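/- Let 2 ≤ p < ∞, 2 ≤ q ≤ ∞, and s > 0 (s = 0 is also allowed when q = 2). There exists C > 0, depending only on φ, Φ, p, q, s, such that for every admissible finite collection 𝓘 = {[a_m,b_m]}_{m=1}^N and every Schwartz function f, setting g_m(x) = e^{−2πi a_m x}(f∗φ_m)(x), one has ‖ ( Σ_{j∈ℤ} 2^{jsq} ( Σ_{m=1}^N |(g_m∗ψ_j)(x)|² )^{q/2} )^{1/q} ‖_{L^p(dx)} ≤ C ‖ ( Σ_{j∈ℤ} (2^{js} |(f∗ψ_j)(x)|)^q )^{1/q} ‖_{L^p(dx)} (with the sums over j replaced by suprema when q = ∞). This is the uniform boundedness of the rotated Rubio de Francia family on the homogeneous Triebel–Lizorkin space Ḟ^s_{pq}. -/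

import Mathlib

open MeasureTheory Real Set Function
open scoped FourierTransform ENNReal NNReal

/-- `e2pi t = e^{2πit}`. -/
noncomputable def e2pi (t : ℝ) : ℂ := Complex.exp (2 * (Real.pi : ℂ) * Complex.I * (t : ℂ))

/-- Convolution of two functions on `ℝ`. -/
noncomputable def conv (f g : ℝ → ℂ) (x : ℝ) : ℂ := ∫ t, f t * g (x - t)

/-- The function `φ_m` associated with the interval `[a,b]`: its Fourier transform is
`ξ ↦ 𝓕φ ((ξ - a)/(b - a))`; in space variables it is `x ↦ (b-a) e^{2πiax} φ((b-a)x)`. -/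
noncomputable def phim (φ : ℝ → ℂ) (a b : ℝ) (x : ℝ) : ℂ :=
  ((b - a : ℝ) : ℂ) * e2pi (a * x) * φ ((b - a) * x)

/-- A finite collection of compact intervals `[a m, b m]` is admissible if the intervals are
nondegenerate, pairwise disjoint, and none of them contains `0` in its interior. -/
def Admissible {N : ℕ} (a b : Fin N → ℝ) : Prop :=
  (∀ m, a m < b m) ∧ (∀ m, (0 : ℝ) ∉ Set.Ioo (a m) (b m)) ∧
    ∀ m m', m ≠ m' → Disjoint (Set.Icc (a m) (b m)) (Set.Icc (a m') (b m'))

/-- The rotated Rubio de Francia piece `g_m(x) = e^{-2πi a x} (f ∗ φ_m)(x)`. -/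
noncomputable def rotConv (φ : ℝ → ℂ) (a b : ℝ) (f : ℝ → ℂ) (x : ℝ) : ℂ :=
  e2pi (-(a * x)) * conv f (phim φ a b) x

/-- Littlewood–Paley block `ψ_j`, whose Fourier transform is `ξ ↦ 𝓕Φ(2^{-j}ξ) - 𝓕Φ(2^{-j+1}ξ)`. -/
noncomputable def psi (Φ : ℝ → ℂ) (j : ℤ) (x : ℝ) : ℂ :=
  (((2:ℝ) ^ j : ℝ) : ℂ) * Φ ((2:ℝ) ^ j * x) - (((2:ℝ) ^ (j-1) : ℝ) : ℂ) * Φ ((2:ℝ) ^ (j-1) * x)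

/-- The `ℓ^q` (quasi)norm of a sequence indexed by `ℤ`, with values in `[0,∞]`;
for `q = ∞` it is the supremum. -/
noncomputable def lqNorm (q : ℝ≥0∞) (F : ℤ → ℝ≥0∞) : ℝ≥0∞ :=
  if q = ∞ then ⨆ j, F j else (∑' j, F j ^ q.toReal) ^ (1 / q.toReal)

/-- powers of two in `[0,∞]` -/
noncomputable def p2 (k : ℤ) : ℝ≥0∞ := ENNReal.ofReal ((2:ℝ)^k)

lemma p2_ne_top (k : ℤ) : p2 k ≠ ∞ := ENNReal.ofReal_ne_top
lemma p2_pos (k : ℤ) : 0 < p2 k := by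
  unfold p2; rw [ENNReal.ofReal_pos]; positivity
lemma p2_ne_zero (k : ℤ) : p2 k ≠ 0 := (p2_pos k).ne'
lemma p2_add (a b : ℤ) : p2 (a + b) = p2 a * p2 b := by
  unfold p2; rw [← ENNReal.ofReal_mul (by positivity), zpow_add₀ (by norm_num)]
lemma p2_zero : p2 0 = 1 := by simp [p2]
lemma p2_mono {a b : ℤ} (h : a ≤ b) : p2 a ≤ p2 b := by
  unfold p2; exact ENNReal.ofReal_le_ofReal (zpow_le_zpow_right₀ (by norm_num) h)
lemma p2_strict {a b : ℤ} (h : a < b) : p2 a < p2 b := by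
  unfold p2
  exact (ENNReal.ofReal_lt_ofReal_iff (by positivity)).2 (zpow_lt_zpow_right₀ (by norm_num) h)
lemma p2_neg_mul (k : ℤ) : p2 (-k) * p2 k = 1 := by rw [← p2_add]; simp [p2_zero]
lemma p2_mul_neg (k : ℤ) : p2 k * p2 (-k) = 1 := by rw [← p2_add]; simp [p2_zero]
lemma p2_one : p2 1 = 2 := by simp [p2]
lemma p2_rpow (k : ℤ) (α : ℝ) : p2 k ^ α = (2:ℝ≥0∞) ^ ((k:ℝ) * α) := by
  unfold p2
  rw [← Real.rpow_intCast, ENNReal.rpow_mul]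
  congr 1
  rw [← ENNReal.ofReal_rpow_of_pos (by norm_num)]
  simp

lemma p2_exists {x : ℝ≥0∞} (h0 : x ≠ 0) (h1 : x ≠ ∞) : ∃ k : ℤ, p2 k < x ∧ x ≤ p2 (k+1) := by
  have hx : 0 < x.toReal := ENNReal.toReal_pos h0 h1
  obtain ⟨k, hk⟩ := exists_mem_Ioc_zpow hx (by norm_num : (1:ℝ) < 2)
  refine ⟨k, ?_, ?_⟩
  · unfold p2
    rw [← ENNReal.ofReal_toReal h1]
    exact (ENNReal.ofReal_lt_ofReal_iff hx).2 hk.1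
  · unfold p2
    rw [← ENNReal.ofReal_toReal h1]
    exact ENNReal.ofReal_le_ofReal hk.2

/-- discrete layer cake sum -/
noncomputable def layer (α : ℝ) (x : ℝ≥0∞) : ℝ≥0∞ := ∑' k : ℤ, if p2 k < x then p2 k ^ α else 0

lemma layer_lower {α : ℝ} (hα : 0 < α) (x : ℝ≥0∞) : x ^ α ≤ 2 ^ α * layer α x := by
  by_cases h0 : x = 0
  · simp [h0, hα]
  by_cases h1 : x = ∞
  · have : layer α x = ∞ := by
      rw [eq_top_iff]
      calc (∞:ℝ≥0∞) = ∑' _ : ℕ, (1:ℝ≥0∞) := (ENNReal.tsum_const_eq_top_of_ne_zero one_ne_zero).symm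
        _ ≤ ∑' n : ℕ, (fun k : ℤ => if p2 k < x then p2 k ^ α else 0) (n:ℤ) := by
            refine ENNReal.tsum_le_tsum fun n => ?_
            simp only [h1, (p2_ne_top _).lt_top, if_true]
            refine ENNReal.one_le_rpow ?_ hα
            rw [← p2_zero]; exact p2_mono (by positivity)
        _ ≤ layer α x := ENNReal.tsum_comp_le_tsum_of_injective Nat.cast_injective _
    rw [this, ENNReal.mul_top]
    · exact le_top
    · simp
  obtain ⟨k, hk, hk'⟩ := p2_exists h0 h1
  calc x ^ α ≤ (p2 (k+1)) ^ α := ENNReal.rpow_le_rpow hk' hα.le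
    _ = 2 ^ α * p2 k ^ α := by
        rw [p2_add, p2_one, ENNReal.mul_rpow_of_nonneg _ _ hα.le, mul_comm]
    _ ≤ 2 ^ α * layer α x := by
        gcongr
        unfold layer
        refine le_trans ?_ (ENNReal.le_tsum k)
        simp [hk]

lemma layer_upper {α : ℝ} (hα : 0 < α) : ∃ C : ℝ≥0∞, C ≠ ∞ ∧ ∀ x, layer α x ≤ C * x ^ α := by
  have hr : (2:ℝ≥0∞) ^ (-α) < 1 := by
    rw [ENNReal.rpow_neg]
    rw [ENNReal.inv_lt_one]
    exact ENNReal.one_lt_rpow (by norm_num) hα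
  refine ⟨∑' i : ℕ, ((2:ℝ≥0∞) ^ (-α)) ^ i, ?_, fun x => ?_⟩
  · rw [ENNReal.tsum_geometric]
    rw [Ne, ENNReal.inv_eq_top, tsub_eq_zero_iff_le]
    exact not_le.2 hr
  by_cases h0 : x = 0
  · simp [layer, h0]
  by_cases h1 : x = ∞
  · rw [h1, ENNReal.top_rpow_of_pos hα, ENNReal.mul_top]
    · exact le_top
    · intro h
      have := (ENNReal.tsum_eq_zero.1 h) 0
      simp at this
  obtain ⟨K, hk, hk'⟩ := p2_exists h0 h1
  have hle : ∀ k, p2 k < x → k ≤ K := by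
    intro k hkx
    by_contra hlt
    push Not at hlt
    exact absurd (lt_of_lt_of_le hkx hk') (not_lt.2 (p2_mono (by omega)))
  have hinj : Function.Injective (fun i : ℕ => K - (i:ℤ)) := by
    intro a b h; simp at h; exact h
  unfold layer
  rw [← hinj.tsum_eq]
  · rw [← ENNReal.tsum_mul_right]
    refine ENNReal.tsum_le_tsum fun i => ?_
    split_ifs
    · rw [sub_eq_add_neg, p2_add, ENNReal.mul_rpow_of_nonneg _ _ hα.le, mul_comm]
      gcongr
      rw [p2_rpow, ← ENNReal.rpow_natCast, ← ENNReal.rpow_mul]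
      apply le_of_eq; congr 1; push_cast; ring
    · exact zero_le
  · intro k hk2
    simp only [Function.mem_support, ne_eq, ite_eq_right_iff, not_forall] at hk2
    obtain ⟨h, -⟩ := hk2
    refine ⟨(K - k).toNat, ?_⟩
    have := hle k h
    simp; omega

/-- dyadic cell of length `2^{-k}` containing `x` -/
def cell (k : ℤ) (x : ℝ) : Set ℝ := {y | ⌊(2:ℝ)^k * y⌋ = ⌊(2:ℝ)^k * x⌋}

lemma mem_cell_self (k : ℤ) (x : ℝ) : x ∈ cell k x := rfl
lemma cell_eq {k : ℤ} {x y : ℝ} (h : y ∈ cell k x) : cell k y = cell k x := by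
  unfold cell at *; simp only [Set.mem_ofPred_eq] at h; rw [h]
lemma mem_cell_symm {k : ℤ} {x y : ℝ} (h : y ∈ cell k x) : x ∈ cell k y := by
  unfold cell at *; exact h.symm

lemma cell_eq_Ico (k : ℤ) (x : ℝ) : cell k x =
    Ico ((⌊(2:ℝ)^k * x⌋:ℝ) * 2^(-k)) ((⌊(2:ℝ)^k * x⌋ + 1:ℝ) * 2^(-k)) := by
  ext y
  have h2 : (0:ℝ) < 2^k := by positivity
  simp only [cell, Set.mem_ofPred_eq, Int.floor_eq_iff, mem_Ico, zpow_neg, ← div_eq_mul_inv]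
  rw [div_le_iff₀ h2, lt_div_iff₀ h2, mul_comm y]

lemma measurableSet_cell (k : ℤ) (x : ℝ) : MeasurableSet (cell k x) := by
  rw [cell_eq_Ico]; exact measurableSet_Ico

lemma volume_cell (k : ℤ) (x : ℝ) : volume (cell k x) = p2 (-k) := by
  rw [cell_eq_Ico, Real.volume_Ico, p2]; congr 1; ring

lemma cell_dist {k : ℤ} {x y : ℝ} (h : y ∈ cell k x) : |y - x| ≤ 2^(-k) := by
  have hx := mem_cell_self k x
  rw [cell_eq_Ico] at h hx
  rw [abs_le]
  constructor <;> nlinarith [h.1, h.2, hx.1, hx.2]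

lemma cell_subset_pred (k : ℤ) (x : ℝ) : cell (k+1) x ⊆ cell k x := by
  intro y hy
  unfold cell at *
  simp only [Set.mem_ofPred_eq] at *
  have h : ∀ z : ℝ, ⌊(2:ℝ)^k * z⌋ = ⌊(2:ℝ)^(k+1) * z⌋ / 2 := by
    intro z
    have := Int.floor_div_natCast (k := ℝ) ((2:ℝ)^(k+1) * z) 2
    rw [zpow_add₀ (by norm_num)] at *
    simp only [zpow_one] at *
    rw [show ((2:ℝ)^k * 2 * z) / ((2:ℕ):ℝ) = 2^k * z by push_cast; ring] at this
    simpa using this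
  rw [h, h, hy]

lemma cell_anti {k l : ℤ} (h : k ≤ l) (x : ℝ) : cell l x ⊆ cell k x := by
  obtain ⟨n, rfl⟩ := Int.le.dest h
  clear h
  induction n with
  | zero => simp
  | succ n ih =>
    refine subset_trans ?_ ih
    have := cell_subset_pred (k + n) x
    push_cast; rw [← add_assoc]; exact this

/-- comparison of measures on unions of cells -/
lemma cell_union_le (μ ν : Measure ℝ) (k : ℤ) (S : Set ℝ)
    (hS : ∀ x ∈ S, cell k x ⊆ S) (h : ∀ x ∈ S, μ (cell k x) ≤ ν (cell k x)) : μ S ≤ ν S := by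
  have hfib : ∀ n : ℤ, MeasurableSet {y : ℝ | ⌊(2:ℝ)^k * y⌋ = n} := fun n => by
    have : Measurable fun y : ℝ => ⌊(2:ℝ)^k * y⌋ := Int.measurable_floor.comp (by fun_prop)
    exact this (measurableSet_singleton n)
  have hdec : ∀ (m : Measure ℝ), m S = ∑' n : ℤ, m (S ∩ {y : ℝ | ⌊(2:ℝ)^k * y⌋ = n}) := by
    intro m
    have hU : S = ⋃ n : ℤ, (S ∩ {y : ℝ | ⌊(2:ℝ)^k * y⌋ = n}) := by
      ext y; simp
    have hcase : ∀ n : ℤ, MeasurableSet (S ∩ {y : ℝ | ⌊(2:ℝ)^k * y⌋ = n}) := by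
      intro n
      by_cases hne : (S ∩ {y : ℝ | ⌊(2:ℝ)^k * y⌋ = n}).Nonempty
      · obtain ⟨x, hx, hxn⟩ := hne
        have : S ∩ {y : ℝ | ⌊(2:ℝ)^k * y⌋ = n} = cell k x := by
          simp only [Set.mem_ofPred_eq] at hxn
          subst hxn
          exact inter_eq_right.2 (hS x hx)
        rw [this]; exact measurableSet_cell k x
      · rw [not_nonempty_iff_eq_empty.1 hne]; exact MeasurableSet.empty
    conv_lhs => rw [hU]
    rw [measure_iUnion _ hcase]
    intro a b hab
    refine Set.disjoint_left.2 ?_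
    rintro y ⟨-, h1⟩ ⟨-, h2⟩
    exact hab (h1.symm.trans h2)
  rw [hdec μ, hdec ν]
  refine ENNReal.tsum_le_tsum fun n => ?_
  by_cases hne : (S ∩ {y : ℝ | ⌊(2:ℝ)^k * y⌋ = n}).Nonempty
  · obtain ⟨x, hx, hxn⟩ := hne
    have : S ∩ {y : ℝ | ⌊(2:ℝ)^k * y⌋ = n} = cell k x := by
      simp only [Set.mem_ofPred_eq] at hxn
      subst hxn
      exact inter_eq_right.2 (hS x hx)
    rw [this]; exact h x hx
  · rw [not_nonempty_iff_eq_empty.1 hne]; simp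

lemma cell_union_meas (k : ℤ) (S : Set ℝ) (hS : ∀ x ∈ S, cell k x ⊆ S) : MeasurableSet S := by
  have : S = (fun y : ℝ => ⌊(2:ℝ)^k * y⌋) ⁻¹' ((fun y : ℝ => ⌊(2:ℝ)^k * y⌋) '' S) := by
    ext y; constructor
    · intro hy; exact ⟨y, hy, rfl⟩
    · rintro ⟨x, hx, hxy⟩; exact hS x hx hxy.symm
  rw [this]
  have hm : Measurable fun y : ℝ => ⌊(2:ℝ)^k * y⌋ := Int.measurable_floor.comp (by fun_prop)
  exact hm (MeasurableSet.of_discrete)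

lemma halting_lem (μ ν : Measure ℝ) (k0 : ℤ) (P : ℕ → ℝ → Prop)
    (hinv : ∀ (i : ℕ) x y, y ∈ cell (k0+i) x → P i x → P i y)
    (h : ∀ i x, P i x → (∀ i' < i, ¬ P i' x) → μ (cell (k0+i) x) ≤ ν (cell (k0+i) x)) :
    μ {x | ∃ i, P i x} ≤ ν {x | ∃ i, P i x} := by
  set S : ℕ → Set ℝ := fun i => {x | P i x ∧ ∀ i' < i, ¬ P i' x} with hS
  have hU : {x | ∃ i, P i x} = ⋃ i, S i := by
    ext x
    simp only [Set.mem_ofPred_eq, mem_iUnion, hS]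
    constructor
    · intro hx
      classical
      exact ⟨Nat.find hx, Nat.find_spec hx, fun i' hi' => Nat.find_min hx hi'⟩
    · rintro ⟨i, hi, -⟩; exact ⟨i, hi⟩
  have hcell : ∀ i, ∀ x ∈ S i, cell (k0+i) x ⊆ S i := by
    rintro i x ⟨hx, hx'⟩ y hy
    refine ⟨hinv i x y hy hx, fun i' hi' hP => hx' i' hi' ?_⟩
    have : y ∈ cell (k0+i') x := cell_anti (by omega) x hy
    exact hinv i' y x (mem_cell_symm this) hP
  have hm : ∀ i, MeasurableSet (S i) := fun i => cell_union_meas _ _ (hcell i)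
  have hd : Pairwise (Function.onFun Disjoint S) := by
    intro i j hij
    refine Set.disjoint_left.2 ?_
    rintro x ⟨h1, h2⟩ ⟨h3, h4⟩
    rcases lt_or_gt_of_ne hij with hlt | hlt
    · exact h4 i hlt h1
    · exact h2 j hlt h3
  rw [hU, measure_iUnion hd hm, measure_iUnion hd hm]
  refine ENNReal.tsum_le_tsum fun i => cell_union_le μ ν (k0+i) _ (hcell i) ?_
  rintro x ⟨hx, hx'⟩
  exact h i x hx hx'

/-- dyadic average -/
noncomputable def dA (k : ℤ) (w : ℝ → ℝ≥0∞) (x : ℝ) : ℝ≥0∞ := p2 k * ∫⁻ y in cell k x, w y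

lemma dA_congr {k : ℤ} {x y : ℝ} (h : y ∈ cell k x) (w : ℝ → ℝ≥0∞) : dA k w y = dA k w x := by
  unfold dA; rw [cell_eq h]

lemma lt_dA {k : ℤ} {w : ℝ → ℝ≥0∞} {x : ℝ} {l : ℝ≥0∞} (h : l < dA k w x) :
    l * p2 (-k) ≤ ∫⁻ y in cell k x, w y := by
  calc l * p2 (-k) ≤ dA k w x * p2 (-k) := by gcongr
    _ = ∫⁻ y in cell k x, w y := by
      unfold dA; rw [mul_right_comm, p2_mul_neg, one_mul]

lemma dA_le_iff {k : ℤ} {w : ℝ → ℝ≥0∞} {x : ℝ} {l : ℝ≥0∞} :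
    dA k w x ≤ l ↔ ∫⁻ y in cell k x, w y ≤ l * p2 (-k) := by
  unfold dA
  constructor
  · intro h
    calc _ = (p2 k * ∫⁻ y in cell k x, w y) * p2 (-k) := by
            rw [mul_right_comm, p2_mul_neg, one_mul]
      _ ≤ _ := by gcongr
  · intro h
    calc _ ≤ p2 k * (l * p2 (-k)) := by gcongr
      _ = l := by rw [mul_left_comm, p2_mul_neg, mul_one]

lemma weak_dyadic0 (k0 : ℤ) {w : ℝ → ℝ≥0∞} (l : ℝ≥0∞) :
    l * volume {x | ∃ i : ℕ, l < dA (k0+i) w x} ≤ ∫⁻ y, w y := by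
  have := halting_lem (l • volume) (volume.withDensity w) k0 (fun i x => l < dA (k0+i) w x)
    (fun i x y hy h => by rw [dA_congr hy]; exact h) (by
      intro i x h _
      rw [withDensity_apply _ (measurableSet_cell _ _)]
      simp only [Measure.smul_apply, smul_eq_mul, volume_cell]
      exact lt_dA h)
  refine le_trans (by simpa using this) ?_
  refine le_trans (measure_mono (subset_univ _)) ?_
  rw [withDensity_apply _ MeasurableSet.univ]; simp

lemma weak_lim (S : ℤ → Set ℝ) (hS : ∀ k l, k ≤ l → S l ⊆ S k) (l B : ℝ≥0∞)
    (h : ∀ k, l * volume (S k) ≤ B) : l * volume (⋃ k, S k) ≤ B := by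
  have : Directed (· ⊆ ·) S := by
    intro a b
    exact ⟨min a b, hS _ _ (min_le_left _ _), hS _ _ (min_le_right _ _)⟩
  rw [this.measure_iUnion, ENNReal.mul_iSup]
  exact iSup_le h

lemma exists_ge_iff (k0 : ℤ) (Q : ℤ → Prop) : (∃ i : ℕ, Q (k0 + i)) ↔ ∃ k, k0 ≤ k ∧ Q k := by
  constructor
  · rintro ⟨i, h⟩; exact ⟨_, by omega, h⟩
  · rintro ⟨k, h, h'⟩
    refine ⟨(k-k0).toNat, ?_⟩
    rwa [show k0 + ((k-k0).toNat:ℤ) = k by omega]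

lemma weak_dyadic {w : ℝ → ℝ≥0∞} (l : ℝ≥0∞) :
    l * volume {x | ∃ k : ℤ, l < dA k w x} ≤ ∫⁻ y, w y := by
  have := weak_lim (fun k0 => {x | ∃ i : ℕ, l < dA (k0+i) w x}) (by
      intro a b hab x
      simp only [Set.mem_ofPred_eq, exists_ge_iff _ (fun k => l < dA k w x)]
      rintro ⟨k, h, h'⟩; exact ⟨k, by omega, h'⟩) l _ (fun k0 => weak_dyadic0 (w := w) k0 l)
  refine le_trans ?_ this
  gcongr
  intro x hx
  obtain ⟨k, hk⟩ := hx
  exact mem_iUnion.2 ⟨k, 0, by simpa using hk⟩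

/-- Hardy-Littlewood type maximal function -/
noncomputable def HL (w : ℝ → ℝ≥0∞) (x : ℝ) : ℝ≥0∞ :=
  ⨆ k : ℤ, p2 k * ∫⁻ y in {y | |y - x| ≤ 2^(-k)}, w y

lemma near_cell {k : ℤ} {x y : ℝ} (h : |y - x| ≤ 2^(-k)) :
    y ∈ cell k x ∨ y ∈ cell k (x + 2^(-k)) ∨ y ∈ cell k (x - 2^(-k)) := by
  have h2 : (2:ℝ)^k * 2^(-k) = 1 := by rw [← zpow_add₀ (by norm_num)]; simp
  have hp : (0:ℝ) < 2^k := by positivity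
  simp only [cell, Set.mem_ofPred_eq, mul_add, mul_sub, h2]
  rw [Int.floor_add_one, Int.floor_sub_one]
  have h3 : |2^k * y - 2^k*x| ≤ 1 := by
    rw [← mul_sub, abs_mul, abs_of_pos hp, ← h2]; gcongr
  rw [abs_le] at h3
  have a1 := Int.floor_le ((2:ℝ)^k*x)
  have a2 := Int.lt_floor_add_one ((2:ℝ)^k*x)
  have b1 := Int.floor_le ((2:ℝ)^k*y)
  have b2 := Int.lt_floor_add_one ((2:ℝ)^k*y)
  have c1 : ⌊(2:ℝ)^k*y⌋ < ⌊(2:ℝ)^k*x⌋ + 2 := by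
    have : (⌊(2:ℝ)^k*y⌋:ℝ) < ((⌊(2:ℝ)^k*x⌋ + 2 : ℤ):ℝ) := by push_cast; linarith
    exact_mod_cast this
  have c2 : ⌊(2:ℝ)^k*x⌋ < ⌊(2:ℝ)^k*y⌋ + 2 := by
    have : (⌊(2:ℝ)^k*x⌋:ℝ) < ((⌊(2:ℝ)^k*y⌋ + 2 : ℤ):ℝ) := by push_cast; linarith
    exact_mod_cast this
  omega

lemma ball_le_dA (k : ℤ) (w : ℝ → ℝ≥0∞) (x : ℝ) :
    p2 k * ∫⁻ y in {y | |y - x| ≤ 2^(-k)}, w y ≤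
      dA k w x + dA k w (x + 2^(-k)) + dA k w (x - 2^(-k)) := by
  unfold dA
  rw [← mul_add, ← mul_add]
  gcongr
  calc ∫⁻ y in {y | |y - x| ≤ 2^(-k)}, w y
      ≤ ∫⁻ y in (cell k x ∪ cell k (x + 2^(-k))) ∪ cell k (x - 2^(-k)), w y := by
        apply lintegral_mono_set
        intro y hy
        have := near_cell (k := k) hy
        simp only [mem_union]; tauto
    _ ≤ _ := by
        refine (lintegral_union_le _ _ _).trans ?_
        gcongr
        exact lintegral_union_le _ _ _

lemma weak_HL0 (k0 : ℤ) {w : ℝ → ℝ≥0∞} (l : ℝ≥0∞) :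
    l * volume {x | ∃ i : ℕ, 3 * l < p2 (k0+i) * ∫⁻ y in {y | |y - x| ≤ 2^(-(k0+i))}, w y}
      ≤ 3 * ∫⁻ y, w y := by
  set P : ℕ → ℝ → Prop := fun i x => l < dA (k0+i) w x with hP
  set S : ℕ → Set ℝ := fun i => {x | P i x ∧ ∀ i' < i, ¬ P i' x} with hS
  have hinv : ∀ (i : ℕ) x y, y ∈ cell (k0+i) x → P i x → P i y := by
    intro i x y hy h; simp only [hP] at *; rw [dA_congr hy]; exact h
  have hcell : ∀ i, ∀ x ∈ S i, cell (k0+i) x ⊆ S i := by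
    rintro i x ⟨hx, hx'⟩ y hy
    refine ⟨hinv i x y hy hx, fun i' hi' hP => hx' i' hi' ?_⟩
    have : y ∈ cell (k0+i') x := cell_anti (by omega) x hy
    exact hinv i' y x (mem_cell_symm this) hP
  have hm : ∀ i, MeasurableSet (S i) := fun i => cell_union_meas _ _ (hcell i)
  have hd : Pairwise (Function.onFun Disjoint S) := by
    intro i j hij
    refine Set.disjoint_left.2 ?_
    rintro x ⟨h1, h2⟩ ⟨h3, h4⟩
    rcases lt_or_gt_of_ne hij with hlt | hlt
    · exact h4 i hlt h1
    · exact h2 j hlt h3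
  have hfind : ∀ i x, P i x → ∃ j ≤ i, x ∈ S j := by
    intro i x hx
    classical
    have hx' : ∃ i, P i x := ⟨i, hx⟩
    exact ⟨Nat.find hx', Nat.find_min' hx' hx, Nat.find_spec hx', fun i' hi' => Nat.find_min hx' hi'⟩
  have hsub : {x | ∃ i : ℕ, 3 * l < p2 (k0+i) * ∫⁻ y in {y | |y - x| ≤ 2^(-(k0+i))}, w y} ⊆
      ⋃ j, (S j ∪ (fun x => x + (-(2:ℝ)^(-(k0+j)))) ⁻¹' S j ∪ (fun x => x + (2:ℝ)^(-(k0+j))) ⁻¹' S j) := by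
    rintro x ⟨i, hi⟩
    have hz : ∃ z, |z - x| ≤ 2^(-(k0+i:ℤ)) ∧ P i z := by
      by_contra hcon
      push Not at hcon
      have hpos : (0:ℝ) < 2^(-(k0+i:ℤ)) := by positivity
      have h1 := hcon x (by rw [sub_self, abs_zero]; exact hpos.le)
      have h2 := hcon (x + 2^(-(k0+i:ℤ))) (by rw [add_sub_cancel_left, abs_of_pos hpos])
      have h3 := hcon (x - 2^(-(k0+i:ℤ))) (by rw [sub_sub_cancel_left, abs_neg, abs_of_pos hpos])
      simp only [hP, not_lt] at h1 h2 h3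
      refine absurd (hi.trans_le (ball_le_dA _ w x)) (not_lt.2 ?_)
      calc _ ≤ l + l + l := by gcongr
        _ = 3 * l := by ring
    obtain ⟨z, hzx, hz⟩ := hz
    obtain ⟨j, hji, hj⟩ := hfind i z hz
    refine mem_iUnion.2 ⟨j, ?_⟩
    have hle : |z - x| ≤ 2^(-(k0+j:ℤ)) := hzx.trans (zpow_le_zpow_right₀ (by norm_num) (by omega))
    simp only [mem_union, mem_preimage]
    rcases near_cell hle with h | h | h
    · left; left; exact hcell j z hj (mem_cell_symm h)
    · right; exact hcell j z hj (mem_cell_symm h)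
    · left; right; rw [← sub_eq_add_neg]; exact hcell j z hj (mem_cell_symm h)
  have hvol : volume (⋃ j, (S j ∪ (fun x => x + (-(2:ℝ)^(-(k0+j)))) ⁻¹' S j ∪ (fun x => x + (2:ℝ)^(-(k0+j))) ⁻¹' S j))
      ≤ 3 * volume (⋃ j, S j) := by
    refine (measure_iUnion_le _).trans ?_
    rw [measure_iUnion hd hm, ← ENNReal.tsum_mul_left]
    refine ENNReal.tsum_le_tsum fun j => ?_
    refine (measure_union_le _ _).trans ?_
    refine (add_le_add_left (measure_union_le _ _) _).trans ?_
    rw [measure_preimage_add_right, measure_preimage_add_right]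
    apply le_of_eq; ring
  calc _ ≤ l * (3 * volume (⋃ j, S j)) := by gcongr; exact (measure_mono hsub).trans hvol
    _ = 3 * (l * volume (⋃ j, S j)) := by ring
    _ ≤ 3 * ∫⁻ y, w y := by
      gcongr
      refine le_trans ?_ (weak_dyadic0 (w := w) k0 l)
      gcongr
      refine iUnion_subset fun j x hx => ⟨j, hx.1⟩

lemma weak_HL {w : ℝ → ℝ≥0∞} (l : ℝ≥0∞) :
    l * volume {x | 3 * l < HL w x} ≤ 3 * ∫⁻ y, w y := by
  have := weak_lim (fun k0 => {x | ∃ i : ℕ, 3 * l < p2 (k0+i) * ∫⁻ y in {y | |y - x| ≤ 2^(-(k0+i))}, w y}) (by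
      intro a b hab x
      simp only [Set.mem_ofPred_eq, exists_ge_iff _ (fun k => 3 * l < p2 k * ∫⁻ y in {y | |y - x| ≤ 2^(-k)}, w y)]
      rintro ⟨k, h, h'⟩; exact ⟨k, by omega, h'⟩) l _ (fun k0 => weak_HL0 (w := w) k0 l)
  refine le_trans ?_ this
  gcongr
  intro x hx
  simp only [HL, Set.mem_ofPred_eq, lt_iSup_iff] at hx
  obtain ⟨k, hk⟩ := hx
  exact mem_iUnion.2 ⟨k, 0, by simpa using hk⟩

lemma HL_meas {w : ℝ → ℝ≥0∞} (hw : Measurable w) : Measurable (HL w) := by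
  unfold HL
  refine Measurable.iSup fun k => Measurable.const_mul ?_ _
  have : (fun x => ∫⁻ y in {y | |y - x| ≤ 2^(-k)}, w y) =
      fun x : ℝ => ∫⁻ y : ℝ, ({z : ℝ × ℝ | |z.2 - z.1| ≤ 2^(-k)}.indicator (fun z => w z.2)) (x, y) := by
    ext x
    rw [← lintegral_indicator]
    · rfl
    · exact measurableSet_le (by fun_prop) (by fun_prop)
  rw [this]
  apply Measurable.lintegral_prod_right'
  exact (hw.comp measurable_snd).indicator (measurableSet_le (by fun_prop) (by fun_prop))

lemma vol_near (k : ℤ) (x : ℝ) : volume {y : ℝ | |y - x| ≤ 2^(-k)} = 2 * p2 (-k) := by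
  have : {y : ℝ | |y - x| ≤ 2^(-k)} = Icc (x - 2^(-k)) (x + 2^(-k)) := by
    ext y; simp only [Set.mem_ofPred_eq, abs_le, mem_Icc]; constructor <;> rintro ⟨h1, h2⟩ <;> constructor <;> linarith
  rw [this, Real.volume_Icc, p2, ← ENNReal.ofReal_ofNat, ← ENNReal.ofReal_mul (by norm_num)]
  congr 1; ring

lemma HL_mono {w v : ℝ → ℝ≥0∞} (h : ∀ x, w x ≤ v x) (x : ℝ) : HL w x ≤ HL v x := by
  unfold HL; gcongr; exact h _

lemma HL_split {w : ℝ → ℝ≥0∞} (hw : Measurable w) (l : ℝ≥0∞) (x : ℝ) :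
    HL w x ≤ 2 * l + HL ({y | l < w y}.indicator w) x := by
  unfold HL
  refine iSup_le fun k => ?_
  calc p2 k * ∫⁻ y in {y | |y - x| ≤ 2^(-k)}, w y
      ≤ p2 k * ∫⁻ y in {y | |y - x| ≤ 2^(-k)}, (l + {y | l < w y}.indicator w y) := by
        gcongr with y
        by_cases h : l < w y
        · rw [indicator_of_mem (by exact h)]; exact le_add_self
        · exact (not_lt.1 h).trans le_self_add
    _ = 2 * l + p2 k * ∫⁻ y in {y | |y - x| ≤ 2^(-k)}, ({y | l < w y}.indicator w y) := by
        rw [lintegral_add_left measurable_const, mul_add, lintegral_const,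
          Measure.restrict_apply_univ, vol_near]
        congr 1
        rw [show p2 k * (l * (2 * p2 (-k))) = 2 * l * (p2 k * p2 (-k)) by ring, p2_mul_neg, mul_one]
    _ ≤ _ := by
        gcongr
        exact le_iSup (fun k => p2 k * ∫⁻ y in {y | |y - x| ≤ 2^(-k)}, ({y | l < w y}.indicator w y)) k

lemma layer_lintegral {α : ℝ} {g : ℝ → ℝ≥0∞} (hg : Measurable g) :
    ∫⁻ x, layer α (g x) = ∑' k : ℤ, p2 k ^ α * volume {x | p2 k < g x} := by
  unfold layer
  rw [lintegral_tsum]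
  · congr 1; ext k
    have hm : MeasurableSet {x | p2 k < g x} := measurableSet_lt measurable_const hg
    rw [← lintegral_indicator_const hm]
    congr 1; ext a
    by_cases h : p2 k < g a <;> simp [h]
  · intro k
    exact (Measurable.ite (measurableSet_lt measurable_const hg) measurable_const measurable_const).aemeasurable

theorem maximal_Lp {α : ℝ} (hα : 1 < α) : ∃ C : ℝ≥0∞, C ≠ ∞ ∧ ∀ w : ℝ → ℝ≥0∞, Measurable w →
    ∫⁻ x, HL w x ^ α ≤ C * ∫⁻ x, w x ^ α := by
  obtain ⟨C, hC, hlay⟩ := layer_upper (α := α - 1) (by linarith)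
  refine ⟨2 ^ α * (3 * 8 ^ α * C), ?_, fun w hw => ?_⟩
  · refine ENNReal.mul_ne_top (ENNReal.rpow_ne_top_of_nonneg (by linarith) (by simp)) (ENNReal.mul_ne_top (ENNReal.mul_ne_top (by simp) ?_) hC)
    exact ENNReal.rpow_ne_top_of_nonneg (by linarith) (by simp)
  have h8 : p2 3 = 8 := by simp [p2]; norm_num
  calc ∫⁻ x, HL w x ^ α ≤ ∫⁻ x, 2 ^ α * layer α (HL w x) := by
        gcongr with x; exact layer_lower (by linarith) _
    _ = 2 ^ α * ∫⁻ x, layer α (HL w x) := by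
        rw [lintegral_const_mul' _ _ (ENNReal.rpow_ne_top_of_nonneg (by linarith) (by simp))]
    _ = 2 ^ α * ∑' k : ℤ, p2 k ^ α * volume {x | p2 k < HL w x} := by
        rw [layer_lintegral (HL_meas hw)]
    _ = 2 ^ α * ∑' k : ℤ, p2 (k+3) ^ α * volume {x | p2 (k+3) < HL w x} := by
        congr 1
        exact ((Equiv.addRight (3:ℤ)).tsum_eq (fun k : ℤ => p2 k ^ α * volume {x | p2 k < HL w x})).symm
    _ ≤ 2 ^ α * ∑' k : ℤ, 3 * 8 ^ α * ∫⁻ y, (if p2 k < w y then p2 k ^ (α-1) else 0) * w y := by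
        refine mul_le_mul_right (ENNReal.tsum_le_tsum fun k => ?_) _
        rw [p2_add, h8, ENNReal.mul_rpow_of_nonneg _ _ (by linarith)]
        have hk : p2 k ^ α = p2 k ^ (α - 1) * p2 k := by
          nth_rewrite 3 [← ENNReal.rpow_one (p2 k)]
          rw [← ENNReal.rpow_add _ _ (p2_ne_zero k) (p2_ne_top k)]; congr 1; ring
        have hw1 := weak_HL (w := {y | p2 k < w y}.indicator w) (p2 k)
        have hsub : {x | p2 k * 8 < HL w x} ⊆ {x | 3 * p2 k < HL ({y | p2 k < w y}.indicator w) x} := by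
          intro x hx
          simp only [Set.mem_ofPred_eq] at *
          by_contra hcon
          push Not at hcon
          refine absurd (hx.trans_le ((HL_split hw (p2 k) x).trans (add_le_add_right hcon _))) (not_lt.2 ?_)
          rw [← add_mul, mul_comm]; gcongr; norm_num
        calc p2 k ^ α * 8 ^ α * volume {x | p2 k * 8 < HL w x}
            ≤ p2 k ^ (α-1) * p2 k * 8 ^ α * volume {x | 3 * p2 k < HL ({y | p2 k < w y}.indicator w) x} := by
              rw [hk]; gcongr
          _ = p2 k ^ (α-1) * 8 ^ α * (p2 k * volume {x | 3 * p2 k < HL ({y | p2 k < w y}.indicator w) x}) := by ring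
          _ ≤ p2 k ^ (α-1) * 8 ^ α * (3 * ∫⁻ y, {y | p2 k < w y}.indicator w y) := by gcongr
          _ = 3 * 8 ^ α * (p2 k ^ (α-1) * ∫⁻ y, {y | p2 k < w y}.indicator w y) := by ring
          _ = _ := by
              congr 1
              rw [← lintegral_const_mul' _ _ (ENNReal.rpow_ne_top_of_nonneg (by linarith) (p2_ne_top k))]
              congr 1; ext y
              by_cases h : p2 k < w y <;> simp [h]
    _ = 2 ^ α * (3 * 8 ^ α * ∫⁻ y, layer (α-1) (w y) * w y) := by
        rw [ENNReal.tsum_mul_left, ← lintegral_tsum]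
        · congr 3; ext y; rw [ENNReal.tsum_mul_right]; rfl
        · intro k
          exact ((Measurable.ite (measurableSet_lt measurable_const hw) measurable_const measurable_const).mul hw).aemeasurable
    _ ≤ 2 ^ α * (3 * 8 ^ α * ∫⁻ y, C * w y ^ α) := by
        refine mul_le_mul_right (mul_le_mul_right (lintegral_mono fun y => ?_) _) _
        refine (mul_le_mul_left (hlay (w y)) _).trans ?_
        rw [mul_assoc]; gcongr
        nth_rewrite 2 [← ENNReal.rpow_one (w y)]
        rw [← ENNReal.rpow_add_of_nonneg _ _ (by linarith) (by linarith)]; simp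
    _ = _ := by rw [lintegral_const_mul' _ _ hC]; ring

lemma dA_meas (k : ℤ) (w : ℝ → ℝ≥0∞) : Measurable (dA k w) := by
  refine measurable_of_Ioi fun l => cell_union_meas k _ ?_
  intro x hx y hy
  simp only [mem_preimage, mem_Ioi] at *
  rwa [dA_congr hy]

lemma le_dA_of_le {k : ℤ} {w : ℝ → ℝ≥0∞} {x : ℝ} {l : ℝ≥0∞} (h : ∀ y ∈ cell k x, l ≤ w y) :
    l ≤ dA k w x := by
  unfold dA
  calc l = p2 k * (l * p2 (-k)) := by rw [mul_left_comm, p2_mul_neg, mul_one]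
    _ = p2 k * ∫⁻ _ in cell k x, l := by rw [setLIntegral_const, volume_cell]
    _ ≤ _ := by gcongr 1; exact setLIntegral_mono' (measurableSet_cell k x) h

lemma dA_const_add (k : ℤ) (w : ℝ → ℝ≥0∞) (x : ℝ) (l : ℝ≥0∞) :
    dA k (fun y => l + w y) x = l + dA k w x := by
  unfold dA
  rw [lintegral_add_left measurable_const, mul_add, setLIntegral_const, volume_cell,
    mul_left_comm, p2_mul_neg, mul_one]

lemma dA_mono_on {k : ℤ} {w v : ℝ → ℝ≥0∞} {x : ℝ} (h : ∀ y ∈ cell k x, w y ≤ v y) :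
    dA k w x ≤ dA k v x := by
  unfold dA; gcongr 1; exact setLIntegral_mono' (measurableSet_cell k x) h

lemma cell_small {x : ℝ} {U : Set ℝ} (hU : U ∈ nhds x) : ∃ k : ℤ, cell k x ⊆ U := by
  obtain ⟨ε, hε, hb⟩ := Metric.mem_nhds_iff.1 hU
  obtain ⟨n, hn⟩ := exists_pow_lt_of_lt_one hε (by norm_num : (1/2:ℝ) < 1)
  refine ⟨n, fun y hy => hb ?_⟩
  rw [Metric.mem_ball, Real.dist_eq]
  refine (cell_dist hy).trans_lt ?_
  simpa using hn

lemma le_dyadicMax {w : ℝ → ℝ≥0∞} (hw : Continuous w) (x : ℝ) : w x ≤ ⨆ k, dA k w x := by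
  refine le_of_forall_lt fun l hl => ?_
  obtain ⟨l', h1, h2⟩ := exists_between hl
  obtain ⟨k, hk⟩ := cell_small (hw.continuousAt.preimage_mem_nhds (Ioi_mem_nhds h2))
  exact h1.trans_le ((le_dA_of_le fun y hy => (hk hy).le).trans (le_iSup (fun k => dA k w x) k))

lemma enorm_sq_split (z c : ℂ) : ‖z‖ₑ^2 ≤ 2 * ‖z - c‖ₑ^2 + 2 * ‖c‖ₑ^2 := by
  have h : ‖z‖^2 ≤ 2 * ‖z-c‖^2 + 2*‖c‖^2 := by
    have := norm_le_norm_sub_add z c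
    nlinarith [norm_nonneg z, norm_nonneg c, norm_nonneg (z-c), sq_nonneg (‖z-c‖ - ‖c‖)]
  simp only [← ofReal_norm_eq_enorm, ← ENNReal.ofReal_pow (norm_nonneg _)]
  rw [← ENNReal.ofReal_ofNat, ← ENNReal.ofReal_mul (by norm_num), ← ENNReal.ofReal_mul (by norm_num), ← ENNReal.ofReal_add (by positivity) (by positivity)]
  exact ENNReal.ofReal_le_ofReal h

lemma goodlambda {ι : Type} [Fintype ι] (G : ι → ℝ → ℂ) (hG : ∀ i, Continuous (G i))
    (A : ℝ → ℝ≥0∞) (hA : Measurable A) (hfin : ∫⁻ x, ∑ i, ‖G i x‖ₑ^2 ≠ ∞)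
    (hosc : ∀ k x, ∃ c : ι → ℂ, ∀ y' ∈ cell k x, dA k (fun y => ∑ i, ‖G i y - c i‖ₑ^2) x ≤ A y')
    (n : ℤ) (r : ℕ) :
    volume {x | p2 (n+4) < ⨆ k, dA k (fun y => ∑ i, ‖G i y‖ₑ^2) x} ≤
      p2 (-r-1) * volume {x | p2 n < ⨆ k, dA k (fun y => ∑ i, ‖G i y‖ₑ^2) x} +
      volume {x | p2 (n-r) < A x} := by
  set W : ℝ → ℝ≥0∞ := fun y => ∑ i, ‖G i y‖ₑ^2 with hW
  have hWc : Continuous W := by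
    refine continuous_finsetSum _ fun i _ => ?_
    exact (ENNReal.continuous_pow 2).comp (hG i).enorm
  obtain ⟨k0, hk0⟩ : ∃ k0 : ℤ, p2 k0 * ∫⁻ x, W x ≤ p2 n := by
    by_cases h0 : ∫⁻ x, W x = 0
    · exact ⟨0, by rw [h0]; simp⟩
    obtain ⟨K, -, hK⟩ := p2_exists h0 hfin
    refine ⟨n - (K+1), ?_⟩
    calc _ ≤ p2 (n - (K+1)) * p2 (K+1) := by gcongr
      _ = p2 n := by rw [← p2_add]; congr 1; ring
  have hsmall : ∀ k ≤ k0, ∀ x, dA k W x ≤ p2 n := by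
    intro k hk x
    refine le_trans ?_ hk0
    unfold dA
    exact mul_le_mul' (p2_mono hk) (setLIntegral_le_lintegral _ _)
  have hE : {x | p2 n < ⨆ k, dA k W x} = {x | ∃ i : ℕ, p2 n < dA (k0+i) W x} := by
    ext x
    simp only [Set.mem_ofPred_eq, lt_iSup_iff, exists_ge_iff _ (fun k => p2 n < dA k W x)]
    constructor
    · rintro ⟨k, hk⟩
      refine ⟨k, ?_, hk⟩
      by_contra hlt
      exact absurd hk (not_lt.2 (hsmall k (by omega) x))
    · rintro ⟨k, -, hk⟩; exact ⟨k, hk⟩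
  set F : Set ℝ := {x | p2 (n+4) < ⨆ k, dA k W x} with hF
  have hFE : F ⊆ {x | p2 n < ⨆ k, dA k W x} := by
    intro x hx
    exact lt_of_le_of_lt (p2_mono (by omega)) hx
  have hFm : MeasurableSet F := measurableSet_lt measurable_const (Measurable.iSup fun k => dA_meas k W)
  have hAm : MeasurableSet {x | p2 (n-r) < A x} := measurableSet_lt measurable_const hA
  have key := halting_lem (volume.restrict F) (p2 (-r-1) • volume + volume.restrict {x | p2 (n-r) < A x}) k0
    (fun i x => p2 n < dA (k0+i) W x)
    (fun i x y hy h => by rw [dA_congr hy]; exact h) (by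
      intro i x hi hmin
      simp only [Measure.add_apply, Measure.smul_apply, smul_eq_mul]
      rw [Measure.restrict_apply (measurableSet_cell _ _), Measure.restrict_apply (measurableSet_cell _ _)]
      set Q := cell (k0+i) x with hQ
      by_cases hQA : Q ⊆ {x | p2 (n-r) < A x}
      · rw [inter_eq_left.2 hQA]
        exact (measure_mono inter_subset_left).trans le_add_self
      refine le_trans ?_ le_self_add
      rw [not_subset] at hQA
      obtain ⟨y', hy'Q, hy'⟩ := hQA
      simp only [Set.mem_ofPred_eq, not_lt] at hy'
      have hsub : Q ⊆ cell (k0+i-1) x := cell_anti (by omega) x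
      obtain ⟨c, hc⟩ := hosc (k0+i-1) x
      have hc1 := (hc y' (hsub hy'Q)).trans hy'
      set V : ℝ → ℝ≥0∞ := fun y => ∑ i, ‖G i y - c i‖ₑ^2 with hV
      have hVc : Continuous V := by
        refine continuous_finsetSum _ fun i _ => ?_
        exact (ENNReal.continuous_pow 2).comp ((hG i).sub continuous_const).enorm
      have hprev : ∀ k < k0 + i, ∀ y ∈ Q, dA k W y ≤ p2 n := by
        intro k hk y hy
        by_cases hk' : k ≤ k0
        · exact hsmall k hk' y
        have := hmin (k - k0).toNat (by omega)
        rw [show k0 + ((k-k0).toNat:ℤ) = k by omega, not_lt] at this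
        rw [dA_congr (cell_anti (by omega) x hy)]; exact this
      have hcc : ∑ i, ‖c i‖ₑ^2 ≤ p2 (n+2) := by
        have h1 : ∑ i, ‖c i‖ₑ^2 ≤ dA (k0+i-1) (fun y => 2 * V y + 2 * W y) x := by
          refine le_dA_of_le fun y _ => ?_
          simp only [hV, hW, Finset.mul_sum, ← Finset.sum_add_distrib]
          refine Finset.sum_le_sum fun i _ => ?_
          have := enorm_sq_split (c i) (c i - G i y)
          rw [sub_sub_cancel, add_comm, ← enorm_neg (c i - G i y), neg_sub] at this
          exact this
        refine h1.trans ?_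
        have h2 : dA (k0+i-1) (fun y => 2 * V y + 2 * W y) x
            = 2 * dA (k0+i-1) V x + 2 * dA (k0+i-1) W x := by
          unfold dA
          rw [lintegral_add_left (by fun_prop), lintegral_const_mul _ (by fun_prop), lintegral_const_mul _ (by fun_prop)]
          ring
        rw [h2]
        calc _ ≤ 2 * p2 n + 2 * p2 n := by
              gcongr
              · exact hc1.trans (p2_mono (by omega))
              · exact hprev _ (by omega) x (mem_cell_self _ _)
          _ = p2 (n+2) := by
              rw [p2_add, show p2 2 = 4 by simp [p2]; norm_num]; ring
      have hsubF : Q ∩ F ⊆ {y | ∃ l : ℤ, p2 (n+2) < dA l (Q.indicator V) y} := by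
        rintro y ⟨hyQ, hyF⟩
        simp only [hF, Set.mem_ofPred_eq, lt_iSup_iff] at hyF
        obtain ⟨l, hl⟩ := hyF
        have hlk : k0 + i ≤ l := by
          by_contra hlt
          push Not at hlt
          exact absurd (hl.trans_le (hprev l hlt y hyQ)) (not_lt.2 (p2_mono (by omega)))
        refine ⟨l, ?_⟩
        by_contra hcon
        push Not at hcon
        refine absurd hl (not_lt.2 ?_)
        calc dA l W y ≤ dA l (fun z => p2 (n+3) + 2 * Q.indicator V z) y := by
              refine dA_mono_on fun z hz => ?_
              have hzQ : z ∈ Q := by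
                have := cell_anti hlk y hz
                rw [cell_eq hyQ] at this; exact this
              rw [indicator_of_mem hzQ]
              calc W z ≤ 2 * V z + 2 * ∑ i, ‖c i‖ₑ^2 := by
                    simp only [hV, hW, Finset.mul_sum, ← Finset.sum_add_distrib]
                    exact Finset.sum_le_sum fun i _ => enorm_sq_split _ _
                _ ≤ 2 * V z + 2 * p2 (n+2) := by gcongr
                _ = _ := by
                  rw [← p2_one, ← p2_add, add_comm, show 1 + (n+2) = n + 3 by ring]
          _ = p2 (n+3) + 2 * dA l (Q.indicator V) y := by
              rw [dA_const_add]
              unfold dA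
              rw [lintegral_const_mul _ (hVc.measurable.indicator (measurableSet_cell _ _))]; ring
          _ ≤ p2 (n+3) + 2 * p2 (n+2) := by gcongr
          _ = p2 (n+4) := by
              rw [← p2_one, ← p2_add, show 1 + (n+2) = n + 3 by ring, ← two_mul, ← p2_one, ← p2_add]
              congr 1; ring
      have hweak := weak_dyadic (w := Q.indicator V) (p2 (n+2))
      calc volume (Q ∩ F) ≤ volume {y | ∃ l : ℤ, p2 (n+2) < dA l (Q.indicator V) y} := measure_mono hsubF
        _ = p2 (-(n+2)) * (p2 (n+2) * volume {y | ∃ l : ℤ, p2 (n+2) < dA l (Q.indicator V) y}) := by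
            rw [← mul_assoc, p2_neg_mul, one_mul]
        _ ≤ p2 (-(n+2)) * ∫⁻ y in cell (k0+i-1) x, V y := by
            gcongr
            refine hweak.trans ?_
            rw [lintegral_indicator (measurableSet_cell _ _)]
            exact lintegral_mono_set hsub
        _ ≤ p2 (-(n+2)) * (p2 (n-r) * p2 (-(k0+i-1))) := by
            gcongr
            exact dA_le_iff.1 hc1
        _ = p2 (-r-1) * volume Q := by
            rw [hQ, volume_cell, ← p2_add, ← p2_add, ← p2_add]; congr 1; ring)
  rw [← hE] at key
  have hEm : MeasurableSet {x | p2 n < ⨆ k, dA k W x} :=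
    measurableSet_lt measurable_const (Measurable.iSup fun k => dA_meas k W)
  rw [Measure.restrict_apply hEm, inter_eq_right.2 hFE] at key
  refine key.trans ?_
  simp only [Measure.add_apply, Measure.smul_apply, smul_eq_mul]
  refine add_le_add_right ?_ _
  rw [Measure.restrict_apply hEm]; exact measure_mono inter_subset_right

theorem SH {α : ℝ} (hα : 1 < α) : ∃ C : ℝ≥0∞, C ≠ ∞ ∧ ∀ (ι : Type) [Fintype ι] (G : ι → ℝ → ℂ)
    (_ : ∀ i, Continuous (G i)) (A : ℝ → ℝ≥0∞) (_ : Measurable A)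
    (_ : ∫⁻ x, ∑ i, ‖G i x‖ₑ^2 ≠ ∞)
    (_ : ∀ k x, ∃ c : ι → ℂ, ∀ y' ∈ cell k x, dA k (fun y => ∑ i, ‖G i y - c i‖ₑ^2) x ≤ A y'),
    ∫⁻ x, (∑ i, ‖G i x‖ₑ^2)^α ≤ C * ∫⁻ x, A x ^ α := by
  obtain ⟨C1, hC1, hlay1⟩ := layer_upper (α := α) (by linarith)
  obtain ⟨C2, hC2, hlay2⟩ := layer_upper (α := α - 1) (by linarith)
  have hα0 : 0 < α := by linarith
  have h16 : p2 4 ^ α ≠ ∞ := ENNReal.rpow_ne_top_of_nonneg hα0.le (p2_ne_top _)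
  have h16' : p2 4 ^ α ≠ 0 := by
    rw [Ne, ENNReal.rpow_eq_zero_iff]; simp [p2_ne_zero, p2_ne_top]
  obtain ⟨r, hr⟩ : ∃ r : ℕ, p2 4 ^ α * p2 (-r-1) ≤ p2 (-1) := by
    obtain ⟨K, -, hK⟩ := p2_exists h16' h16
    refine ⟨(K+1).toNat, ?_⟩
    calc _ ≤ p2 (K+1) * p2 (-((K+1).toNat:ℤ)-1) := by gcongr
      _ = p2 (K+1-(K+1).toNat-1) := by rw [← p2_add]; congr 1; ring
      _ ≤ p2 (-1) := p2_mono (by omega)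
  refine ⟨2^α * (2 * (p2 4^α * (p2 r ^ α * C1))), ?_, ?_⟩
  · have : ∀ k, p2 k ^ α ≠ ∞ := fun k => ENNReal.rpow_ne_top_of_nonneg hα0.le (p2_ne_top _)
    rw [← p2_one]
    exact ENNReal.mul_ne_top (this _) (ENNReal.mul_ne_top (p2_ne_top _) (ENNReal.mul_ne_top (this _)
      (ENNReal.mul_ne_top (this _) hC1)))
  intro ι _ G hG A hA hfin hosc
  have hgl := goodlambda G hG A hA hfin hosc
  set W : ℝ → ℝ≥0∞ := fun y => ∑ i, ‖G i y‖ₑ^2 with hW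
  have hWc : Continuous W := by
    refine continuous_finsetSum _ fun i _ => ?_
    exact (ENNReal.continuous_pow 2).comp (hG i).enorm
  set N : ℝ → ℝ≥0∞ := fun x => ⨆ k, dA k W x with hN
  have hNm : Measurable N := Measurable.iSup fun k => dA_meas k W
  set D := p2 4^α * ∑' k : ℤ, p2 k ^ α * volume {x | p2 (k-r) < A x} with hD
  set T : ℤ → ℝ≥0∞ := fun K => ∑' k : ℤ, if k ≤ K then p2 k ^ α * volume {x | p2 k < N x} else 0 with hT
  have hTfin : ∀ K, T K ≠ ∞ := by
    intro K
    have : T K ≤ layer (α-1) (p2 (K+1)) * ∫⁻ x, W x := by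
      unfold layer
      rw [← ENNReal.tsum_mul_right]
      refine ENNReal.tsum_le_tsum fun k => ?_
      split_ifs with h1 h2
      · have hk : p2 k ^ α = p2 k ^ (α - 1) * p2 k := by
          nth_rewrite 3 [← ENNReal.rpow_one (p2 k)]
          rw [← ENNReal.rpow_add _ _ (p2_ne_zero k) (p2_ne_top k)]; congr 1; ring
        rw [hk, mul_assoc]
        gcongr
        have := weak_dyadic (w := W) (p2 k)
        refine le_trans ?_ this
        gcongr with x
        simp only [hN, lt_iSup_iff]; exact id
      · exact absurd (p2_strict (by omega)) h2
      · exact zero_le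
      · exact zero_le
    refine ne_top_of_le_ne_top (ENNReal.mul_ne_top ?_ hfin) this
    exact ne_top_of_le_ne_top (ENNReal.mul_ne_top hC2 (ENNReal.rpow_ne_top_of_nonneg (by linarith) (p2_ne_top _))) (hlay2 _)
  have hTmono : ∀ K, T K ≤ T (K+4) := by
    intro K
    refine ENNReal.tsum_le_tsum fun k => ?_
    split_ifs
    · exact le_rfl
    · omega
    · exact zero_le
    · exact zero_le
  have hrec : ∀ K, T (K+4) ≤ p2 (-1) * T (K+4) + D := by
    intro K
    have h1 : T (K+4) = ∑' k : ℤ, if k ≤ K then p2 (k+4) ^ α * volume {x | p2 (k+4) < N x} else 0 := by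
      rw [hT]
      have := (Equiv.addRight (4:ℤ)).tsum_eq (fun k : ℤ => if k ≤ K + 4 then p2 k ^ α * volume {x | p2 k < N x} else 0)
      simp only [Equiv.coe_addRight, add_le_add_iff_right] at this
      exact this.symm
    calc T (K+4) = _ := h1
      _ ≤ ∑' k : ℤ, (p2 (-1) * (if k ≤ K then p2 k ^ α * volume {x | p2 k < N x} else 0) +
            p2 4^α * (p2 k ^ α * volume {x | p2 (k-r) < A x})) := by
          refine ENNReal.tsum_le_tsum fun k => ?_
          split_ifs
          · rw [p2_add, ENNReal.mul_rpow_of_nonneg _ _ hα0.le]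
            have := hgl k r
            rw [p2_add k 4] at this
            calc _ ≤ p2 k ^ α * p2 4 ^ α * (p2 (-r-1) * volume {x | p2 k < N x} + volume {x | p2 (k-r) < A x}) := by
                  gcongr
              _ = (p2 4 ^ α * p2 (-r-1)) * (p2 k ^ α * volume {x | p2 k < N x}) + p2 4^α * (p2 k ^ α * volume {x | p2 (k-r) < A x}) := by ring
              _ ≤ _ := by gcongr
          · exact zero_le
      _ = p2 (-1) * T K + D := by
          rw [ENNReal.tsum_add, ENNReal.tsum_mul_left, ENNReal.tsum_mul_left]
      _ ≤ _ := by gcongr; exact hTmono K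
  have hTD : ∀ K, T K ≤ 2 * D := by
    intro K
    refine (hTmono K).trans ?_
    have h := hrec K
    have hf := hTfin (K+4)
    clear_value D
    generalize T (K+4) = t at h hf
    by_cases hDt : D = ∞
    · rw [hDt]; simp
    lift t to ℝ≥0 using hf
    lift D to ℝ≥0 using hDt
    have hp : p2 (-1) = ((1/2:ℝ≥0):ℝ≥0∞) := by
      rw [p2]; simp [zpow_neg, ENNReal.ofReal_inv_of_pos]
    rw [hp] at h
    norm_cast at h ⊢
    have h' : (t:ℝ) ≤ 1/2 * t + D := by exact_mod_cast h
    have : (t:ℝ) ≤ 2 * D := by linarith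
    exact_mod_cast this
  have hsum : ∑' k : ℤ, p2 k ^ α * volume {x | p2 k < N x} ≤ 2 * D := by
    rw [ENNReal.tsum_eq_iSup_sum]
    refine iSup_le fun s => ?_
    obtain ⟨K, hK⟩ : ∃ K, ∀ k ∈ s, k ≤ K := s.exists_le
    refine le_trans ?_ (hTD K)
    calc _ = ∑ k ∈ s, if k ≤ K then p2 k ^ α * volume {x | p2 k < N x} else 0 := by
          refine Finset.sum_congr rfl fun k hk => ?_
          rw [if_pos (hK k hk)]
      _ ≤ _ := ENNReal.sum_le_tsum s
  have hDA : D ≤ p2 4^α * (p2 r ^ α * C1) * ∫⁻ x, A x ^ α := by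
    rw [hD, mul_assoc]
    gcongr
    rw [← (Equiv.addRight (r:ℤ)).tsum_eq]
    simp only [Equiv.coe_addRight, add_sub_cancel_right]
    calc _ = p2 r ^ α * ∑' k : ℤ, p2 k ^ α * volume {x | p2 k < A x} := by
          rw [← ENNReal.tsum_mul_left]
          congr 1; ext k
          rw [p2_add, ENNReal.mul_rpow_of_nonneg _ _ hα0.le]; ring
      _ = p2 r ^ α * ∫⁻ x, layer α (A x) := by rw [layer_lintegral hA]
      _ ≤ p2 r ^ α * ∫⁻ x, C1 * A x ^ α := by gcongr; exact hlay1 _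
      _ = _ := by rw [lintegral_const_mul' _ _ hC1]; ring
  calc ∫⁻ x, W x ^ α ≤ ∫⁻ x, 2^α * layer α (N x) := by
        gcongr with x
        refine le_trans ?_ (layer_lower hα0 _)
        gcongr; exact le_dyadicMax hWc x
    _ = 2^α * ∑' k : ℤ, p2 k ^ α * volume {x | p2 k < N x} := by
        rw [lintegral_const_mul' _ _ (ENNReal.rpow_ne_top_of_nonneg hα0.le (by simp)), layer_lintegral hNm]
    _ ≤ 2^α * (2 * D) := by gcongr
    _ ≤ 2^α * (2 * (p2 4^α * (p2 r ^ α * C1) * ∫⁻ x, A x ^ α)) := by gcongr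
    _ = _ := by ring

/-- averaging kernel -/
noncomputable def kw (j : ℤ) (t : ℝ) : ℝ≥0∞ := ENNReal.ofReal ((2:ℝ)^j / (1 + 2^j * |t|)^2)

/-- weighted average at scale `2^{-j}` -/
noncomputable def kav (j : ℤ) (w : ℝ → ℝ≥0∞) (x : ℝ) : ℝ≥0∞ := ∫⁻ y, kw j (x - y) * w y

lemma kw_symm (j : ℤ) (x y : ℝ) : kw j (x - y) = kw j (y - x) := by
  unfold kw; rw [abs_sub_comm]

lemma kw_meas (j : ℤ) : Measurable (kw j) := by unfold kw; fun_prop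

lemma kav_meas (j : ℤ) {w : ℝ → ℝ≥0∞} (hw : Measurable w) : Measurable (kav j w) := by
  unfold kav
  apply Measurable.lintegral_prod_right' (f := fun z : ℝ × ℝ => kw j (z.1 - z.2) * w z.2)
  exact ((kw_meas j).comp (by fun_prop)).mul (hw.comp measurable_snd)

lemma kw_le (j : ℤ) (x y : ℝ) : kw j (x - y) ≤
    ∑' i : ℕ, p2 (j + 2 - 2 * i) * {y | |y - x| ≤ 2^(-(j - i))}.indicator (1 : ℝ → ℝ≥0∞) y := by
  have h2j : (0:ℝ) < 2^j := by positivity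
  set u := 2^j * |x - y| with hu
  have hu0 : 0 ≤ u := by positivity
  have hconv : ∀ i : ℕ, u ≤ 2^i → y ∈ {y | |y - x| ≤ (2:ℝ)^(-(j - i))} := by
    intro i hi
    simp only [Set.mem_ofPred_eq]
    rw [abs_sub_comm]
    have : (2:ℝ)^(-(j-(i:ℤ))) = 2^i / 2^j := by
      rw [neg_sub, zpow_sub₀ (by norm_num)]; simp
    rw [this, le_div_iff₀ h2j, mul_comm]; exact hi
  have key : ∃ i : ℕ, u ≤ 2^i ∧ (2:ℝ)^i ≤ 2 * (1 + u) := by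
    by_cases h1 : u ≤ 1
    · exact ⟨0, by simpa using h1, by simp; linarith⟩
    push Not at h1
    obtain ⟨n, hn1, hn2⟩ := exists_nat_pow_near h1.le (by norm_num : (1:ℝ) < 2)
    exact ⟨n+1, hn2.le, by rw [pow_succ]; linarith⟩
  obtain ⟨i, hi1, hi2⟩ := key
  refine le_trans ?_ (ENNReal.le_tsum i)
  rw [indicator_of_mem (hconv i hi1)]
  simp only [Pi.one_apply, mul_one]
  unfold kw p2
  refine ENNReal.ofReal_le_ofReal ?_
  rw [← hu, div_le_iff₀ (by positivity)]
  have : (2:ℝ)^(j+2-2*(i:ℤ)) = 2^j * 4 / (2^i)^2 := by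
    rw [zpow_sub₀ (by norm_num), zpow_add₀ (by norm_num), zpow_mul]
    congr 1
    · norm_num
    · rw [← zpow_natCast, ← zpow_natCast, ← zpow_mul, ← zpow_mul]; ring_nf
  rw [this, div_mul_eq_mul_div, le_div_iff₀ (by positivity), mul_assoc]
  gcongr
  nlinarith [pow_pos (by norm_num : (0:ℝ) < 2) i]

lemma kav_le_HL (j : ℤ) {w : ℝ → ℝ≥0∞} (hw : Measurable w) (x : ℝ) : kav j w x ≤ 8 * HL w x := by
  have hms : ∀ i : ℕ, MeasurableSet {y : ℝ | |y - x| ≤ 2^(-(j - (i:ℤ)))} := fun i =>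
    measurableSet_le (by fun_prop) (by fun_prop)
  calc kav j w x ≤ ∫⁻ y, ∑' i : ℕ, p2 (j + 2 - 2 * i) * {y | |y - x| ≤ 2^(-(j - (i:ℤ)))}.indicator w y := by
        unfold kav
        refine lintegral_mono fun y => ?_
        refine (mul_le_mul_left (kw_le j x y) _).trans ?_
        rw [← ENNReal.tsum_mul_right]
        refine ENNReal.tsum_le_tsum fun i => ?_
        rw [mul_assoc]
        gcongr
        by_cases h : y ∈ {y | |y - x| ≤ (2:ℝ)^(-(j - (i:ℤ)))}
        · rw [indicator_of_mem h, indicator_of_mem h]; simp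
        · rw [indicator_of_notMem h, indicator_of_notMem h]; simp
    _ = ∑' i : ℕ, p2 (j + 2 - 2 * i) * ∫⁻ y in {y | |y - x| ≤ 2^(-(j - (i:ℤ)))}, w y := by
        rw [lintegral_tsum]
        · congr 1; ext i
          rw [lintegral_const_mul' _ _ (p2_ne_top _), lintegral_indicator (hms i)]
        · intro i
          exact ((hw.indicator (hms i)).const_mul _).aemeasurable
    _ ≤ ∑' i : ℕ, (4 * (2⁻¹)^i) * HL w x := by
        refine ENNReal.tsum_le_tsum fun i => ?_
        have h1 : p2 (j + 2 - 2 * i) = (4 * (2⁻¹)^i) * p2 (j - i) := by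
          have h4 : (4:ℝ≥0∞) = p2 2 := by simp [p2]; norm_num
          have h5 : (2⁻¹:ℝ≥0∞)^i = p2 (-i) := by
            rw [p2, zpow_neg, ENNReal.ofReal_inv_of_pos (by positivity)]
            simp [ENNReal.inv_pow, ENNReal.ofReal_pow]
          rw [h4, h5, ← p2_add, ← p2_add]; congr 1; ring
        rw [h1, mul_assoc]
        gcongr
        exact le_iSup (fun k => p2 k * ∫⁻ y in {y | |y - x| ≤ 2^(-k)}, w y) (j - i)
    _ = 8 * HL w x := by
        rw [ENNReal.tsum_mul_right, ENNReal.tsum_mul_left, ENNReal.tsum_geometric]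
        congr 1
        rw [ENNReal.one_sub_inv_two, inv_inv]; norm_num

lemma kav_one (j : ℤ) (x : ℝ) : kav j (fun _ => 1) x ≤ 16 := by
  refine (kav_le_HL j measurable_const x).trans ?_
  have : HL (fun _ => 1) x ≤ 2 := by
    unfold HL
    refine iSup_le fun k => ?_
    rw [setLIntegral_const, vol_near, one_mul, mul_left_comm, p2_mul_neg, mul_one]
  calc _ ≤ (8:ℝ≥0∞) * 2 := by gcongr
    _ = 16 := by norm_num

lemma kw_int (j : ℤ) (x : ℝ) : ∫⁻ y, kw j (x - y) ≤ 16 := by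
  have := kav_one j x; simpa [kav] using this

lemma kw_ne_top (j : ℤ) (t : ℝ) : kw j t ≠ ∞ := ENNReal.ofReal_ne_top

/-- two-function Hölder for `kav` -/
lemma kav_holder (j : ℤ) {u v : ℝ → ℝ≥0∞} (hu : Measurable u) (hv : Measurable v) {a b : ℝ}
    (hab : a.HolderConjugate b) (x : ℝ) :
    kav j (fun y => u y * v y) x ≤
      kav j (fun y => u y ^ a) x ^ (1/a) * kav j (fun y => v y ^ b) x ^ (1/b) := by
  have hk : Measurable fun y => kw j (x - y) := (kw_meas j).comp (by fun_prop)
  have := ENNReal.lintegral_mul_le_Lp_mul_Lq volume hab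
    (f := fun y => kw j (x - y) ^ (1/a) * u y) (g := fun y => kw j (x-y) ^ (1/b) * v y)
    ((hk.pow_const _).mul hu).aemeasurable ((hk.pow_const _).mul hv).aemeasurable
  have ha := hab.pos
  have hb := hab.symm.pos
  unfold kav
  refine le_trans (le_of_eq ?_) (this.trans (le_of_eq ?_))
  · congr 1; ext y
    simp only [Pi.mul_apply]
    rw [show kw j (x-y) ^ (1/a) * u y * (kw j (x-y) ^ (1/b) * v y) =
      kw j (x-y) ^ (1/a) * kw j (x-y) ^ (1/b) * (u y * v y) by ring,
      ← ENNReal.rpow_add_of_nonneg _ _ (by positivity) (by positivity)]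
    have : 1/a + 1/b = 1 := by rw [one_div, one_div]; exact hab.inv_add_inv_eq_one
    rw [this, ENNReal.rpow_one]
  · congr 2
    · congr 1; ext y
      rw [ENNReal.mul_rpow_of_nonneg _ _ ha.le, ← ENNReal.rpow_mul]
      rw [one_div_mul_cancel ha.ne', ENNReal.rpow_one]
    · congr 1; ext y
      rw [ENNReal.mul_rpow_of_nonneg _ _ hb.le, ← ENNReal.rpow_mul]
      rw [one_div_mul_cancel hb.ne', ENNReal.rpow_one]

lemma kav_jensen (j : ℤ) {w : ℝ → ℝ≥0∞} (hw : Measurable w) {β : ℝ} (hβ : 1 < β) (x : ℝ) :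
    kav j w x ^ β ≤ 16 ^ (β - 1) * kav j (fun y => w y ^ β) x := by
  have hab := Real.HolderConjugate.conjExponent hβ
  have h := kav_holder j hw (measurable_const (a := (1:ℝ≥0∞))) hab x
  simp only [mul_one, ENNReal.one_rpow] at h
  have hβ0 : 0 < β := by linarith
  calc kav j w x ^ β ≤ (kav j (fun y => w y ^ β) x ^ (1/β) * 16 ^ (1/β.conjExponent)) ^ β := by
        gcongr
        refine h.trans ?_
        have := hab.symm.pos
        gcongr
        exact kav_one j x
    _ = _ := by
        rw [ENNReal.mul_rpow_of_nonneg _ _ hβ0.le, ← ENNReal.rpow_mul, ← ENNReal.rpow_mul,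
          one_div_mul_cancel hβ0.ne', ENNReal.rpow_one, mul_comm]
        congr 2
        unfold Real.conjExponent
        have : β - 1 ≠ 0 := by linarith
        field_simp

lemma kav_adj (j : ℤ) {u v : ℝ → ℝ≥0∞} (hu : Measurable u) (hv : Measurable v) :
    ∫⁻ x, v x * kav j u x = ∫⁻ y, u y * kav j v y := by
  unfold kav
  have h1 : ∀ x, v x * ∫⁻ y, kw j (x - y) * u y = ∫⁻ y, v x * (kw j (x-y) * u y) := by
    intro x; rw [lintegral_const_mul]; exact ((kw_meas j).comp (by fun_prop)).mul hu
  have h2 : ∀ y, u y * ∫⁻ x, kw j (y - x) * v x = ∫⁻ x, u y * (kw j (y - x) * v x) := by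
    intro x; rw [lintegral_const_mul]; exact ((kw_meas j).comp (by fun_prop)).mul hv
  simp_rw [h1, h2]
  rw [lintegral_lintegral_swap]
  · congr 1; ext y; congr 1; ext x; rw [kw_symm]; ring
  · apply Measurable.aemeasurable
    exact (hv.comp measurable_fst).mul (((kw_meas j).comp (by fun_prop)).mul (hu.comp measurable_snd))

lemma kav_int (j : ℤ) {u : ℝ → ℝ≥0∞} (hu : Measurable u) :
    ∫⁻ x, kav j u x ≤ 16 * ∫⁻ y, u y := by
  have := kav_adj j hu (measurable_const (a := (1:ℝ≥0∞)))
  simp only [one_mul] at this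
  rw [this, ← lintegral_const_mul _ hu]
  refine lintegral_mono fun y => ?_
  rw [mul_comm]; gcongr; exact kav_one j y

lemma kav_mono (j : ℤ) {u v : ℝ → ℝ≥0∞} (h : ∀ y, u y ≤ v y) (x : ℝ) : kav j u x ≤ kav j v x := by
  unfold kav; gcongr; exact h _

lemma absorb {X Y K : ℝ≥0∞} {γ : ℝ} (hγ : 1 < γ) (hX : X ≠ ∞)
    (h : X ≤ K * Y ^ (1/γ) * X ^ (1 - 1/γ)) : X ≤ K ^ γ * Y := by
  have hγ0 : 0 < γ := by linarith
  by_cases h0 : X = 0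
  · rw [h0]; exact zero_le
  have h1 : X ^ (1/γ) ≤ K * Y ^ (1/γ) := by
    have hpos : X ^ (1 - 1/γ) ≠ 0 := by
      rw [Ne, ENNReal.rpow_eq_zero_iff]; simp [h0, hX]
    have hfin : X ^ (1 - 1/γ) ≠ ∞ := by
      refine ENNReal.rpow_ne_top_of_nonneg ?_ hX
      rw [sub_nonneg, div_le_one hγ0]; exact hγ.le
    rw [← ENNReal.mul_le_mul_iff_left hpos hfin]
    refine le_trans (le_of_eq ?_) h
    rw [← ENNReal.rpow_add _ _ h0 hX]; simp
  calc X = (X ^ (1/γ)) ^ γ := by rw [← ENNReal.rpow_mul, one_div_mul_cancel hγ0.ne', ENNReal.rpow_one]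
    _ ≤ (K * Y ^ (1/γ)) ^ γ := by gcongr
    _ = _ := by rw [ENNReal.mul_rpow_of_nonneg _ _ hγ0.le, ← ENNReal.rpow_mul, one_div_mul_cancel hγ0.ne', ENNReal.rpow_one]

lemma trunc_iSup {A : ℝ → ℝ≥0∞} (x : ℝ) :
    ⨆ n : ℕ, (Icc (-(n:ℝ)) n).indicator (fun x => min (A x) n) x = A x := by
  apply le_antisymm
  · refine iSup_le fun n => ?_
    by_cases h : x ∈ Icc (-(n:ℝ)) n
    · rw [indicator_of_mem h]; exact min_le_left _ _
    · rw [indicator_of_notMem h]; exact zero_le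
  · refine le_of_forall_lt fun l hl => ?_
    obtain ⟨n1, h1⟩ := ENNReal.exists_nat_gt (ne_top_of_lt hl)
    obtain ⟨n2, h2⟩ := exists_nat_ge |x|
    refine lt_of_lt_of_le ?_ (le_iSup _ (max n1 n2))
    rw [indicator_of_mem]
    · refine lt_min hl (h1.trans_le ?_)
      exact_mod_cast le_max_left _ _
    · rw [mem_Icc, ← abs_le]; refine h2.trans ?_; exact_mod_cast le_max_right _ _

lemma VVsum {γ : ℝ} (hγ : 1 ≤ γ) : ∃ C : ℝ≥0∞, C ≠ ∞ ∧ ∀ (σ : ℤ → ℤ) (E : ℤ → ℝ → ℝ≥0∞),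
    (∀ j, Measurable (E j)) →
    ∫⁻ x, (∑' j, kav (σ j) (E j) x) ^ γ ≤ C * ∫⁻ x, (∑' j, E j x) ^ γ := by
  rcases hγ.eq_or_lt with h1 | h1
  · subst h1
    refine ⟨16, by simp, fun σ E hE => ?_⟩
    simp only [ENNReal.rpow_one]
    rw [lintegral_tsum fun j => (kav_meas _ (hE j)).aemeasurable,
      lintegral_tsum fun j => (hE j).aemeasurable, ← ENNReal.tsum_mul_left]
    exact ENNReal.tsum_le_tsum fun j => kav_int _ (hE j)
  have hγ0 : 0 < γ := by linarith
  have hab := Real.HolderConjugate.conjExponent h1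
  set γ' := γ.conjExponent with hγ'
  obtain ⟨C1, hC1, hmax⟩ := maximal_Lp hab.symm.lt
  refine ⟨(8 * C1 ^ (1/γ')) ^ γ, ?_, fun σ E hE => ?_⟩
  · refine ENNReal.rpow_ne_top_of_nonneg hγ0.le (ENNReal.mul_ne_top (by simp) ?_)
    exact ENNReal.rpow_ne_top_of_nonneg (one_div_nonneg.2 hab.symm.pos.le) hC1
  set A : ℝ → ℝ≥0∞ := fun x => ∑' j, kav (σ j) (E j) x with hA
  have hAm : Measurable A := Measurable.ennreal_tsum fun j => kav_meas _ (hE j)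
  have hSm : Measurable fun x => ∑' j, E j x := Measurable.ennreal_tsum fun j => hE j
  set An : ℕ → ℝ → ℝ≥0∞ := fun n => (Icc (-(n:ℝ)) n).indicator (fun x => min (A x) n) with hAn
  have hAnm : ∀ n, Measurable (An n) := fun n => (hAm.min measurable_const).indicator measurableSet_Icc
  have hAnle : ∀ n x, An n x ≤ A x := by
    intro n x
    exact (le_iSup (fun n => An n x) n).trans (trunc_iSup x).le
  have hγγ : γ - 1 = γ * (1/γ') := by
    rw [hγ']; unfold Real.conjExponent
    have : γ - 1 ≠ 0 := by linarith
    field_simp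
  have hγγ' : (γ - 1) * γ' = γ := by
    have := hab.symm.pos.ne'
    rw [hγγ, mul_assoc, one_div_mul_cancel this, mul_one]
  have hbound : ∀ n, ∫⁻ x, An n x ^ γ ≤ (8 * C1 ^ (1/γ')) ^ γ * ∫⁻ x, (∑' j, E j x) ^ γ := by
    intro n
    have hfin : ∫⁻ x, An n x ^ γ ≠ ∞ := by
      have : ∫⁻ x, An n x ^ γ ≤ ∫⁻ x, (Icc (-(n:ℝ)) n).indicator (fun _ => (n:ℝ≥0∞) ^ γ) x := by
        refine lintegral_mono fun x => ?_
        by_cases h : x ∈ Icc (-(n:ℝ)) n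
        · simp only [hAn]; rw [indicator_of_mem h, indicator_of_mem h]; gcongr; exact min_le_right _ _
        · simp only [hAn]; rw [indicator_of_notMem h, indicator_of_notMem h]; simp [hγ0]
      refine ne_top_of_le_ne_top ?_ this
      rw [lintegral_indicator_const measurableSet_Icc]
      exact ENNReal.mul_ne_top (ENNReal.rpow_ne_top_of_nonneg hγ0.le (by simp)) (by simp)
    refine absorb h1 hfin ?_
    have hB : Measurable fun x => An n x ^ (γ - 1) := (hAnm n).pow_const _
    calc ∫⁻ x, An n x ^ γ ≤ ∫⁻ x, An n x ^ (γ-1) * A x := by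
          refine lintegral_mono fun x => ?_
          calc An n x ^ γ = An n x ^ (γ-1) * An n x ^ (1:ℝ) := by
                rw [← ENNReal.rpow_add_of_nonneg _ _ (by linarith) (by norm_num)]; simp
            _ ≤ _ := by rw [ENNReal.rpow_one]; gcongr; exact hAnle n x
      _ = ∑' j, ∫⁻ x, An n x ^ (γ-1) * kav (σ j) (E j) x := by
          rw [← lintegral_tsum]
          · congr 1; ext x; rw [ENNReal.tsum_mul_left]
          · exact fun j => (hB.mul (kav_meas _ (hE j))).aemeasurable
      _ = ∑' j, ∫⁻ x, E j x * kav (σ j) (fun x => An n x ^ (γ-1)) x := by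
          congr 1; ext j; exact kav_adj _ (hE j) hB
      _ ≤ ∑' j, ∫⁻ x, E j x * (8 * HL (fun x => An n x ^ (γ-1)) x) := by
          gcongr with j x; exact kav_le_HL _ hB _
      _ = ∫⁻ x, (∑' j, E j x) * (8 * HL (fun x => An n x ^ (γ-1)) x) := by
          rw [← lintegral_tsum]
          · congr 1; ext x; rw [ENNReal.tsum_mul_right]
          · exact fun j => ((hE j).mul ((HL_meas hB).const_mul _)).aemeasurable
      _ = 8 * ∫⁻ x, (∑' j, E j x) * HL (fun x => An n x ^ (γ-1)) x := by
          rw [← lintegral_const_mul' _ _ (by simp)]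
          congr 1; ext x; ring
      _ ≤ 8 * ((∫⁻ x, (∑' j, E j x)^γ) ^ (1/γ) * (∫⁻ x, HL (fun x => An n x ^ (γ-1)) x ^ γ') ^ (1/γ')) := by
          gcongr
          exact ENNReal.lintegral_mul_le_Lp_mul_Lq volume hab hSm.aemeasurable (HL_meas hB).aemeasurable
      _ ≤ 8 * ((∫⁻ x, (∑' j, E j x)^γ) ^ (1/γ) * (C1 * ∫⁻ x, (An n x ^ (γ-1)) ^ γ') ^ (1/γ')) := by
          have := hab.symm.pos
          gcongr
          exact hmax _ hB
      _ = 8 * C1 ^ (1/γ') * (∫⁻ x, (∑' j, E j x)^γ) ^ (1/γ) * (∫⁻ x, An n x ^ γ) ^ (1 - 1/γ) := by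
          have h3 : 1/γ' = 1 - 1/γ := by
            rw [one_div, one_div]; linarith [hab.inv_add_inv_eq_one]
          have h4 : ∀ x, (An n x ^ (γ-1)) ^ γ' = An n x ^ γ := by
            intro x; rw [← ENNReal.rpow_mul, hγγ']
          simp_rw [h4]
          rw [ENNReal.mul_rpow_of_nonneg _ _ (one_div_nonneg.2 hab.symm.pos.le), ← h3]
          ring
  have hAsup : ∀ x, A x ^ γ = ⨆ n, An n x ^ γ := by
    intro x
    have : A x = ⨆ n, An n x := (trunc_iSup x).symm
    rw [this]
    exact (ENNReal.monotone_rpow_of_nonneg hγ0.le).map_iSup_of_continuousAt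
      (ENNReal.continuous_rpow_const.continuousAt) (by simp [hγ0])
  rw [show ∫⁻ x, A x ^ γ = ∫⁻ x, ⨆ n, An n x ^ γ from lintegral_congr hAsup]
  rw [lintegral_iSup (fun n => (hAnm n).pow_const _)]
  · exact iSup_le hbound
  · intro n m hnm x
    refine ENNReal.rpow_le_rpow ?_ hγ0.le
    change (Icc (-(n:ℝ)) n).indicator (fun x => min (A x) n) x ≤ (Icc (-(m:ℝ)) m).indicator (fun x => min (A x) m) x
    have hsub : Icc (-(n:ℝ)) n ⊆ Icc (-(m:ℝ)) m := by
      have : (n:ℝ) ≤ m := by exact_mod_cast hnm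
      exact Icc_subset_Icc (by linarith) this
    by_cases h : x ∈ Icc (-(n:ℝ)) n
    · rw [indicator_of_mem h, indicator_of_mem (hsub h)]
      gcongr
    · rw [indicator_of_notMem h]; exact zero_le

lemma VVfin {α β : ℝ} (hα : 1 < α) (hβ : 1 < β) : ∃ C : ℝ≥0∞, C ≠ ∞ ∧
    ∀ (σ : ℤ → ℤ) (F : ℤ → ℝ → ℝ≥0∞), (∀ j, Measurable (F j)) →
    ∫⁻ x, (∑' j, kav (σ j) (F j) x ^ β) ^ (α/β) ≤ C * ∫⁻ x, (∑' j, F j x ^ β) ^ (α/β) := by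
  have hα0 : 0 < α := by linarith
  have hβ0 : 0 < β := by linarith
  rcases le_or_gt β α with hle | hlt
  · obtain ⟨C, hC, h⟩ := VVsum (γ := α/β) (by rw [le_div_iff₀ hβ0]; linarith)
    refine ⟨(16^(β-1))^(α/β) * C, ?_, fun σ F hF => ?_⟩
    · refine ENNReal.mul_ne_top (ENNReal.rpow_ne_top_of_nonneg (by positivity) (ENNReal.rpow_ne_top_of_nonneg (by linarith) (by simp))) hC
    calc _ ≤ ∫⁻ x, (16^(β-1) * ∑' j, kav (σ j) (fun y => F j y ^ β) x) ^ (α/β) := by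
          refine lintegral_mono fun x => ?_
          gcongr
          rw [← ENNReal.tsum_mul_left]
          exact ENNReal.tsum_le_tsum fun j => kav_jensen _ (hF j) hβ x
      _ = (16^(β-1))^(α/β) * ∫⁻ x, (∑' j, kav (σ j) (fun y => F j y ^ β) x) ^ (α/β) := by
          rw [← lintegral_const_mul' _ _ (ENNReal.rpow_ne_top_of_nonneg (by positivity) (ENNReal.rpow_ne_top_of_nonneg (by linarith) (by simp)))]
          congr 1; ext x
          rw [ENNReal.mul_rpow_of_nonneg _ _ (by positivity)]
      _ ≤ _ := by
          rw [mul_assoc]; gcongr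
          exact h σ _ fun j => (hF j).pow_const _
  -- case α < β
  set θ := 1 - α/β with hθ
  have hαβ : α/β < 1 := by rw [div_lt_one hβ0]; exact hlt
  have hθ0 : 0 < θ := by rw [hθ]; linarith
  have hab := Real.HolderConjugate.conjExponent hβ
  set β' := β.conjExponent with hβ'
  have hβ'0 : 0 < β' := hab.symm.pos
  have hexp : 1 < α/(β' * θ) := by
    rw [lt_div_iff₀ (by positivity), one_mul, hβ', hθ]
    unfold Real.conjExponent
    have h1 : 0 < β - 1 := by linarith
    rw [div_mul_eq_mul_div, div_lt_iff₀ h1, mul_sub, mul_one, mul_div_cancel₀ _ hβ0.ne']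
    nlinarith
  obtain ⟨C1, hC1, hmax⟩ := maximal_Lp hexp
  refine ⟨8 ^ (α/β') * (C1 ^ θ * 16 ^ (α/β)), ?_, fun σ F hF => ?_⟩
  · refine ENNReal.mul_ne_top (ENNReal.rpow_ne_top_of_nonneg (by positivity) (by simp)) (ENNReal.mul_ne_top (ENNReal.rpow_ne_top_of_nonneg hθ0.le hC1) (ENNReal.rpow_ne_top_of_nonneg (by positivity) (by simp)))
  set Z : ℝ → ℝ≥0∞ := fun x => ∑' j, F j x ^ β with hZ
  have hZm : Measurable Z := Measurable.ennreal_tsum fun j => (hF j).pow_const _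
  by_cases htop : ∫⁻ x, Z x ^ (α/β) = ∞
  · rw [htop, ENNReal.mul_top]
    · exact le_top
    · have h1 : (1:ℝ≥0∞) ≤ 8 ^ (α/β') := ENNReal.one_le_rpow (by norm_num) (by positivity)
      by_cases hC10 : C1 = 0
      · -- degenerate: contradiction with a nontrivial function
        exfalso
        have := hmax ((Icc (0:ℝ) 1).indicator 1) (measurable_one.indicator measurableSet_Icc)
        rw [hC10, zero_mul, nonpos_iff_eq_zero, lintegral_eq_zero_iff ((HL_meas (measurable_one.indicator measurableSet_Icc)).pow_const _)] at this
        have hv : volume (Icc (0:ℝ) 1) = 0 := by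
          rw [← nonpos_iff_eq_zero]
          have h0 : volume {x | ¬ (HL ((Icc (0:ℝ) 1).indicator 1) x ^ (α / (β' * θ)) = 0)} = 0 := this
          rw [← h0]
          refine measure_mono fun x hx => ?_
          simp only [Set.mem_ofPred_eq]
          have hp : 0 < HL ((Icc (0:ℝ) 1).indicator 1) x := by
            refine lt_of_lt_of_le ?_ (le_iSup (fun k => p2 k * ∫⁻ y in {y | |y - x| ≤ 2^(-k)}, (Icc (0:ℝ) 1).indicator 1 y) 0)
            rw [p2_zero, one_mul, lintegral_indicator_one measurableSet_Icc, Measure.restrict_apply measurableSet_Icc]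
            rw [inter_eq_left.2]
            · simp
            · intro y hy
              simp only [Set.mem_ofPred_eq, neg_zero, zpow_zero, abs_le]
              constructor <;> linarith [hx.1, hx.2, hy.1, hy.2]
          have := ENNReal.rpow_pos_of_nonneg hp (by positivity : 0 ≤ α / (β' * θ))
          exact this.ne'
        simp at hv
      refine mul_ne_zero (by positivity) (mul_ne_zero ?_ ?_)
      · rw [Ne, ENNReal.rpow_eq_zero_iff]; simp [hC10, hC1]
      · rw [Ne, ENNReal.rpow_eq_zero_iff]; simp
  have hZfin : ∀ᵐ x, Z x < ∞ := by
    have := ae_lt_top (hZm.pow_const (α/β)) htop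
    filter_upwards [this] with x hx
    by_contra h
    push Not at h
    rw [top_le_iff.1 h, ENNReal.top_rpow_of_pos (by positivity)] at hx
    exact absurd hx (by simp)
  set H : ℝ → ℝ≥0∞ := fun y => Z y ^ (θ/β*β') with hH
  have hHm : Measurable H := hZm.pow_const _
  set U : ℤ → ℝ → ℝ≥0∞ := fun j y => F j y ^ β * Z y ^ (-θ) with hU
  have hUm : ∀ j, Measurable (U j) := fun j => ((hF j).pow_const _).mul (hZm.pow_const _)
  have hkav : ∀ j x, kav (σ j) (F j) x ^ β ≤ (8 * HL H x) ^ (β/β') * kav (σ j) (U j) x := by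
    intro j x
    have hle1 : kav (σ j) (F j) x ≤ kav (σ j) (fun y => (F j y * Z y ^ (-θ/β)) * Z y ^ (θ/β)) x := by
      unfold kav
      refine lintegral_mono_ae ?_
      filter_upwards [hZfin] with y hy
      gcongr
      by_cases h0 : Z y = 0
      · have : F j y = 0 := by
          have := (ENNReal.tsum_eq_zero.1 h0) j
          rw [ENNReal.rpow_eq_zero_iff] at this
          rcases this with h | h
          · exact h.1
          · linarith [h.2]
        rw [this]; exact zero_le
      · rw [mul_assoc, ← ENNReal.rpow_add _ _ h0 hy.ne, show -θ/β + θ/β = 0 by ring]; simp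
    have h2 := kav_holder (σ j) ((hF j).mul (hZm.pow_const (-θ/β))) (hZm.pow_const (θ/β)) hab x
    calc kav (σ j) (F j) x ^ β ≤ (kav (σ j) (U j) x ^ (1/β) * (8 * HL H x) ^ (1/β')) ^ β := by
          gcongr
          refine (hle1.trans h2).trans ?_
          gcongr ?_ ^ (1/β) * ?_ ^ (1/β')
          · refine kav_mono _ (fun y => le_of_eq ?_) x
            simp only [hU, Pi.mul_apply]
            rw [ENNReal.mul_rpow_of_nonneg _ _ hβ0.le, ← ENNReal.rpow_mul]
            congr 2; field_simp
          · refine le_trans (le_of_eq ?_) (kav_le_HL (σ j) hHm x)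
            congr 1; ext y
            simp only [hH]; rw [← ENNReal.rpow_mul]
      _ = _ := by
          rw [ENNReal.mul_rpow_of_nonneg _ _ hβ0.le, ← ENNReal.rpow_mul, ← ENNReal.rpow_mul,
            one_div_mul_cancel hβ0.ne', ENNReal.rpow_one, mul_comm]
          congr 2; ring
  have hconj : (1/θ).HolderConjugate (β/α) := by
    rw [Real.holderConjugate_iff]
    constructor
    · rw [lt_div_iff₀ hθ0, hθ]; have : 0 < α/β := by positivity
      linarith
    · rw [one_div, inv_inv, inv_div, hθ]; ring
  set V : ℝ → ℝ≥0∞ := fun x => ∑' j, kav (σ j) (U j) x with hV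
  have hVm : Measurable V := Measurable.ennreal_tsum fun j => kav_meas _ (hUm j)
  have hVint : ∫⁻ x, V x ≤ 16 * ∫⁻ x, Z x ^ (α/β) := by
    calc ∫⁻ x, V x = ∑' j, ∫⁻ x, kav (σ j) (U j) x := lintegral_tsum fun j => (kav_meas _ (hUm j)).aemeasurable
      _ ≤ ∑' j, 16 * ∫⁻ x, U j x := ENNReal.tsum_le_tsum fun j => kav_int _ (hUm j)
      _ = 16 * ∫⁻ x, Z x * Z x ^ (-θ) := by
          rw [ENNReal.tsum_mul_left, ← lintegral_tsum fun j => (hUm j).aemeasurable]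
          congr 2; ext x; rw [hU]; simp only; rw [ENNReal.tsum_mul_right]
      _ = _ := by
          congr 1
          refine lintegral_congr_ae ?_
          filter_upwards [hZfin] with x hx
          by_cases h0 : Z x = 0
          · rw [h0, zero_mul, ENNReal.zero_rpow_of_pos (by positivity)]
          · nth_rewrite 1 [← ENNReal.rpow_one (Z x)]
            rw [← ENNReal.rpow_add _ _ h0 hx.ne]; congr 1; rw [hθ]; ring
  calc ∫⁻ x, (∑' j, kav (σ j) (F j) x ^ β) ^ (α/β)
      ≤ ∫⁻ x, ((8 * HL H x) ^ (β/β') * V x) ^ (α/β) := by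
        refine lintegral_mono fun x => ?_
        gcongr
        rw [hV, ← ENNReal.tsum_mul_left]
        exact ENNReal.tsum_le_tsum fun j => hkav j x
    _ = ∫⁻ x, 8 ^ (α/β') * (HL H x ^ (α/β') * V x ^ (α/β)) := by
        congr 1; ext x
        rw [ENNReal.mul_rpow_of_nonneg _ _ (by positivity), ← ENNReal.rpow_mul, ← mul_assoc,
          ← ENNReal.mul_rpow_of_nonneg _ _ (by positivity)]
        congr 2; field_simp
    _ = 8 ^ (α/β') * ∫⁻ x, HL H x ^ (α/β') * V x ^ (α/β) := by
        rw [lintegral_const_mul' _ _ (ENNReal.rpow_ne_top_of_nonneg (by positivity) (by simp))]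
    _ ≤ 8 ^ (α/β') * ((∫⁻ x, (HL H x ^ (α/β')) ^ (1/θ)) ^ (1/(1/θ)) * (∫⁻ x, (V x ^ (α/β)) ^ (β/α)) ^ (1/(β/α))) := by
        gcongr
        exact ENNReal.lintegral_mul_le_Lp_mul_Lq volume hconj ((HL_meas hHm).pow_const _).aemeasurable
          (hVm.pow_const _).aemeasurable
    _ = 8 ^ (α/β') * ((∫⁻ x, HL H x ^ (α/(β'*θ))) ^ θ * (∫⁻ x, V x) ^ (α/β)) := by
        congr 2
        · rw [one_div_one_div]; congr 2; ext x; rw [← ENNReal.rpow_mul]; congr 1; field_simp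
        · rw [one_div_div]; congr 2; ext x; rw [← ENNReal.rpow_mul, div_mul_div_cancel₀ hβ0.ne', div_self hα0.ne', ENNReal.rpow_one]
    _ ≤ 8 ^ (α/β') * ((C1 * ∫⁻ x, Z x ^ (α/β)) ^ θ * (16 * ∫⁻ x, Z x ^ (α/β)) ^ (α/β)) := by
        gcongr 8 ^ (α/β') * (?_ ^ θ * ?_ ^ (α/β))
        refine (hmax H hHm).trans (le_of_eq ?_)
        congr 2; ext x
        simp only [hH]
        rw [← ENNReal.rpow_mul]; congr 1
        field_simp
    _ = _ := by
        rw [ENNReal.mul_rpow_of_nonneg _ _ hθ0.le, ENNReal.mul_rpow_of_nonneg _ _ (by positivity)]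
        set X := ∫⁻ x, Z x ^ (α/β)
        have : X ^ θ * X ^ (α/β) = X := by
          rw [← ENNReal.rpow_add_of_nonneg _ _ hθ0.le (by positivity), hθ]; simp
        calc _ = 8 ^ (α/β') * (C1 ^ θ * 16 ^ (α/β)) * (X ^ θ * X ^ (α/β)) := by ring
          _ = _ := by rw [this]

theorem VV {α : ℝ} {β : ℝ≥0∞} (hα : 1 < α) (hβ : 1 < β) : ∃ C : ℝ≥0∞, C ≠ ∞ ∧
    ∀ (σ : ℤ → ℤ) (F : ℤ → ℝ → ℝ≥0∞), (∀ j, Measurable (F j)) →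
    ∫⁻ x, lqNorm β (fun j => kav (σ j) (F j) x) ^ α ≤ C * ∫⁻ x, lqNorm β (fun j => F j x) ^ α := by
  by_cases hinf : β = ∞
  · obtain ⟨C, hC, hmax⟩ := maximal_Lp hα
    refine ⟨8 ^ α * C, ENNReal.mul_ne_top (ENNReal.rpow_ne_top_of_nonneg (by linarith) (by simp)) hC, fun σ F hF => ?_⟩
    simp only [lqNorm, hinf, if_true]
    have hm : Measurable fun x => ⨆ j, F j x := Measurable.iSup hF
    calc _ ≤ ∫⁻ x, (8 * HL (fun x => ⨆ j, F j x) x) ^ α := by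
          refine lintegral_mono fun x => ?_
          gcongr
          refine iSup_le fun j => ?_
          refine (kav_le_HL (σ j) (hF j) x).trans ?_
          gcongr
          exact HL_mono (fun y => le_iSup (fun j => F j y) j) x
      _ = 8 ^ α * ∫⁻ x, HL (fun x => ⨆ j, F j x) x ^ α := by
          rw [← lintegral_const_mul' _ _ (ENNReal.rpow_ne_top_of_nonneg (by linarith) (by simp))]
          congr 1; ext x; rw [ENNReal.mul_rpow_of_nonneg _ _ (by linarith)]
      _ ≤ _ := by rw [mul_assoc]; gcongr; exact hmax _ hm
  · have hb : 1 < β.toReal := by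
      rw [← ENNReal.toReal_one]; exact (ENNReal.toReal_lt_toReal (by simp) hinf).2 hβ
    obtain ⟨C, hC, h⟩ := VVfin hα hb
    refine ⟨C, hC, fun σ F hF => ?_⟩
    simp only [lqNorm, hinf, if_false, ← ENNReal.rpow_mul, one_div_mul_eq_div]
    exact h σ F hF

lemma minkowski {X : Type*} [MeasurableSpace X] (μ : Measure X) {p : ℝ} (hp : 1 ≤ p)
    (F : ℤ → X → ℝ≥0∞) (hF : ∀ l, Measurable (F l)) :
    (∫⁻ x, (∑' l, F l x) ^ p ∂μ) ^ (1/p) ≤ ∑' l, (∫⁻ x, F l x ^ p ∂μ) ^ (1/p) := by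
  have hp0 : 0 < p := by linarith
  have hfin : ∀ s : Finset ℤ, (∫⁻ x, (∑ l ∈ s, F l x) ^ p ∂μ) ^ (1/p) ≤ ∑ l ∈ s, (∫⁻ x, F l x ^ p ∂μ) ^ (1/p) := by
    intro s
    classical
    induction s using Finset.induction_on with
    | empty => simp [hp0]
    | insert a s ha ih =>
      simp only [Finset.sum_insert ha]
      refine (ENNReal.lintegral_Lp_add_le (hF a).aemeasurable (Finset.measurable_fun_sum s fun l _ => hF l).aemeasurable hp).trans ?_
      gcongr
  have h1 : ∀ x, (∑' l, F l x) ^ p = ⨆ s : Finset ℤ, (∑ l ∈ s, F l x) ^ p := by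
    intro x
    rw [ENNReal.tsum_eq_iSup_sum]
    exact (ENNReal.monotone_rpow_of_nonneg hp0.le).map_iSup_of_continuousAt
      (ENNReal.continuous_rpow_const.continuousAt) (by simp [hp0])
  simp_rw [h1]
  rw [lintegral_iSup_directed]
  · rw [(ENNReal.monotone_rpow_of_nonneg (z := 1/p) (by positivity)).map_iSup_of_continuousAt
      (ENNReal.continuous_rpow_const.continuousAt) (by simp [hp0])]
    exact iSup_le fun s => (hfin s).trans (ENNReal.sum_le_tsum s)
  · intro s
    exact ((Finset.measurable_fun_sum s fun l _ => hF l).pow_const _).aemeasurable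
  · classical
    intro s t
    refine ⟨s ∪ t, fun x => ?_, fun x => ?_⟩
    · exact ENNReal.rpow_le_rpow (Finset.sum_le_sum_of_subset Finset.subset_union_left) hp0.le
    · exact ENNReal.rpow_le_rpow (Finset.sum_le_sum_of_subset Finset.subset_union_right) hp0.le

lemma lqNorm_tsum {q : ℝ≥0∞} (hq : 1 ≤ q) (F : ℤ → ℤ → ℝ≥0∞) :
    lqNorm q (fun j => ∑' l, F l j) ≤ ∑' l, lqNorm q (F l) := by
  by_cases hinf : q = ∞
  · simp only [lqNorm, hinf, if_true]
    refine iSup_le fun j => ENNReal.tsum_le_tsum fun l => le_iSup (F l) j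
  · simp only [lqNorm, hinf, if_false]
    have hb : 1 ≤ q.toReal := by
      rw [← ENNReal.toReal_one]; exact (ENNReal.toReal_le_toReal (by simp) hinf).2 hq
    have := minkowski (Measure.count : Measure ℤ) hb F (fun l => Measurable.of_discrete)
    simpa [lintegral_count] using this

lemma lqNorm_mono {q : ℝ≥0∞} {F G : ℤ → ℝ≥0∞} (h : ∀ j, F j ≤ G j) : lqNorm q F ≤ lqNorm q G := by
  unfold lqNorm
  split_ifs
  · gcongr; exact h _
  · gcongr; exact h _

lemma lqNorm_const_mul {q : ℝ≥0∞} (hq : 1 ≤ q) (c : ℝ≥0∞) (F : ℤ → ℝ≥0∞) :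
    lqNorm q (fun j => c * F j) = c * lqNorm q F := by
  unfold lqNorm
  split_ifs with h
  · rw [ENNReal.mul_iSup]
  · have hb : 1 ≤ q.toReal := by
      rw [← ENNReal.toReal_one]; exact (ENNReal.toReal_le_toReal (by simp) h).2 hq
    have hb0 : 0 < q.toReal := by linarith
    simp_rw [ENNReal.mul_rpow_of_nonneg _ _ hb0.le]
    rw [ENNReal.tsum_mul_left, ENNReal.mul_rpow_of_nonneg _ _ (by positivity), ← ENNReal.rpow_mul,
      mul_one_div_cancel hb0.ne', ENNReal.rpow_one]

lemma lqNorm_shift (q : ℝ≥0∞) (l : ℤ) (F : ℤ → ℝ≥0∞) :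
    lqNorm q (fun j => F (j + l)) = lqNorm q F := by
  unfold lqNorm
  split_ifs
  · exact (Equiv.addRight l).iSup_comp (g := F)
  · congr 1; exact (Equiv.addRight l).tsum_eq (fun j => F j ^ q.toReal)

lemma lqNorm_rpow {q : ℝ≥0∞} (hq : q ≠ 0) {r : ℝ} (hr : 0 < r) (F : ℤ → ℝ≥0∞) :
    lqNorm q (fun j => F j ^ (1/r)) = lqNorm (q / ENNReal.ofReal r) F ^ (1/r) := by
  unfold lqNorm
  by_cases h : q = ∞
  · have : q / ENNReal.ofReal r = ∞ := by rw [h, ENNReal.top_div_of_ne_top (by simp)]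
    rw [if_pos h, if_pos this]
    exact ((ENNReal.monotone_rpow_of_nonneg (by positivity)).map_iSup_of_continuousAt
      (ENNReal.continuous_rpow_const.continuousAt) (by simp [hr])).symm
  · have : q / ENNReal.ofReal r ≠ ∞ := ENNReal.div_ne_top h (by simpa using hr)
    rw [if_neg h, if_neg this, ← ENNReal.rpow_mul]
    have hqp : 0 < q.toReal := ENNReal.toReal_pos hq h
    rw [ENNReal.toReal_div, ENNReal.toReal_ofReal hr.le]
    congr 1
    · congr 1; ext j; rw [← ENNReal.rpow_mul]; congr 1; ring
    · field_simp

lemma lqNorm_meas {q : ℝ≥0∞} {F : ℤ → ℝ → ℝ≥0∞} (hF : ∀ j, Measurable (F j)) :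
    Measurable fun x => lqNorm q (fun j => F j x) := by
  unfold lqNorm
  split_ifs
  · exact Measurable.iSup hF
  · exact (Measurable.ennreal_tsum fun j => (hF j).pow_const _).pow_const _

lemma e2pi_add (s t : ℝ) : e2pi (s + t) = e2pi s * e2pi t := by
  unfold e2pi; rw [← Complex.exp_add]; congr 1; push_cast; ring

lemma norm_e2pi (t : ℝ) : ‖e2pi t‖ = 1 := by
  unfold e2pi
  rw [show (2 * (Real.pi : ℂ) * Complex.I * (t : ℂ)) = ((2 * Real.pi * t : ℝ) : ℂ) * Complex.I by
    push_cast; ring]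
  exact Complex.norm_exp_ofReal_mul_I _

lemma e2pi_zero : e2pi 0 = 1 := by simp [e2pi]

lemma e2pi_neg_mul (t : ℝ) : e2pi (-t) * e2pi t = 1 := by
  rw [← e2pi_add]; simp [e2pi_zero]

lemma e2pi_cont : Continuous e2pi := by unfold e2pi; fun_prop

/-- Fourier transform of a Schwartz function, as a Schwartz function. -/
noncomputable def fh (η : SchwartzMap ℝ ℂ) : SchwartzMap ℝ ℂ := 𝓕 η

lemma fh_coe (η : SchwartzMap ℝ ℂ) : ⇑(fh η) = 𝓕 (⇑η) := rfl

lemma fh_apply (η : SchwartzMap ℝ ℂ) (ξ : ℝ) : fh η ξ = ∫ t, e2pi (-(t * ξ)) * η t := by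
  rw [fh_coe, Real.fourier_real_eq_integral_exp_smul]
  refine integral_congr_ae (Filter.Eventually.of_forall fun t => ?_)
  simp only [e2pi, smul_eq_mul]
  congr 2; push_cast; ring

lemma fh_inj {η θ : SchwartzMap ℝ ℂ} (h : ∀ ξ, fh η ξ = fh θ ξ) : η = θ := by
  have h1 : fh η = fh θ := SchwartzMap.ext h
  have h2 := congrArg (fun u : SchwartzMap ℝ ℂ => (𝓕⁻ u : SchwartzMap ℝ ℂ)) h1
  simpa [fh] using h2

lemma fh_add (η θ : SchwartzMap ℝ ℂ) (ξ : ℝ) : fh (η + θ) ξ = fh η ξ + fh θ ξ := by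
  simp [fh, FourierTransform.fourier_add]

lemma fh_smul (c : ℂ) (η : SchwartzMap ℝ ℂ) (ξ : ℝ) : fh (c • η) ξ = c * fh η ξ := by
  simp [fh, FourierTransform.fourier_smul]

lemma fh_sub (η θ : SchwartzMap ℝ ℂ) (ξ : ℝ) : fh (η - θ) ξ = fh η ξ - fh θ ξ := by
  have := fh_add (η - θ) θ ξ
  rw [sub_add_cancel] at this
  rw [this]; ring

lemma fh_zero (ξ : ℝ) : fh 0 ξ = 0 := by
  have := fh_smul 0 0 ξ
  simpa using this

lemma fh_sum {ι : Type*} (s : Finset ι) (η : ι → SchwartzMap ℝ ℂ) (ξ : ℝ) :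
    fh (∑ i ∈ s, η i) ξ = ∑ i ∈ s, fh (η i) ξ := by
  classical
  induction s using Finset.induction_on with
  | empty => simp [fh_zero]
  | insert i s hi ih => rw [Finset.sum_insert hi, fh_add, ih, Finset.sum_insert hi]

/-- Convolution of Schwartz functions. -/
noncomputable def scv (f g : SchwartzMap ℝ ℂ) : SchwartzMap ℝ ℂ :=
  SchwartzMap.convolution (ContinuousLinearMap.mul ℂ ℂ) f g

lemma scv_apply (f g : SchwartzMap ℝ ℂ) (x : ℝ) : scv f g x = ∫ t, f t * g (x - t) := by
  unfold scv
  rw [SchwartzMap.convolution_apply]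
  rfl

lemma scv_conv (f g : SchwartzMap ℝ ℂ) (x : ℝ) : scv f g x = conv f g x := scv_apply f g x

lemma fh_scv (f g : SchwartzMap ℝ ℂ) (ξ : ℝ) : fh (scv f g) ξ = fh f ξ * fh g ξ := by
  unfold scv fh
  rw [SchwartzMap.fourier_convolution]
  simp

lemma scv_comm (f g : SchwartzMap ℝ ℂ) : scv f g = scv g f :=
  fh_inj fun ξ => by rw [fh_scv, fh_scv, mul_comm]

lemma scv_assoc (f g h : SchwartzMap ℝ ℂ) : scv (scv f g) h = scv f (scv g h) :=
  fh_inj fun ξ => by simp only [fh_scv, mul_assoc]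

lemma scv_add (f g h : SchwartzMap ℝ ℂ) : scv f (g + h) = scv f g + scv f h := by
  simp [scv]

lemma scv_sub (f g h : SchwartzMap ℝ ℂ) : scv f (g - h) = scv f g - scv f h := by
  simp [scv]

lemma sub_scv (f g h : SchwartzMap ℝ ℂ) : scv (f - g) h = scv f h - scv g h := by
  rw [scv_comm, scv_sub, scv_comm h f, scv_comm h g]

lemma add_scv (f g h : SchwartzMap ℝ ℂ) : scv (f + g) h = scv f h + scv g h := by
  rw [scv_comm, scv_add, scv_comm h f, scv_comm h g]

lemma sum_apply' {ι : Type*} (s : Finset ι) (η : ι → SchwartzMap ℝ ℂ) (x : ℝ) :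
    (∑ i ∈ s, η i) x = ∑ i ∈ s, η i x := by
  classical
  induction s using Finset.induction_on with
  | empty => simp
  | insert i s hi ih => rw [Finset.sum_insert hi, SchwartzMap.add_apply, ih, Finset.sum_insert hi]

/-- L¹-normalised dilation. -/
noncomputable def dil (L : ℝ) (η : SchwartzMap ℝ ℂ) : SchwartzMap ℝ ℂ :=
  if h : L ≠ 0 then (L : ℂ) • SchwartzMap.compCLMOfContinuousLinearEquiv ℂ
    (ContinuousLinearEquiv.smulLeft (Units.mk0 L h)) η else 0

lemma dil_apply (L : ℝ) (η : SchwartzMap ℝ ℂ) (x : ℝ) : dil L η x = (L : ℂ) * η (L * x) := by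
  unfold dil
  split_ifs with h
  · simp [SchwartzMap.smul_apply, Units.smul_def]
  · push Not at h; simp [h]

/-- translation -/
noncomputable def trn (a : ℝ) (η : SchwartzMap ℝ ℂ) : SchwartzMap ℝ ℂ :=
  SchwartzMap.compSubConstCLM ℂ a η

lemma trn_apply (a : ℝ) (η : SchwartzMap ℝ ℂ) (x : ℝ) : trn a η x = η (x - a) := rfl

/-- modulation -/
noncomputable def modS (a : ℝ) (η : SchwartzMap ℝ ℂ) : SchwartzMap ℝ ℂ :=
  𝓕⁻ (trn a (𝓕 η))

lemma fh_modS (a : ℝ) (η : SchwartzMap ℝ ℂ) (ξ : ℝ) : fh (modS a η) ξ = fh η (ξ - a) := by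
  simp [fh, modS, trn_apply]

lemma modS_apply (a : ℝ) (η : SchwartzMap ℝ ℂ) (x : ℝ) : modS a η x = e2pi (a * x) * η x := by
  have key : ∀ (θ : SchwartzMap ℝ ℂ) (y : ℝ), (𝓕⁻ θ : SchwartzMap ℝ ℂ) y
      = ∫ v, e2pi (v * y) * θ v := by
    intro θ y
    rw [SchwartzMap.fourierInv_coe, Real.fourierInv_eq']
    refine integral_congr_ae (Filter.Eventually.of_forall fun t => ?_)
    simp only [e2pi, smul_eq_mul]
    congr 2; simp; ring
  have h1 : η x = ∫ v, e2pi (v * x) * fh η v := by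
    rw [← key]; simp [fh]
  unfold modS
  rw [key]
  rw [h1, ← integral_const_mul,
    ← integral_sub_right_eq_self (fun v => e2pi (a * x) * (e2pi (v * x) * fh η v)) a]
  refine integral_congr_ae (Filter.Eventually.of_forall fun t => ?_)
  simp only [trn_apply, fh]
  rw [← mul_assoc, ← e2pi_add]
  congr 2; ring

lemma norm_modS (a : ℝ) (η : SchwartzMap ℝ ℂ) (x : ℝ) : ‖modS a η x‖ = ‖η x‖ := by
  rw [modS_apply, norm_mul, norm_e2pi, one_mul]

lemma fh_trn (a : ℝ) (η : SchwartzMap ℝ ℂ) (ξ : ℝ) :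
    fh (trn a η) ξ = e2pi (-(a * ξ)) * fh η ξ := by
  rw [fh_apply, fh_apply, ← integral_const_mul,
    ← integral_sub_right_eq_self (fun t => e2pi (-(a * ξ)) * (e2pi (-(t * ξ)) * η t)) a]
  refine integral_congr_ae (Filter.Eventually.of_forall fun t => ?_)
  simp only [trn_apply]
  rw [← mul_assoc, ← e2pi_add]
  congr 2; ring

lemma fh_dil {L : ℝ} (hL : 0 < L) (η : SchwartzMap ℝ ℂ) (ξ : ℝ) :
    fh (dil L η) ξ = fh η (ξ / L) := by
  rw [fh_apply, fh_apply]
  have := Measure.integral_comp_mul_left (fun t => e2pi (-(t * (ξ / L))) * η t) L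
  rw [abs_of_pos (inv_pos.2 hL)] at this
  have h2 : ∫ t, e2pi (-(t * (ξ / L))) * η t
      = (L : ℂ) * ∫ x, e2pi (-((L * x) * (ξ / L))) * η (L * x) := by
    rw [this]
    simp only [Complex.real_smul]
    push_cast
    rw [← mul_assoc, mul_inv_cancel₀ (by exact_mod_cast hL.ne'), one_mul]
  rw [h2, ← integral_const_mul]
  refine integral_congr_ae (Filter.Eventually.of_forall fun t => ?_)
  simp only [dil_apply]
  rw [show L * t * (ξ / L) = t * ξ by field_simp]
  ring

/-- multiplication by `t` -/
noncomputable def xm (η : SchwartzMap ℝ ℂ) : SchwartzMap ℝ ℂ :=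
  SchwartzMap.smulLeftCLM ℂ (fun t : ℝ => t) η

lemma xm_apply (η : SchwartzMap ℝ ℂ) (x : ℝ) : xm η x = (x : ℂ) * η x := by
  unfold xm
  rw [SchwartzMap.smulLeftCLM_apply_apply (by fun_prop)]
  simp

lemma fh_xm_supp (η : SchwartzMap ℝ ℂ) {K : Set ℝ} (hK : IsClosed K)
    (h : ∀ ξ, ξ ∉ K → fh η ξ = 0) : ∀ ξ, ξ ∉ K → fh (xm η) ξ = 0 := by
  intro ξ hξ
  have h1 : deriv (𝓕 (⇑η)) ξ = 0 := by
    have : (𝓕 (⇑η)) =ᶠ[nhds ξ] fun _ => 0 := by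
      filter_upwards [hK.isOpen_compl.mem_nhds hξ] with y hy using h y hy
    rw [this.deriv_eq]; simp
  rw [Real.deriv_fourier η.integrable] at h1
  · have h2 : (𝓕 fun x : ℝ => ((-2 * π * Complex.I * x : ℂ)) • η x) ξ
      = fh ((-2 * π * Complex.I : ℂ) • xm η) ξ := by
      rw [fh_coe]
      refine congrFun (congrArg _ ?_) ξ
      ext x; simp [xm_apply]; ring
    rw [h2, fh_smul] at h1
    rcases mul_eq_zero.1 h1 with h3 | h3
    · exfalso; simp [Real.pi_ne_zero] at h3
    · exact h3
  · have := (xm η).integrable (μ := volume)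
    refine this.congr (Filter.Eventually.of_forall fun t => ?_)
    simp [xm_apply]

lemma enorm_sq_eq (z : ℂ) : ‖z‖ₑ ^ 2 = ENNReal.ofReal (‖z‖ ^ 2) := by
  rw [ENNReal.ofReal_pow (norm_nonneg _), ofReal_norm]

lemma l2_integrable (η : SchwartzMap ℝ ℂ) : Integrable (fun x => ‖η x‖ ^ 2) := by
  have := (η.memLp 2 (volume : Measure ℝ)).integrable_norm_pow (by norm_num)
  simpa using this

lemma l2_eq (η : SchwartzMap ℝ ℂ) : ∫⁻ x, ‖η x‖ₑ ^ 2 = ENNReal.ofReal (∫ x, ‖η x‖ ^ 2) := by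
  rw [ofReal_integral_eq_lintegral_ofReal (l2_integrable η)
    (Filter.Eventually.of_forall fun x => by positivity)]
  simp only [enorm_sq_eq]

lemma l2_fin (η : SchwartzMap ℝ ℂ) : ∫⁻ x, ‖η x‖ₑ ^ 2 ≠ ∞ := by
  rw [l2_eq]; exact ENNReal.ofReal_ne_top

lemma plancherel (η : SchwartzMap ℝ ℂ) : ∫⁻ x, ‖fh η x‖ₑ ^ 2 = ∫⁻ x, ‖η x‖ₑ ^ 2 := by
  rw [l2_eq, l2_eq]
  congr 1
  exact SchwartzMap.integral_norm_sq_fourier η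

lemma sch_meas (η : SchwartzMap ℝ ℂ) : Measurable fun x => ‖η x‖ₑ := η.continuous.measurable.enorm

lemma enorm_sum_disjoint {ι : Type*} [Fintype ι] (z : ι → ℂ)
    (h : ∀ i i', i ≠ i' → z i = 0 ∨ z i' = 0) : ‖∑ i, z i‖ₑ ^ 2 = ∑ i, ‖z i‖ₑ ^ 2 := by
  by_cases h0 : ∀ i, z i = 0
  · simp [h0]
  · push Not at h0
    obtain ⟨i, hi⟩ := h0
    have h1 : ∀ i', i' ≠ i → z i' = 0 := fun i' hne => (h i' i hne).resolve_right hi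
    rw [Finset.sum_eq_single i (fun b _ hb => h1 b hb) (by simp),
      Finset.sum_eq_single i (fun b _ hb => by simp [h1 b hb]) (by simp)]

lemma l2_orth {ι : Type*} [Fintype ι] (U : ι → SchwartzMap ℝ ℂ) (K : ι → Set ℝ)
    (hd : ∀ i i', i ≠ i' → Disjoint (K i) (K i')) (hs : ∀ i ξ, ξ ∉ K i → fh (U i) ξ = 0)
    (c : ι → ℂ) : ∫⁻ x, ‖(∑ i, c i • U i) x‖ₑ ^ 2 = ∑ i, ‖c i‖ₑ ^ 2 * ∫⁻ x, ‖U i x‖ₑ ^ 2 := by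
  rw [← plancherel]
  have h1 : ∀ ξ, ‖fh (∑ i, c i • U i) ξ‖ₑ ^ 2 = ∑ i, ‖c i‖ₑ ^ 2 * ‖fh (U i) ξ‖ₑ ^ 2 := by
    intro ξ
    rw [fh_sum, enorm_sum_disjoint]
    · simp only [fh_smul, enorm_mul, mul_pow]
    · intro i i' hne
      by_cases hi : ξ ∈ K i
      · right
        rw [fh_smul, hs i' ξ (fun h => (Set.disjoint_left.1 (hd i i' hne)) hi h), mul_zero]
      · left
        rw [fh_smul, hs i ξ hi, mul_zero]
  simp only [h1]
  rw [lintegral_finsetSum _ fun i _ => ((sch_meas _).pow_const 2).const_mul _]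
  refine Finset.sum_congr rfl fun i _ => ?_
  rw [lintegral_const_mul _ ((sch_meas _).pow_const 2), plancherel]

lemma cs_sq (F G : ℝ → ℝ≥0∞) (hF : Measurable F) (hG : Measurable G) :
    (∫⁻ x, F x * G x) ^ 2 ≤ (∫⁻ x, F x ^ 2) * ∫⁻ x, G x ^ 2 := by
  have h := ENNReal.lintegral_mul_le_Lp_mul_Lq volume (p := 2) (q := 2)
    (Real.HolderConjugate.two_two) hF.aemeasurable hG.aemeasurable
  calc (∫⁻ x, F x * G x) ^ 2
      ≤ ((∫⁻ x, F x ^ (2:ℝ)) ^ (1/2:ℝ) * (∫⁻ x, G x ^ (2:ℝ)) ^ (1/2:ℝ)) ^ 2 := by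
        gcongr; exact h
    _ = _ := by
      rw [mul_pow, ← ENNReal.rpow_natCast, ← ENNReal.rpow_natCast, ← ENNReal.rpow_mul,
        ← ENNReal.rpow_mul]
      norm_num

lemma bessel {ι : Type*} [Fintype ι] (U : ι → SchwartzMap ℝ ℂ) (K : ι → Set ℝ)
    (hd : ∀ i i', i ≠ i' → Disjoint (K i) (K i')) (hs : ∀ i ξ, ξ ∉ K i → fh (U i) ξ = 0)
    (M : ℝ≥0∞) (hM : ∀ i, ∫⁻ x, ‖U i x‖ₑ ^ 2 ≤ M) (F : ℝ → ℂ) (hF : Measurable F)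
    (hinteg0 : ∀ i, Integrable fun t => F t * U i t) :
    ∑ i, ‖∫ t, F t * U i t‖ₑ ^ 2 ≤ M * ∫⁻ x, ‖F x‖ₑ ^ 2 := by
  set c : ι → ℂ := fun i => ∫ t, F t * U i t with hc
  set S : ℝ≥0∞ := ∑ i, ‖c i‖ₑ ^ 2 with hS
  have hStop : S ≠ ∞ := by
    rw [hS]; exact ENNReal.sum_ne_top.2 fun i _ => by simp
  set G : SchwartzMap ℝ ℂ := ∑ i, (starRingEnd ℂ (c i)) • U i with hG
  have hG2 : ∫⁻ x, ‖G x‖ₑ ^ 2 ≤ M * S := by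
    rw [hG, l2_orth U K hd hs]
    rw [hS, Finset.mul_sum]
    refine Finset.sum_le_sum fun i _ => ?_
    rw [show ‖(starRingEnd ℂ) (c i)‖ₑ = ‖c i‖ₑ by
      rw [← ofReal_norm, ← ofReal_norm, RCLike.norm_conj], mul_comm]
    exact mul_le_mul_left (hM i) _
  have hFG : ∫ t, F t * G t = ((∑ i, ‖c i‖ ^ 2 : ℝ) : ℂ) := by
    have : ∀ t, F t * G t = ∑ i, (starRingEnd ℂ (c i)) * (F t * U i t) := by
      intro t
      rw [hG, sum_apply', Finset.mul_sum]
      refine Finset.sum_congr rfl fun i _ => ?_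
      rw [SchwartzMap.smul_apply, smul_eq_mul]; ring
    simp only [this]
    rw [integral_finsetSum _ fun i _ => (hinteg0 i).const_mul _]
    push_cast
    refine Finset.sum_congr rfl fun i _ => ?_
    rw [integral_const_mul, Complex.conj_mul']
  have hSe : S = ‖∫ t, F t * G t‖ₑ := by
    rw [hFG, ← ofReal_norm, Complex.norm_real, Real.norm_of_nonneg (by positivity),
      ENNReal.ofReal_sum_of_nonneg fun i _ => by positivity, hS]
    exact Finset.sum_congr rfl fun i _ => enorm_sq_eq _
  have h1 : S ^ 2 ≤ (∫⁻ x, ‖F x‖ₑ ^ 2) * (M * S) := by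
    calc S ^ 2 ≤ (∫⁻ x, ‖F x‖ₑ * ‖G x‖ₑ) ^ 2 := by
          gcongr
          rw [hSe]
          refine (enorm_integral_le_lintegral_enorm _).trans (le_of_eq ?_)
          simp only [enorm_mul]
      _ ≤ _ := (cs_sq _ _ hF.enorm (sch_meas G)).trans (mul_le_mul_right hG2 _)
  by_cases h0 : S = 0
  · rw [h0]; exact zero_le
  · rw [sq, ← mul_assoc] at h1
    have := (ENNReal.mul_le_mul_iff_left h0 hStop).1 h1
    rwa [mul_comm] at this

/-- cubic decay profile at scale `2^j`. -/
noncomputable def kr (j : ℤ) (t : ℝ) : ℝ := 2 ^ j / (1 + 2 ^ j * |t|) ^ 3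

lemma kr_nonneg (j : ℤ) (t : ℝ) : 0 ≤ kr j t := by unfold kr; positivity

/-- quartic decay profile at scale `2^j`. -/
noncomputable def k4 (j : ℤ) (t : ℝ) : ℝ≥0∞ := ENNReal.ofReal (2 ^ j / (1 + 2 ^ j * |t|) ^ 4)

lemma k4_meas (j : ℤ) : Measurable (k4 j) := by
  unfold k4
  have : Continuous fun t : ℝ => (2:ℝ) ^ j / (1 + 2 ^ j * |t|) ^ 4 := by
    refine Continuous.div (by fun_prop) (by fun_prop) fun t => by positivity
  exact this.measurable.ennreal_ofReal

lemma BL {ι : Type*} [Fintype ι] (u : ι → SchwartzMap ℝ ℂ) (K : ι → Set ℝ)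
    (hK : ∀ i, IsClosed (K i))
    (hd : ∀ i i', i ≠ i' → Disjoint (K i) (K i')) (hs : ∀ i ξ, ξ ∉ K i → fh (u i) ξ = 0)
    (j : ℤ) (B : ℝ) (hB0 : 0 ≤ B) (hB : ∀ i t, ‖u i t‖ ≤ B * kr j t) (f : SchwartzMap ℝ ℂ) (x : ℝ) :
    ∑ i, ‖scv f (u i) x‖ₑ ^ 2
      ≤ ENNReal.ofReal (64 * B ^ 2) * ∫⁻ t, k4 j (x - t) * ‖f t‖ₑ ^ 2 := by
  set δ : ℝ := 2 ^ j with hδ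
  have hδ0 : 0 < δ := by positivity
  set W : ℝ → ℂ := fun s => (1 + Complex.I * (δ * s : ℝ)) ^ 2 with hW
  have hWn : ∀ s, ‖W s‖ = 1 + (δ * s) ^ 2 := by
    intro s
    rw [hW]; simp only [norm_pow]
    rw [← Complex.normSq_eq_norm_sq, Complex.normSq_apply]
    simp; ring
  have hW0 : ∀ s, W s ≠ 0 := fun s => by
    rw [← norm_pos_iff, hWn]; positivity
  set U : ι → SchwartzMap ℝ ℂ := fun i => u i + (2 * Complex.I * δ : ℂ) • xm (u i)
    + (-(δ:ℂ) ^ 2) • xm (xm (u i)) with hU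
  have hUa : ∀ i t, U i t = W t * u i t := by
    intro i t
    simp only [hU, hW, SchwartzMap.add_apply, SchwartzMap.smul_apply, xm_apply, smul_eq_mul]
    push_cast
    have := Complex.I_sq
    linear_combination (-(δ:ℂ)^2 * t^2 * u i t) * this
  have hUs : ∀ i ξ, ξ ∉ K i → fh (U i) ξ = 0 := by
    intro i ξ hξ
    simp only [hU, fh_add, fh_smul]
    rw [hs i ξ hξ, fh_xm_supp (u i) (hK i) (hs i) ξ hξ,
      fh_xm_supp _ (hK i) (fh_xm_supp (u i) (hK i) (hs i)) ξ hξ]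
    ring
  -- reflected version
  have hU2 : ∀ i, ∫⁻ t, ‖U i t‖ₑ ^ 2 ≤ ENNReal.ofReal (B ^ 2 * δ) * 16 := by
    intro i
    have h1 : ∀ t, ‖U i t‖ₑ ^ 2 ≤ ENNReal.ofReal (B ^ 2 * δ) * (kw j (0 - t) * 1) := by
      intro t
      rw [enorm_sq_eq, mul_one, kw, ← ENNReal.ofReal_mul (by positivity)]
      refine ENNReal.ofReal_le_ofReal ?_
      rw [hUa, norm_mul, hWn, zero_sub, abs_neg]
      have ha : 1 + (δ * t) ^ 2 ≤ (1 + δ * |t|) ^ 2 := by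
        have : (δ * t) ^ 2 = (δ * |t|) ^ 2 := by rw [mul_pow, mul_pow, sq_abs]
        rw [this]
        have : 0 ≤ δ * |t| := by positivity
        nlinarith
      calc ((1 + (δ * t) ^ 2) * ‖u i t‖) ^ 2
          ≤ ((1 + δ * |t|) ^ 2 * (B * (δ / (1 + δ * |t|) ^ 3))) ^ 2 := by
            gcongr; exact hB i t
        _ = _ := by
          rw [← hδ]
          have : (1 + δ * |t|) ≠ 0 := by positivity
          field_simp
    calc _ ≤ ∫⁻ t, ENNReal.ofReal (B ^ 2 * δ) * (kw j (0 - t) * 1) := lintegral_mono h1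
      _ = ENNReal.ofReal (B ^ 2 * δ) * kav j (fun _ => 1) 0 := by
        rw [lintegral_const_mul']
        · rfl
        · exact ENNReal.ofReal_ne_top
      _ ≤ _ := by gcongr; exact kav_one j 0
  -- use the reflection s = x - t
  have hsc : ∀ i, scv f (u i) x = ∫ s, (f (x - s) / W s) * U i s := by
    intro i
    rw [scv_apply, ← integral_sub_left_eq_self (fun t => f t * u i (x - t)) volume x]
    refine integral_congr_ae (Filter.Eventually.of_forall fun s => ?_)
    simp only [hUa]
    rw [show x - (x - s) = s by ring]
    field_simp [hW0 s]
  have hWc : Continuous W := by rw [hW]; fun_prop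
  have hF : Measurable fun s => f (x - s) / W s :=
    ((f.continuous.comp (by fun_prop : Continuous fun s : ℝ => x - s)).div hWc hW0).measurable
  have hinteg0 : ∀ i, Integrable fun s => (f (x - s) / W s) * U i s := by
    intro i
    have h0 : ∃ Cb, ∀ y, ‖f y‖ ≤ Cb := by
      obtain ⟨Cb, hCb⟩ := f.decay 0 0
      exact ⟨Cb, fun y => by simpa using hCb.2 y⟩
    obtain ⟨Cb, hCb⟩ := h0
    refine Integrable.bdd_mul (c := Cb) (U i).integrable hF.aestronglyMeasurable
      (Filter.Eventually.of_forall fun s => ?_)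
    rw [norm_div, hWn]
    refine (div_le_self (norm_nonneg _) ?_).trans (hCb _)
    nlinarith [sq_nonneg (δ * s)]
  have hb := bessel U K hd hUs _ hU2 _ hF hinteg0
  simp only [hsc]
  refine hb.trans ?_
  have h2 : ∀ s, ‖f (x - s) / W s‖ₑ ^ 2
      ≤ ENNReal.ofReal (4 / δ) * (k4 j s * ‖f (x - s)‖ₑ ^ 2) := by
    intro s
    rw [enorm_sq_eq, enorm_sq_eq, k4, ← ENNReal.ofReal_mul (by positivity),
      ← ENNReal.ofReal_mul (by positivity)]
    refine ENNReal.ofReal_le_ofReal ?_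
    rw [norm_div, hWn, div_pow, ← hδ]
    have ha : (1 + δ * |s|) ^ 2 ≤ 2 * (1 + (δ * s) ^ 2) := by
      have : (δ * s) ^ 2 = (δ * |s|) ^ 2 := by rw [mul_pow, mul_pow, sq_abs]
      rw [this]; nlinarith [sq_nonneg (1 - δ * |s|)]
    have hb : (1 + δ * |s|) ^ 4 ≤ 4 * (1 + (δ * s) ^ 2) ^ 2 := by
      calc (1 + δ * |s|) ^ 4 = ((1 + δ * |s|) ^ 2) ^ 2 := by ring
        _ ≤ (2 * (1 + (δ * s) ^ 2)) ^ 2 := by gcongr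
        _ = _ := by ring
    have hp : 0 < 1 + δ * |s| := by positivity
    rw [show 4 / δ * (δ / (1 + δ * |s|) ^ 4 * ‖f (x - s)‖ ^ 2)
      = ‖f (x - s)‖ ^ 2 * (4 / (1 + δ * |s|) ^ 4) by field_simp, div_eq_mul_inv]
    gcongr
    rw [inv_eq_one_div, div_le_div_iff₀ (by positivity) (by positivity)]
    linarith
  have h3 : ∫⁻ s, k4 j s * ‖f (x - s)‖ₑ ^ 2 = ∫⁻ t, k4 j (x - t) * ‖f t‖ₑ ^ 2 := by
    rw [← lintegral_sub_left_eq_self (fun s => k4 j s * ‖f (x - s)‖ₑ ^ 2) x]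
    simp
  calc _ ≤ ENNReal.ofReal (B ^ 2 * δ) * 16 *
        ∫⁻ s, ENNReal.ofReal (4 / δ) * (k4 j s * ‖f (x - s)‖ₑ ^ 2) := by
        gcongr with s; exact h2 s
    _ = ENNReal.ofReal (B ^ 2 * δ) * 16 * (ENNReal.ofReal (4 / δ) *
        ∫⁻ t, k4 j (x - t) * ‖f t‖ₑ ^ 2) := by
        rw [lintegral_const_mul' _ _ ENNReal.ofReal_ne_top, h3]
    _ = _ := by
      rw [← mul_assoc]
      congr 1
      rw [show (16 : ℝ≥0∞) = ENNReal.ofReal 16 by norm_num,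
        ← ENNReal.ofReal_mul (by positivity), ← ENNReal.ofReal_mul (by positivity)]
      congr 1; field_simp; ring

lemma sdecay (η : SchwartzMap ℝ ℂ) (n : ℕ) : ∃ C : ℝ, 0 ≤ C ∧ ∀ u, ‖η u‖ ≤ C / (1 + |u|) ^ n := by
  refine ⟨2 ^ n * ((Finset.Iic (n, 0)).sup fun m => SchwartzMap.seminorm ℝ m.1 m.2) η,
    by positivity, fun u => ?_⟩
  rw [le_div_iff₀ (by positivity), mul_comm]
  have := SchwartzMap.one_add_le_sup_seminorm_apply (𝕜 := ℝ) (m := (n, 0)) (k := n) (n := 0)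
    le_rfl le_rfl η u
  simpa using this

lemma sdiff3 (η : SchwartzMap ℝ ℂ) : ∃ C : ℝ, 0 ≤ C ∧ ∀ u τ : ℝ, |τ| ≤ 1 →
    ‖η u - η (u - τ)‖ ≤ C * |τ| / (1 + |u|) ^ 3 := by
  obtain ⟨C, hC, h⟩ := sdecay (SchwartzMap.derivCLM ℂ ℂ η) 3
  refine ⟨8 * C, by positivity, fun u τ hτ => ?_⟩
  have hb : ∀ w ∈ Metric.closedBall u |τ|, ‖deriv η w‖ ≤ 8 * C / (1 + |u|) ^ 3 := by
    intro w hw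
    rw [Metric.mem_closedBall, Real.dist_eq] at hw
    refine (h w).trans ?_
    rw [div_le_div_iff₀ (by positivity) (by positivity)]
    have h1 : 1 + |u| ≤ 2 * (1 + |w|) := by
      have : |u| ≤ |w| + |w - u| := by
        have := abs_sub_abs_le_abs_sub u w
        rw [abs_sub_comm u w] at this; linarith
      have := abs_nonneg w
      linarith
    calc C * (1 + |u|) ^ 3 ≤ C * (2 * (1 + |w|)) ^ 3 := by gcongr
      _ = _ := by ring
  have := (convex_closedBall u |τ|).norm_image_sub_le_of_norm_deriv_le (f := η)
    (fun w _ => η.differentiableAt) hb (x := u - τ) (y := u) (by simp [Real.dist_eq])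
    (by simp)
  refine this.trans (le_of_eq ?_)
  rw [show u - (u - τ) = τ by ring, Real.norm_eq_abs]; ring

lemma dil_bound (η : SchwartzMap ℝ ℂ) : ∃ C : ℝ, 0 ≤ C ∧ ∀ (j : ℤ) (t : ℝ),
    ‖dil (2 ^ j) η t‖ ≤ C * kr j t ∧ ∀ d, 2 ^ j * |d| ≤ 1 →
      ‖dil (2 ^ j) η t - dil (2 ^ j) η (t - d)‖ ≤ C * (2 ^ j * |d|) * kr j t := by
  obtain ⟨C, hC, h⟩ := sdecay η 3
  obtain ⟨D, hD, h'⟩ := sdiff3 η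
  refine ⟨C + D, by positivity, fun j t => ⟨?_, fun d hd => ?_⟩⟩
  · rw [dil_apply, norm_mul, Complex.norm_real, Real.norm_of_nonneg (by positivity)]
    have := h (2 ^ j * t)
    rw [abs_mul, abs_of_pos (by positivity : (0:ℝ) < 2 ^ j)] at this
    unfold kr
    calc (2:ℝ) ^ j * ‖η (2 ^ j * t)‖ ≤ 2 ^ j * (C / (1 + 2 ^ j * |t|) ^ 3) := by gcongr
      _ = C * (2 ^ j / (1 + 2 ^ j * |t|) ^ 3) := by ring
      _ ≤ _ := by gcongr; linarith
  · rw [dil_apply, dil_apply, ← mul_sub, norm_mul, Complex.norm_real,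
      Real.norm_of_nonneg (by positivity)]
    have := h' (2 ^ j * t) (2 ^ j * d) (by
      rwa [abs_mul, abs_of_pos (by positivity : (0:ℝ) < 2 ^ j)])
    rw [abs_mul, abs_mul, abs_of_pos (by positivity : (0:ℝ) < 2 ^ j), ← mul_sub] at this
    unfold kr
    calc (2:ℝ) ^ j * ‖η (2 ^ j * t) - η (2 ^ j * (t - d))‖
        ≤ 2 ^ j * (D * (2 ^ j * |d|) / (1 + 2 ^ j * |t|) ^ 3) := by gcongr
      _ = D * (2 ^ j * |d|) * (2 ^ j / (1 + 2 ^ j * |t|) ^ 3) := by ring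
      _ ≤ _ := by gcongr; linarith

lemma kr_shift (j : ℤ) (t s : ℝ) : kr j (t - s) ≤ kr j t * (1 + 2 ^ j * |s|) ^ 3 := by
  unfold kr
  have h0 : (0:ℝ) < 2 ^ j := by positivity
  rw [div_mul_eq_mul_div, div_le_div_iff₀ (by positivity) (by positivity), mul_assoc, ← mul_pow]
  gcongr
  have : |t| ≤ |t - s| + |s| := by
    have := abs_add_le (t - s) s; rwa [sub_add_cancel] at this
  have h1 : 2 ^ j * |t| ≤ 2 ^ j * (|t - s| + |s|) := by gcongr
  have h2 : 0 ≤ (2 ^ j * |s|) * (2 ^ j * |t - s|) := by positivity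
  nlinarith

lemma CV (η : SchwartzMap ℝ ℂ) : ∃ C : ℝ, 0 ≤ C ∧ ∀ (j : ℤ) (B : ℝ) (v : SchwartzMap ℝ ℂ)
    (a L : ℝ), 0 ≤ B → 2 ^ j / 2 ≤ L → (∀ t, ‖v t‖ ≤ B * kr j t) →
    ∀ t, ‖scv v (modS a (dil L η)) t‖ ≤ C * B * kr j t := by
  refine ⟨∫ s, ‖η s‖ * (1 + 2 * |s|) ^ 3, integral_nonneg fun s => by positivity, ?_⟩
  have hI : Integrable fun s => ‖η s‖ * (1 + 2 * |s|) ^ 3 := by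
    have h0 := η.integrable_pow_mul volume 0
    have h1 := η.integrable_pow_mul volume 1
    have h2 := η.integrable_pow_mul volume 2
    have h3 := η.integrable_pow_mul volume 3
    refine (((h0.add (h1.const_mul 6)).add (h2.const_mul 12)).add (h3.const_mul 8)).congr
      (Filter.Eventually.of_forall fun s => ?_)
    simp only [Pi.add_apply, Real.norm_eq_abs]; ring
  intro j B v a L hB hL hv t
  have h0 : (0:ℝ) < 2 ^ j := by positivity
  have hL0 : 0 < L := by linarith [half_pos h0]
  have hI2 : Integrable fun s => L * (‖η (L * s)‖ * (1 + 2 * |L * s|) ^ 3) :=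
    (hI.comp_mul_left' hL0.ne').const_mul _
  have hval : ∫ s, L * (‖η (L * s)‖ * (1 + 2 * |L * s|) ^ 3) = ∫ s, ‖η s‖ * (1 + 2 * |s|) ^ 3 := by
    rw [integral_const_mul,
      Measure.integral_comp_mul_left (fun s => ‖η s‖ * (1 + 2 * |s|) ^ 3) L,
      abs_of_pos (inv_pos.2 hL0), smul_eq_mul, ← mul_assoc, mul_inv_cancel₀ hL0.ne', one_mul]
  rw [scv_comm, scv_apply, ← hval]
  calc ‖∫ s, modS a (dil L η) s * v (t - s)‖
      ≤ ∫ s, (L * (‖η (L * s)‖ * (1 + 2 * |L * s|) ^ 3)) * (B * kr j t) := by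
        refine norm_integral_le_of_norm_le (hI2.mul_const _)
          (Filter.Eventually.of_forall fun s => ?_)
        rw [norm_mul, norm_modS, dil_apply, norm_mul, Complex.norm_real,
          Real.norm_of_nonneg hL0.le]
        calc L * ‖η (L * s)‖ * ‖v (t - s)‖
            ≤ L * ‖η (L * s)‖ * (B * (kr j t * (1 + 2 * |L * s|) ^ 3)) := by
              gcongr
              refine (hv _).trans ?_
              gcongr
              refine (kr_shift j t s).trans ?_
              have := kr_nonneg j t
              gcongr ?_ * (1 + ?_) ^ 3
              rw [abs_mul, abs_of_pos hL0, ← mul_assoc]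
              gcongr; linarith
          _ = _ := by ring
    _ = _ := by rw [integral_mul_const]; ring

/-- Littlewood–Paley block as Schwartz function -/
noncomputable def psS (Φ : SchwartzMap ℝ ℂ) (j : ℤ) : SchwartzMap ℝ ℂ :=
  dil (2 ^ j) (Φ - dil (1/2) Φ)

lemma psS_eq (Φ : SchwartzMap ℝ ℂ) (j : ℤ) :
    psS Φ j = dil (2 ^ j) Φ - dil (2 ^ (j - 1)) Φ := by
  ext x
  simp only [psS, dil_apply, SchwartzMap.sub_apply]
  rw [zpow_sub_one₀ (by norm_num : (2:ℝ) ≠ 0)]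
  push_cast
  rw [mul_sub, ← mul_assoc]
  congr 2
  · ring
  · congr 1; ring

lemma psS_coe (Φ : SchwartzMap ℝ ℂ) (j : ℤ) : ⇑(psS Φ j) = psi Φ j := by
  ext x
  rw [psS_eq, SchwartzMap.sub_apply, dil_apply, dil_apply, psi]

lemma fh_psS (Φ : SchwartzMap ℝ ℂ) (j : ℤ) (ξ : ℝ) :
    fh (psS Φ j) ξ = fh Φ (ξ / 2 ^ j) - fh Φ (ξ / 2 ^ (j - 1)) := by
  rw [psS_eq, fh_sub, fh_dil (by positivity), fh_dil (by positivity)]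

/-- hypotheses on `Φ` -/
def LP (Φ : SchwartzMap ℝ ℂ) : Prop :=
  Function.support (𝓕 ⇑Φ) ⊆ Set.Icc (-2) 2 ∧ ∀ ξ ∈ Set.Icc (-1:ℝ) 1, 𝓕 ⇑Φ ξ = 1

lemma LP.one {Φ : SchwartzMap ℝ ℂ} (h : LP Φ) {ξ : ℝ} (hξ : |ξ| ≤ 1) : fh Φ ξ = 1 :=
  h.2 ξ (abs_le.1 hξ)

lemma LP.zero {Φ : SchwartzMap ℝ ℂ} (h : LP Φ) {ξ : ℝ} (hξ : 2 < |ξ|) : fh Φ ξ = 0 := by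
  by_contra h0
  exact absurd (abs_le.2 (h.1 h0)) (not_le.2 hξ)

lemma LP.dil_one {Φ : SchwartzMap ℝ ℂ} (h : LP Φ) {ξ : ℝ} {j : ℤ} (hξ : |ξ| ≤ 2 ^ j) :
    fh (dil (2 ^ j) Φ) ξ = 1 := by
  have h0 : (0:ℝ) < 2 ^ j := by positivity
  rw [fh_dil h0]
  apply h.one
  rw [abs_div, abs_of_pos h0, div_le_one h0]; exact hξ

lemma LP.dil_zero {Φ : SchwartzMap ℝ ℂ} (h : LP Φ) {ξ : ℝ} {j : ℤ} (hξ : 2 ^ (j + 1) < |ξ|) :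
    fh (dil (2 ^ j) Φ) ξ = 0 := by
  have h0 : (0:ℝ) < 2 ^ j := by positivity
  rw [fh_dil h0]
  apply h.zero
  rw [abs_div, abs_of_pos h0, lt_div_iff₀ h0]
  rwa [zpow_add_one₀ (by norm_num), mul_comm] at hξ

lemma LP.psS_low {Φ : SchwartzMap ℝ ℂ} (h : LP Φ) {ξ : ℝ} {j : ℤ} (hξ : |ξ| ≤ 2 ^ (j - 1)) :
    fh (psS Φ j) ξ = 0 := by
  rw [psS_eq, fh_sub, h.dil_one hξ, h.dil_one, sub_self]
  exact hξ.trans (zpow_le_zpow_right₀ (by norm_num) (by omega))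

lemma LP.psS_high {Φ : SchwartzMap ℝ ℂ} (h : LP Φ) {ξ : ℝ} {j : ℤ} (hξ : 2 ^ (j + 1) < |ξ|) :
    fh (psS Φ j) ξ = 0 := by
  rw [psS_eq, fh_sub, h.dil_zero hξ, h.dil_zero, sub_self]
  exact lt_of_le_of_lt (zpow_le_zpow_right₀ (by norm_num) (by omega)) hξ

/-- the (demodulated) kernel -/
noncomputable def hk (φ Φ : SchwartzMap ℝ ℂ) (L : ℝ) (j : ℤ) : SchwartzMap ℝ ℂ :=
  scv (dil L φ) (psS Φ j)

lemma modS_scv (a : ℝ) (f g : SchwartzMap ℝ ℂ) : modS a (scv f g) = scv (modS a f) (modS a g) :=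
  fh_inj fun ξ => by simp only [fh_modS, fh_scv]

lemma modS_neg (a : ℝ) (f : SchwartzMap ℝ ℂ) : modS (-a) (modS a f) = f :=
  fh_inj fun ξ => by simp [fh_modS]

lemma modS_zero (f : SchwartzMap ℝ ℂ) : modS 0 f = f :=
  fh_inj fun ξ => by simp [fh_modS]

lemma main_conv (φ Φ f : SchwartzMap ℝ ℂ) (a b : ℝ) (j : ℤ) (x : ℝ) :
    conv (rotConv φ a b f) (psi Φ j) x
      = e2pi (-(a * x)) * scv f (modS a (hk φ Φ (b - a) j)) x := by
  have h1 : rotConv φ a b f = ⇑(modS (-a) (scv f (modS a (dil (b - a) φ)))) := by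
    ext y
    rw [rotConv, modS_apply, scv_conv, neg_mul]
    congr 2
    ext z
    rw [phim, modS_apply, dil_apply]; ring
  rw [h1, ← psS_coe, ← scv_conv, show -(a * x) = -a * x by ring, ← modS_apply]
  congr 1
  refine fh_inj fun ξ => ?_
  simp only [fh_scv, fh_modS, hk, sub_neg_eq_add, add_sub_cancel_right, mul_assoc]

/-- hypothesis on `φ` -/
def PH (φ : SchwartzMap ℝ ℂ) : Prop := Function.support (𝓕 ⇑φ) ⊆ Set.Ioo 0 1

lemma PH.zero {φ : SchwartzMap ℝ ℂ} (h : PH φ) {ξ : ℝ} (hξ : ξ ∉ Set.Ioo (0:ℝ) 1) : fh φ ξ = 0 := by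
  by_contra h0
  exact hξ (h h0)

lemma PH.dil_zero {φ : SchwartzMap ℝ ℂ} (h : PH φ) {ξ L : ℝ} (hL : 0 < L)
    (hξ : ξ ∉ Set.Ioo (0:ℝ) L) : fh (dil L φ) ξ = 0 := by
  rw [fh_dil hL]
  refine h.zero fun h' => hξ ⟨?_, ?_⟩
  · have := h'.1; rwa [lt_div_iff₀ hL, zero_mul] at this
  · have := h'.2; rwa [div_lt_one hL] at this

lemma hk_zero {φ Φ : SchwartzMap ℝ ℂ} (hφ : PH φ) (hΦ : LP Φ) {L : ℝ} (hL : 0 < L) {j : ℤ}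
    (h : L ≤ 2 ^ (j - 1)) : hk φ Φ L j = 0 := by
  refine fh_inj fun ξ => ?_
  rw [hk, fh_scv, fh_zero]
  by_cases hξ : ξ ∈ Set.Ioo (0:ℝ) L
  · rw [hΦ.psS_low, mul_zero]
    rw [abs_of_pos hξ.1]; exact hξ.2.le.trans h
  · rw [hφ.dil_zero hL hξ, zero_mul]

lemma hk_supp {φ Φ : SchwartzMap ℝ ℂ} (hφ : PH φ) {a b : ℝ} (hab : a < b) (j : ℤ)
    (ξ : ℝ) (hξ : ξ ∉ Set.Icc a b) : fh (modS a (hk φ Φ (b - a) j)) ξ = 0 := by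
  rw [fh_modS, hk, fh_scv, hφ.dil_zero (sub_pos.2 hab), zero_mul]
  intro h
  exact hξ ⟨by linarith [h.1], by linarith [h.2]⟩

lemma scv_trn (f g : SchwartzMap ℝ ℂ) (d : ℝ) : scv f (trn d g) = trn d (scv f g) :=
  fh_inj fun ξ => by simp only [fh_scv, fh_trn]; ring

/-- kernel size and smoothness bounds at scale `j` -/
def KB (B : ℝ) (j : ℤ) (h : SchwartzMap ℝ ℂ) : Prop :=
  ∀ t, ‖h t‖ ≤ B * kr j t ∧ ∀ d, 2 ^ j * |d| ≤ 1 → ‖h t - h (t - d)‖ ≤ B * (2 ^ j * |d|) * kr j t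

lemma hk_bound {φ Φ : SchwartzMap ℝ ℂ} (hφ : PH φ) (hΦ : LP Φ) : ∃ C : ℝ, 0 ≤ C ∧
    ∀ (L : ℝ) (j : ℤ), 0 < L → KB C j (hk φ Φ L j) := by
  obtain ⟨C, hC, h⟩ := dil_bound (Φ - dil (1/2) Φ)
  obtain ⟨D, hD, h'⟩ := CV φ
  refine ⟨D * C, by positivity, fun L j hL t => ?_⟩
  by_cases hLj : L ≤ 2 ^ (j - 1)
  · rw [hk_zero hφ hΦ hL hLj]
    have := kr_nonneg j t
    simp only [SchwartzMap.zero_apply, norm_zero, sub_zero]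
    exact ⟨by positivity, fun d _ => by positivity⟩
  · have hLj' : (2:ℝ) ^ j / 2 ≤ L := by
      push Not at hLj
      rw [zpow_sub_one₀ (by norm_num : (2:ℝ) ≠ 0)] at hLj
      rw [div_eq_mul_inv]; exact hLj.le
    constructor
    · have := h' j C (psS Φ j) 0 L hC hLj' (fun t => (h j t).1) t
      rwa [modS_zero, scv_comm] at this
    · intro d hd
      have := h' j (C * (2 ^ j * |d|)) (psS Φ j - trn d (psS Φ j)) 0 L (by positivity) hLj'
        (fun t => (h j t).2 d hd) t
      rw [modS_zero, scv_comm, scv_sub, scv_trn, SchwartzMap.sub_apply, trn_apply] at this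
      refine this.trans (le_of_eq ?_)
      ring

/-- two-sided geometric weight -/
noncomputable def gz (r : ℝ) (l : ℤ) : ℝ≥0∞ := ENNReal.ofReal (r ^ l.natAbs)

lemma gz_sum {r : ℝ} (h0 : 0 ≤ r) (h1 : r < 1) : ∑' l : ℤ, gz r l ≠ ∞ := by
  have hs : Summable fun l : ℤ => r ^ l.natAbs := by
    refine Summable.of_nat_of_neg ?_ ?_
    · simpa using summable_geometric_of_lt_one h0 h1
    · simpa using summable_geometric_of_lt_one h0 h1
  unfold gz
  rw [← ENNReal.ofReal_tsum_of_nonneg (fun l => by positivity) hs]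
  exact ENNReal.ofReal_ne_top

lemma gz_sum_shift (r : ℝ) (k : ℤ) : ∑' l : ℤ, gz r (l - k) = ∑' l : ℤ, gz r l :=
  (Equiv.subRight k).tsum_eq (gz r)

lemma gz_sum_fin (r : ℝ) (k : ℤ) (J : Finset ℤ) : ∑ l ∈ J, gz r (l - k) ≤ ∑' l : ℤ, gz r l := by
  rw [← gz_sum_shift r k]; exact ENNReal.sum_le_tsum _

lemma k4_le_kw (j : ℤ) (x y' t θ : ℝ) (hθ : 1 / (1 + 2 ^ j * |x - t|) ^ 2 ≤ θ)
    (h : |y' - t| ≤ 3 * |x - t|) : k4 j (x - t) ≤ ENNReal.ofReal (9 * θ) * kw j (y' - t) := by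
  have hθ0 : 0 ≤ θ := le_trans (by positivity) hθ
  unfold k4 kw
  rw [← ENNReal.ofReal_mul (by positivity)]
  refine ENNReal.ofReal_le_ofReal ?_
  have hδ : (0:ℝ) < 2 ^ j := by positivity
  set δ : ℝ := 2 ^ j
  have h1 : 1 + δ * |y' - t| ≤ 3 * (1 + δ * |x - t|) := by nlinarith
  have h2 : 1 / (1 + δ * |x - t|) ^ 2 ≤ 9 / (1 + δ * |y' - t|) ^ 2 := by
    rw [div_le_div_iff₀ (by positivity) (by positivity), one_mul]
    calc (1 + δ * |y' - t|) ^ 2 ≤ (3 * (1 + δ * |x - t|)) ^ 2 := by gcongr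
      _ = _ := by ring
  calc δ / (1 + δ * |x - t|) ^ 4
      = δ * (1 / (1 + δ * |x - t|) ^ 2) * (1 / (1 + δ * |x - t|) ^ 2) := by
        field_simp
    _ ≤ δ * θ * (9 / (1 + δ * |y' - t|) ^ 2) := by gcongr
    _ = _ := by ring

lemma tail_int (j k : ℤ) (c x y' θ : ℝ) (f : SchwartzMap ℝ ℂ)
    (hz : ∀ t, |t - c| ≤ 2 * 2 ^ (-k) → f t = 0) (hx : |x - c| ≤ 2 ^ (-k))
    (hy : |y' - c| ≤ 2 ^ (-k)) (hθ : 1 / (1 + 2 ^ j * 2 ^ (-k)) ^ 2 ≤ θ) :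
    ∫⁻ t, k4 j (x - t) * ‖f t‖ₑ ^ 2 ≤ ENNReal.ofReal (9 * θ) * kav j (fun t => ‖f t‖ₑ ^ 2) y' := by
  unfold kav
  rw [← lintegral_const_mul' _ _ ENNReal.ofReal_ne_top]
  refine lintegral_mono fun t => ?_
  by_cases ht : |t - c| ≤ 2 * 2 ^ (-k)
  · simp [hz t ht]
  · push Not at ht
    have h1 : (2:ℝ) ^ (-k) ≤ |x - t| := by
      have := abs_sub_le t x c
      rw [abs_sub_comm t x] at this; linarith
    have h2 : |y' - t| ≤ 3 * |x - t| := by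
      have e1 := abs_sub_le y' c t
      have e2 := abs_sub_le c x t
      rw [abs_sub_comm c x] at e2; linarith
    simp only
    rw [← mul_assoc]
    refine mul_le_mul_left (k4_le_kw j x y' t θ (le_trans ?_ hθ) h2) _
    gcongr

lemma osc {ι : Type*} [Fintype ι] (a : ι → ℝ) (h : ι → SchwartzMap ℝ ℂ) (K : ι → Set ℝ)
    (hK : ∀ i, IsClosed (K i)) (hd : ∀ i i', i ≠ i' → Disjoint (K i) (K i'))
    (hs : ∀ i ξ, ξ ∉ K i → fh (modS (a i) (h i)) ξ = 0) (j : ℤ) (B : ℝ) (hB0 : 0 ≤ B)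
    (hB : ∀ i, KB B j (h i)) (f : SchwartzMap ℝ ℂ) (k : ℤ) (c x y' : ℝ)
    (hz : ∀ t, |t - c| ≤ 2 * 2 ^ (-k) → f t = 0) (hx : |x - c| ≤ 2 ^ (-k))
    (hy : |y' - c| ≤ 2 ^ (-k)) :
    ∑ i, ‖e2pi (-(a i * x)) * scv f (modS (a i) (h i)) x
        - e2pi (-(a i * c)) * scv f (modS (a i) (h i)) c‖ₑ ^ 2
      ≤ ENNReal.ofReal (2304 * B ^ 2) * gz (1/4) (j - k) * kav j (fun t => ‖f t‖ₑ ^ 2) y' := by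
  have hδ : (0:ℝ) < 2 ^ j := by positivity
  have hl : (0:ℝ) < 2 ^ (-k) := by positivity
  have hprod : (2:ℝ) ^ j * 2 ^ (-k) = 2 ^ (j - k) := by
    rw [← zpow_add₀ (by norm_num : (2:ℝ) ≠ 0), sub_eq_add_neg]
  rcases le_or_gt j k with hjk | hjk
  · -- large scale kernels
    obtain ⟨n, hn⟩ : ∃ n : ℕ, j - k = -(n:ℤ) := ⟨(k - j).toNat, by omega⟩
    have hgz : gz (1/4) (j - k) = ENNReal.ofReal ((2 ^ (j - k)) ^ 2) := by
      unfold gz; rw [hn]; congr 1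
      rw [Int.natAbs_neg, Int.natAbs_natCast, zpow_neg, zpow_natCast, ← inv_pow, ← pow_mul,
        mul_comm n 2, pow_mul]
      norm_num
    set d := x - c with hdd
    have hdl : 2 ^ j * |d| ≤ 2 ^ (j - k) := by rw [← hprod]; gcongr
    have hd1 : 2 ^ j * |d| ≤ 1 := by
      refine hdl.trans ?_
      rw [show (1:ℝ) = 2 ^ (0:ℤ) by simp]
      exact zpow_le_zpow_right₀ (by norm_num) (by omega)
    have hid : ∀ i, e2pi (-(a i * x)) * scv f (modS (a i) (h i)) x
        - e2pi (-(a i * c)) * scv f (modS (a i) (h i)) c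
        = e2pi (-(a i * x)) * scv f (modS (a i) (h i - trn d (h i))) x := by
      intro i
      have e1 : ∀ y, e2pi (-(a i * y)) * scv f (modS (a i) (h i)) y
          = scv (modS (-(a i)) f) (h i) y := by
        intro y
        rw [show -(a i * y) = -(a i) * y by ring, ← modS_apply, modS_scv, modS_neg]
      have e2 : e2pi (-(a i * x)) * scv f (modS (a i) (h i - trn d (h i))) x
          = scv (modS (-(a i)) f) (h i - trn d (h i)) x := by
        rw [show -(a i * x) = -(a i) * x by ring, ← modS_apply, modS_scv, modS_neg]
      rw [e1, e1, e2, scv_sub, scv_trn, SchwartzMap.sub_apply, trn_apply]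
      congr 2; rw [hdd]; ring
    have hs' : ∀ i ξ, ξ ∉ K i → fh (modS (a i) (h i - trn d (h i))) ξ = 0 := by
      intro i ξ hξ
      have := hs i ξ hξ
      rw [fh_modS] at this
      rw [fh_modS, fh_sub, fh_trn, this]; ring
    have hbl := BL (fun i => modS (a i) (h i - trn d (h i))) K hK hd hs' j (B * 2 ^ (j - k))
      (by positivity) (fun i t => by
        rw [norm_modS, SchwartzMap.sub_apply, trn_apply]
        refine ((hB i t).2 d hd1).trans ?_
        have := kr_nonneg j t
        gcongr) f x
    have ht := tail_int j k c x y' 1 f hz hx hy (by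
      rw [div_le_one (by positivity)]
      have : (0:ℝ) < 2 ^ j * 2 ^ (-k) := by positivity
      nlinarith)
    have hnorm : ∀ i, ‖e2pi (-(a i * x)) * scv f (modS (a i) (h i)) x
        - e2pi (-(a i * c)) * scv f (modS (a i) (h i)) c‖ₑ
        = ‖scv f (modS (a i) (h i - trn d (h i))) x‖ₑ := by
      intro i
      rw [hid i, ← ofReal_norm, norm_mul, norm_e2pi, one_mul, ofReal_norm]
    simp only [hnorm]
    refine hbl.trans ((mul_le_mul_right ht _).trans ?_)
    rw [← mul_assoc, hgz, ← ENNReal.ofReal_mul (by positivity), ← ENNReal.ofReal_mul (by positivity)]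
    gcongr ENNReal.ofReal ?_ * _
    have : 0 ≤ B ^ 2 * (2 ^ (j - k)) ^ 2 := by positivity
    nlinarith
  · obtain ⟨n, hn⟩ : ∃ n : ℕ, j - k = (n:ℤ) := ⟨(j - k).toNat, by omega⟩
    have hgz : gz (1/4) (j - k) = ENNReal.ofReal (1 / (2 ^ (j - k)) ^ 2) := by
      unfold gz; rw [hn]; congr 1
      rw [Int.natAbs_natCast, zpow_natCast, ← pow_mul, mul_comm n 2, pow_mul, div_pow]
      norm_num
    have hkr : ∀ i t, ‖modS (a i) (h i) t‖ ≤ B * kr j t := fun i t => by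
      rw [norm_modS]; exact (hB i t).1
    have hθ : 1 / (1 + (2:ℝ) ^ j * 2 ^ (-k)) ^ 2 ≤ 1 / (2 ^ (j - k)) ^ 2 := by
      rw [hprod]; gcongr; linarith
    have hb : ∀ z, |z - c| ≤ 2 ^ (-k) → ∑ i, ‖scv f (modS (a i) (h i)) z‖ₑ ^ 2
        ≤ ENNReal.ofReal (576 * B ^ 2) * gz (1/4) (j - k) * kav j (fun t => ‖f t‖ₑ ^ 2) y' := by
      intro z hzc
      refine (BL _ K hK hd hs j B hB0 hkr f z).trans
        ((mul_le_mul_right (tail_int j k c z y' _ f hz hzc hy hθ) _).trans (le_of_eq ?_))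
      rw [← mul_assoc, hgz, ← ENNReal.ofReal_mul (by positivity),
        ← ENNReal.ofReal_mul (by positivity)]
      congr 2; ring
    have hsplit : ∀ z w : ℂ, ‖z - w‖ₑ ^ 2 ≤ 2 * ‖z‖ₑ ^ 2 + 2 * ‖w‖ₑ ^ 2 := by
      intro z w
      have := enorm_sq_split (z - w) (-w)
      rwa [sub_neg_eq_add, sub_add_cancel, enorm_neg] at this
    calc _ ≤ ∑ i, (2 * ‖scv f (modS (a i) (h i)) x‖ₑ ^ 2
          + 2 * ‖scv f (modS (a i) (h i)) c‖ₑ ^ 2) := by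
          refine Finset.sum_le_sum fun i _ => (hsplit _ _).trans (le_of_eq ?_)
          have : ∀ s z, ‖e2pi s * z‖ₑ = ‖z‖ₑ := fun s z => by
            rw [← ofReal_norm, norm_mul, norm_e2pi, one_mul, ofReal_norm]
          rw [this, this]
      _ = 2 * ∑ i, ‖scv f (modS (a i) (h i)) x‖ₑ ^ 2
          + 2 * ∑ i, ‖scv f (modS (a i) (h i)) c‖ₑ ^ 2 := by
          rw [Finset.sum_add_distrib, Finset.mul_sum, Finset.mul_sum]
      _ ≤ _ := add_le_add (mul_le_mul_right (hb x hx) 2)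
          (mul_le_mul_right (hb c (by rw [sub_self, abs_zero]; exact hl.le)) 2)
      _ = _ := by
        rw [show (2304 : ℝ) * B ^ 2 = 4 * (576 * B ^ 2) by ring,
          ENNReal.ofReal_mul (by norm_num : (0:ℝ) ≤ 4)]
        norm_num
        ring

lemma cutoff (x0 l : ℝ) (hl : 0 < l) : ∃ T : SchwartzMap ℝ ℂ → SchwartzMap ℝ ℂ,
    ∀ f t, (‖T f t‖ ≤ ‖f t‖ ∧ ‖f t - T f t‖ ≤ ‖f t‖) ∧ (|t - x0| ≤ 2 * l → T f t = f t) ∧ (4 * l < |t - x0| → T f t = 0) := by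
  let χ : ContDiffBump x0 := ⟨2 * l, 4 * l, by linarith, by linarith⟩
  have hg : (fun t : ℝ => (χ t : ℝ)).HasTemperateGrowth := by
    exact HasCompactSupport.hasTemperateGrowth χ.hasCompactSupport χ.contDiff
  refine ⟨fun f => SchwartzMap.smulLeftCLM ℂ (fun t : ℝ => χ t) f, fun f t => ?_⟩
  simp only [SchwartzMap.smulLeftCLM_apply_apply hg]
  refine ⟨⟨?_, ?_⟩, fun h => ?_, fun h => ?_⟩
  · rw [norm_smul, Real.norm_of_nonneg χ.nonneg]
    exact mul_le_of_le_one_left (norm_nonneg _) χ.le_one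
  · have h1 : f t - χ t • f t = (1 - χ t) • f t := by rw [sub_smul, one_smul]
    rw [h1, norm_smul, Real.norm_of_nonneg (by linarith [χ.le_one (x := t)])]
    exact mul_le_of_le_one_left (norm_nonneg _) (by linarith [χ.nonneg (x := t)])
  · rw [χ.one_of_mem_closedBall (by rw [Metric.mem_closedBall, Real.dist_eq]; exact h), one_smul]
  · rw [χ.zero_of_le_dist (by rw [Real.dist_eq]; exact h.le), zero_smul]

lemma count_scale (J : Finset ℤ) (y : ℝ) :
    (J.filter fun j : ℤ => (2:ℝ) ^ (j - 3) < y ∧ y ≤ 2 ^ (j + 3)).card ≤ 7 := by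
  by_cases hy : 0 < y
  · have h1 := Int.zpow_log_le_self (b := 2) (by norm_num) hy
    have h2 := Int.lt_zpow_succ_log_self (b := 2) (by norm_num) y
    have : (J.filter fun j : ℤ => (2:ℝ) ^ (j - 3) < y ∧ y ≤ 2 ^ (j + 3))
        ⊆ Finset.Icc (Int.log 2 y - 3) (Int.log 2 y + 3) := by
      intro j hj
      rw [Finset.mem_filter] at hj
      rw [Finset.mem_Icc]
      have e1 : (2:ℝ) ^ (j - 3) < 2 ^ (Int.log 2 y + 1) := hj.2.1.trans (by exact_mod_cast h2)
      have e2 : (2:ℝ) ^ (Int.log 2 y) ≤ 2 ^ (j + 3) := le_trans (by exact_mod_cast h1) hj.2.2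
      have e3 := (zpow_lt_zpow_iff_right₀ (by norm_num : (1:ℝ) < 2)).1 e1
      have e4 := (zpow_le_zpow_iff_right₀ (by norm_num : (1:ℝ) < 2)).1 e2
      omega
    refine (Finset.card_le_card this).trans ?_
    simp; omega
  · rw [Finset.filter_false_of_mem]
    · simp
    · rintro j _ ⟨h1, _⟩
      have : (0:ℝ) < 2 ^ (j - 3) := by positivity
      linarith

lemma sum_scale (J : Finset ℤ) (y M : ℝ) (z : ℤ → ℂ) (hM : ∀ j, ‖z j‖ ≤ M)
    (hz : ∀ j : ℤ, ¬ ((2:ℝ) ^ (j - 3) < y ∧ y ≤ 2 ^ (j + 3)) → z j = 0) :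
    ∑ j ∈ J, ‖z j‖ ^ 2 ≤ 7 * M ^ 2 := by
  have hM0 : 0 ≤ M := (norm_nonneg _).trans (hM 0)
  calc ∑ j ∈ J, ‖z j‖ ^ 2
      = ∑ j ∈ J.filter (fun j : ℤ => (2:ℝ) ^ (j - 3) < y ∧ y ≤ 2 ^ (j + 3)), ‖z j‖ ^ 2 := by
        rw [Finset.sum_filter]
        refine Finset.sum_congr rfl fun j _ => ?_
        split_ifs with h
        · rfl
        · rw [hz j h]; simp
    _ ≤ ∑ j ∈ J.filter (fun j : ℤ => (2:ℝ) ^ (j - 3) < y ∧ y ≤ 2 ^ (j + 3)), M ^ 2 := by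
        refine Finset.sum_le_sum fun j _ => ?_
        gcongr; exact hM j
    _ ≤ _ := by
        rw [Finset.sum_const, nsmul_eq_mul]
        gcongr
        exact_mod_cast count_scale J y

lemma near_HL (k : ℤ) (x y' : ℝ) (hy : y' ∈ cell k x) (W : ℝ → ℝ≥0∞) :
    p2 k * ∫⁻ y in {y | |y - x| ≤ 4 * 2 ^ (-k)}, W y ≤ 8 * HL W y' := by
  have h1 : {y | |y - x| ≤ 4 * (2:ℝ) ^ (-k)} ⊆ {y | |y - y'| ≤ (2:ℝ) ^ (-(k - 3))} := by
    intro y hy2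
    simp only [Set.mem_ofPred_eq] at *
    have e := cell_dist hy
    have e2 := abs_sub_le y x y'
    rw [abs_sub_comm x y'] at e2
    rw [show -(k - 3) = -k + 3 by ring, zpow_add₀ (by norm_num),
      show (2:ℝ) ^ (3:ℤ) = 8 by norm_num]
    linarith [(by positivity : (0:ℝ) < 2 ^ (-k))]
  calc _ ≤ p2 k * ∫⁻ y in {y | |y - y'| ≤ (2:ℝ) ^ (-(k - 3))}, W y :=
        mul_le_mul_right (lintegral_mono_set h1) _
    _ = 8 * (p2 (k - 3) * ∫⁻ y in {y | |y - y'| ≤ (2:ℝ) ^ (-(k - 3))}, W y) := by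
        rw [← mul_assoc]; congr 1
        rw [show k = 3 + (k - 3) by ring, p2_add]
        congr 1
        · unfold p2; norm_num
        · congr 1; ring
    _ ≤ _ := mul_le_mul_right (le_iSup (fun k => p2 k * ∫⁻ y in {y | |y - y'| ≤ (2:ℝ)^(-k)}, W y) _) _

lemma dA_split (k : ℤ) (x : ℝ) (w w1 : ℝ → ℝ≥0∞) (T : ℝ≥0∞)
    (h : ∀ y ∈ cell k x, w y ≤ 2 * w1 y + 2 * T) :
    dA k w x ≤ 2 * (p2 k * ∫⁻ y, w1 y) + 2 * T := by
  unfold dA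
  calc _ ≤ p2 k * ∫⁻ y in cell k x, (2 * w1 y + 2 * T) := by
        refine mul_le_mul_right (setLIntegral_mono' (measurableSet_cell k x) h) _
    _ = p2 k * (∫⁻ y in cell k x, 2 * w1 y) + p2 k * (2 * T * p2 (-k)) := by
        rw [lintegral_add_right _ measurable_const, setLIntegral_const, volume_cell, mul_add]
    _ ≤ p2 k * (2 * ∫⁻ y, w1 y) + 2 * T := by
        refine add_le_add ?_ (le_of_eq ?_)
        · refine mul_le_mul_right ?_ _
          rw [lintegral_const_mul' _ _ (by norm_num)]
          exact mul_le_mul_right (setLIntegral_le_lintegral _ _) _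
        · rw [mul_comm (2 * T), ← mul_assoc, p2_mul_neg, one_mul]
    _ = _ := by ring

lemma sum_le_of_disj {ι : Type*} [Fintype ι] (z : ι → ℝ≥0∞) (K : ι → Set ℝ) (ξ : ℝ) (C : ℝ≥0∞)
    (hd : ∀ i i', i ≠ i' → Disjoint (K i) (K i')) (hz : ∀ i, ξ ∉ K i → z i = 0)
    (hC : ∀ i, z i ≤ C) : ∑ i, z i ≤ C := by
  by_cases h : ∃ i, ξ ∈ K i
  · obtain ⟨i, hi⟩ := h
    rw [Finset.sum_eq_single i _ (by simp)]
    · exact hC i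
    · intro b _ hb
      exact hz b fun h => (Set.disjoint_left.1 (hd b i hb)) h hi
  · push Not at h
    rw [Finset.sum_eq_zero fun i _ => hz i (h i)]; exact zero_le

lemma fh_bdd (η : SchwartzMap ℝ ℂ) : ∃ M : ℝ, 0 ≤ M ∧ ∀ ξ, ‖fh η ξ‖ ≤ M := by
  obtain ⟨C, hC, h⟩ := sdecay (fh η) 0
  exact ⟨C, hC, fun ξ => by simpa using h ξ⟩

lemma psS_sum {Φ : SchwartzMap ℝ ℂ} (hΦ : LP Φ) : ∃ M : ℝ, 0 ≤ M ∧ ∀ (J : Finset ℤ) (ξ : ℝ),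
    ∑ j ∈ J, ‖fh (psS Φ j) ξ‖ ^ 2 ≤ M := by
  obtain ⟨M, hM, h⟩ := fh_bdd Φ
  refine ⟨7 * (2 * M) ^ 2, by positivity, fun J ξ => ?_⟩
  refine sum_scale J |ξ| (2 * M) (fun j => fh (psS Φ j) ξ) (fun j => ?_) fun j hj => ?_
  · rw [fh_psS]
    refine (norm_sub_le _ _).trans ?_
    linarith [h (ξ / 2 ^ j), h (ξ / 2 ^ (j - 1))]
  · rw [not_and_or] at hj
    rcases hj with hj | hj <;> push Not at hj
    · exact hΦ.psS_low (hj.trans (zpow_le_zpow_right₀ (by norm_num) (by omega)))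
    · exact hΦ.psS_high (lt_of_le_of_lt (zpow_le_zpow_right₀ (by norm_num) (by omega)) hj)

/-- the family of kernels `u_{m,j}` -/
noncomputable def uk (φ Φ : SchwartzMap ℝ ℂ) {N : ℕ} (a b : Fin N → ℝ) (m : Fin N) (j : ℤ) :
    SchwartzMap ℝ ℂ := modS (a m) (hk φ Φ (b m - a m) j)

lemma sq1_L2 {φ Φ : SchwartzMap ℝ ℂ} (hφ : PH φ) (hΦ : LP Φ) : ∃ C : ℝ≥0∞, C ≠ ∞ ∧
    ∀ (N : ℕ) (a b : Fin N → ℝ), Admissible a b → ∀ (J : Finset ℤ) (f : SchwartzMap ℝ ℂ),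
    ∫⁻ x, ∑ i : Fin N × J, ‖scv f (uk φ Φ a b i.1 i.2) x‖ₑ ^ 2 ≤ C * ∫⁻ x, ‖f x‖ₑ ^ 2 := by
  obtain ⟨M, hM, hφM⟩ := fh_bdd φ
  obtain ⟨M', hM', hΦM⟩ := psS_sum hΦ
  refine ⟨ENNReal.ofReal (M ^ 2 * M'), ENNReal.ofReal_ne_top, fun N a b hab J f => ?_⟩
  have hL : ∫⁻ x, ∑ i : Fin N × J, ‖scv f (uk φ Φ a b i.1 i.2) x‖ₑ ^ 2
      = ∫⁻ ξ, ∑ i : Fin N × J, ‖fh (scv f (uk φ Φ a b i.1 i.2)) ξ‖ₑ ^ 2 := by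
    rw [lintegral_finsetSum _ fun i _ => (sch_meas _).pow_const 2,
      lintegral_finsetSum _ fun i _ => (sch_meas _).pow_const 2]
    exact Finset.sum_congr rfl fun i _ => (plancherel _).symm
  rw [hL, ← plancherel f, ← lintegral_const_mul' _ _ ENNReal.ofReal_ne_top]
  refine lintegral_mono fun ξ => ?_
  simp only
  rw [Fintype.sum_prod_type]
  refine sum_le_of_disj _ (fun m => Set.Icc (a m) (b m)) ξ _ hab.2.2 ?_ ?_
  · intro m hm
    refine Finset.sum_eq_zero fun j _ => ?_
    rw [fh_scv]
    simp only [uk]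
    rw [hk_supp hφ (hab.1 m) _ ξ hm]; simp
  · intro m
    have h1 : ∀ j : J, ‖fh (scv f (uk φ Φ a b m j)) ξ‖ₑ ^ 2
        ≤ ENNReal.ofReal (M ^ 2 * ‖fh (psS Φ j) (ξ - a m)‖ ^ 2) * ‖fh f ξ‖ₑ ^ 2 := by
      intro j
      rw [enorm_sq_eq, enorm_sq_eq, ← ENNReal.ofReal_mul (by positivity)]
      refine ENNReal.ofReal_le_ofReal ?_
      rw [fh_scv, uk, fh_modS, hk, fh_scv, norm_mul, norm_mul, mul_pow, mul_pow, mul_comm]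
      gcongr
      rw [fh_dil (sub_pos.2 (hab.1 m))]
      exact hφM _
    calc _ ≤ ∑ j : J, ENNReal.ofReal (M ^ 2 * ‖fh (psS Φ j) (ξ - a m)‖ ^ 2) * ‖fh f ξ‖ₑ ^ 2 :=
          Finset.sum_le_sum fun j _ => h1 j
      _ = ENNReal.ofReal (M ^ 2 * ∑ j ∈ J, ‖fh (psS Φ j) (ξ - a m)‖ ^ 2) * ‖fh f ξ‖ₑ ^ 2 := by
          rw [← Finset.sum_mul, ← ENNReal.ofReal_sum_of_nonneg fun j _ => by positivity,
            ← Finset.mul_sum, Finset.sum_coe_sort J (fun j => ‖fh (psS Φ j) (ξ - a m)‖ ^ 2)]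
      _ ≤ _ := by
          gcongr; exact hΦM J _

lemma enorm_e2pi_mul (s : ℝ) (z : ℂ) : ‖e2pi s * z‖ₑ = ‖z‖ₑ := by
  rw [← ofReal_norm, norm_mul, norm_e2pi, one_mul, ofReal_norm]

lemma enorm_add_sq (z w : ℂ) : ‖z + w‖ₑ ^ 2 ≤ 2 * ‖z‖ₑ ^ 2 + 2 * ‖w‖ₑ ^ 2 := by
  have := enorm_sq_split (z + w) w
  rwa [add_sub_cancel_right] at this

lemma enorm_le_of {z w : ℂ} (h : ‖z‖ ≤ ‖w‖) : ‖z‖ₑ ≤ ‖w‖ₑ := by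
  rw [← ofReal_norm, ← ofReal_norm]; exact ENNReal.ofReal_le_ofReal h

lemma local_int (k : ℤ) (x y' : ℝ) (hy : y' ∈ cell k x) (f f1 : SchwartzMap ℝ ℂ)
    (h1 : ∀ t, ‖f1 t‖ ≤ ‖f t‖) (h2 : ∀ t, 4 * 2 ^ (-k) < |t - x| → f1 t = 0) :
    ∫⁻ t, ‖f1 t‖ₑ ^ 2 ≤ ∫⁻ t in {t | |t - x| ≤ 4 * 2 ^ (-k)}, ‖f t‖ₑ ^ 2 := by
  have hms : MeasurableSet {t : ℝ | |t - x| ≤ 4 * 2 ^ (-k)} :=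
    measurableSet_le (by fun_prop) (by fun_prop)
  rw [← lintegral_indicator hms]
  refine lintegral_mono fun t => ?_
  by_cases ht : |t - x| ≤ 4 * 2 ^ (-k)
  · rw [Set.indicator_of_mem (by exact ht)]
    simp only
    gcongr
    exact enorm_le_of (h1 t)
  · rw [h2 t (by push Not at ht; exact ht)]; simp

theorem sq1 {φ Φ : SchwartzMap ℝ ℂ} (hφ : PH φ) (hΦ : LP Φ) {p : ℝ} (hp : 2 ≤ p) :
    ∃ C : ℝ≥0∞, C ≠ ∞ ∧
    ∀ (N : ℕ) (a b : Fin N → ℝ), Admissible a b → ∀ (J : Finset ℤ) (f : SchwartzMap ℝ ℂ),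
    ∫⁻ x, (∑ i : Fin N × J, ‖scv f (uk φ Φ a b i.1 i.2) x‖ₑ ^ 2) ^ (p / 2)
      ≤ C * ∫⁻ x, ‖f x‖ₑ ^ p := by
  obtain ⟨C2, hC2, hL2⟩ := sq1_L2 hφ hΦ
  rcases hp.eq_or_lt with rfl | hp2
  · refine ⟨C2, hC2, fun N a b hab J f => ?_⟩
    have := hL2 N a b hab J f
    simpa using this
  have hα : 1 < p / 2 := by linarith
  obtain ⟨C1, hC1, hSH⟩ := SH hα
  obtain ⟨CM, hCM, hmax⟩ := maximal_Lp hα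
  obtain ⟨B, hB, hBk⟩ := hk_bound hφ hΦ
  set S : ℝ≥0∞ := ∑' l : ℤ, gz (1/4) l
  have hS : S ≠ ∞ := gz_sum (by norm_num) (by norm_num)
  set D : ℝ≥0∞ := 2 * (C2 * 8) + 2 * (ENNReal.ofReal (2304 * B ^ 2) * S * 8) with hD
  have hDt : D ≠ ∞ := by
    rw [hD]
    refine ENNReal.add_ne_top.2 ⟨?_, ?_⟩
    · exact ENNReal.mul_ne_top (by norm_num) (ENNReal.mul_ne_top hC2 (by norm_num))
    · exact ENNReal.mul_ne_top (by norm_num) (ENNReal.mul_ne_top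
        (ENNReal.mul_ne_top ENNReal.ofReal_ne_top hS) (by norm_num))
  refine ⟨C1 * (D ^ (p / 2) * CM), ENNReal.mul_ne_top hC1 (ENNReal.mul_ne_top
    (ENNReal.rpow_ne_top_of_nonneg (by linarith) hDt) hCM), fun N a b hab J f => ?_⟩
  set W : ℝ → ℝ≥0∞ := fun t => ‖f t‖ₑ ^ 2 with hW
  have hWm : Measurable W := (sch_meas f).pow_const 2
  let Gf : SchwartzMap ℝ ℂ → Fin N × J → ℝ → ℂ := fun f i x =>
    e2pi (-(a i.1 * x)) * scv f (uk φ Φ a b i.1 i.2) x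
  have hGn : ∀ f i x, ‖Gf f i x‖ₑ = ‖scv f (uk φ Φ a b i.1 i.2) x‖ₑ := fun f i x =>
    enorm_e2pi_mul _ _
  have hfin : ∫⁻ x, ∑ i, ‖Gf f i x‖ₑ ^ 2 ≠ ∞ := by
    simp only [hGn]
    exact ne_top_of_le_ne_top (ENNReal.mul_ne_top hC2 (l2_fin f)) (hL2 N a b hab J f)
  have key := hSH (Fin N × J) (Gf f) (fun i => by
      have := (scv f (uk φ Φ a b i.1 i.2)).continuous
      have := e2pi_cont
      fun_prop) (fun x => D * HL W x) ((HL_meas hWm).const_mul _) hfin ?_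
  · simp only [hGn] at key
    refine key.trans ?_
    rw [mul_assoc]
    refine mul_le_mul_right ?_ _
    simp only [ENNReal.mul_rpow_of_nonneg _ _ (by linarith : 0 ≤ p / 2)]
    rw [lintegral_const_mul _ ((HL_meas hWm).pow_const _), mul_assoc]
    refine mul_le_mul_right ((hmax W hWm).trans (le_of_eq ?_)) _
    congr 1
    refine lintegral_congr fun x => ?_
    rw [hW]; simp only
    rw [← ENNReal.rpow_natCast, ← ENNReal.rpow_mul]
    congr 1; push_cast; ring
  · intro k x
    obtain ⟨T, hT⟩ := cutoff x (2 ^ (-k)) (by positivity)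
    set f1 := T f
    set f2 := f - T f with hf2
    have hf : f = f1 + f2 := by simp [f1, f2]
    refine ⟨fun i => Gf f2 i x, fun y' hy' => ?_⟩
    have htail : ∀ y ∈ cell k x, ∑ i, ‖Gf f2 i y - Gf f2 i x‖ₑ ^ 2
        ≤ ENNReal.ofReal (2304 * B ^ 2) * S * (8 * HL W y') := by
      intro y hy
      rw [Fintype.sum_prod_type_right]
      have h1 : ∀ j : J, ∑ m : Fin N, ‖Gf f2 (m, j) y - Gf f2 (m, j) x‖ₑ ^ 2
          ≤ ENNReal.ofReal (2304 * B ^ 2) * gz (1/4) (j - k) * (8 * HL W y') := by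
        intro j
        have := osc (fun m => a m) (fun m => hk φ Φ (b m - a m) j)
          (fun m => Set.Icc (a m) (b m)) (fun m => isClosed_Icc) hab.2.2
          (fun m ξ hξ => hk_supp hφ (hab.1 m) _ ξ hξ) j B hB
          (fun m => hBk _ _ (sub_pos.2 (hab.1 m))) f2 k x y y'
          (fun t ht => by
            rw [hf2, SchwartzMap.sub_apply, (hT f t).2.1 ht, sub_self])
          (cell_dist hy) (cell_dist hy')
        refine this.trans (mul_le_mul_right ?_ _)
        refine (kav_mono j (fun t => ?_) y').trans (kav_le_HL j hWm y')
        simp only [hW]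
        gcongr
        exact enorm_le_of (hT f t).1.2
      calc _ ≤ ∑ j : J, ENNReal.ofReal (2304 * B ^ 2) * gz (1/4) (j - k) * (8 * HL W y') :=
            Finset.sum_le_sum fun j _ => h1 j
        _ = ENNReal.ofReal (2304 * B ^ 2) * (∑ j ∈ J, gz (1/4) (j - k)) * (8 * HL W y') := by
            rw [← Finset.sum_mul, ← Finset.mul_sum, Finset.sum_coe_sort J (fun j => gz (1/4) (j - k))]
        _ ≤ _ := by
            refine mul_le_mul_left (mul_le_mul_right (gz_sum_fin _ _ _) _) _
    have hsp : ∀ y ∈ cell k x, ∑ i, ‖Gf f i y - Gf f2 i x‖ₑ ^ 2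
        ≤ 2 * ∑ i : Fin N × J, ‖scv f1 (uk φ Φ a b i.1 i.2) y‖ₑ ^ 2
          + 2 * (ENNReal.ofReal (2304 * B ^ 2) * S * (8 * HL W y')) := by
      intro y hy
      calc _ ≤ ∑ i, (2 * ‖Gf f1 i y‖ₑ ^ 2 + 2 * ‖Gf f2 i y - Gf f2 i x‖ₑ ^ 2) := by
            refine Finset.sum_le_sum fun i _ => ?_
            have : Gf f i y - Gf f2 i x = Gf f1 i y + (Gf f2 i y - Gf f2 i x) := by
              simp only [Gf]
              rw [hf, add_scv, SchwartzMap.add_apply]; ring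
            rw [this]; exact enorm_add_sq _ _
        _ = 2 * ∑ i, ‖Gf f1 i y‖ₑ ^ 2 + 2 * ∑ i, ‖Gf f2 i y - Gf f2 i x‖ₑ ^ 2 := by
            rw [Finset.sum_add_distrib, Finset.mul_sum, Finset.mul_sum]
        _ ≤ _ := by
            simp only [hGn]
            exact add_le_add_right (mul_le_mul_right (htail y hy) 2) _
    refine (dA_split k x _ _ _ hsp).trans ?_
    have hloc : p2 k * ∫⁻ y, ∑ i : Fin N × J, ‖scv f1 (uk φ Φ a b i.1 i.2) y‖ₑ ^ 2
        ≤ C2 * (8 * HL W y') := by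
      calc _ ≤ p2 k * (C2 * ∫⁻ t in {t | |t - x| ≤ 4 * 2 ^ (-k)}, W t) := by
            refine mul_le_mul_right ((hL2 N a b hab J f1).trans (mul_le_mul_right ?_ _)) _
            exact local_int k x y' hy' f f1 (fun t => (hT f t).1.1) fun t => (hT f t).2.2
        _ = C2 * (p2 k * ∫⁻ t in {t | |t - x| ≤ 4 * 2 ^ (-k)}, W t) := by ring
        _ ≤ _ := mul_le_mul_right (near_HL k x y' hy' W) _
    refine (add_le_add_left (mul_le_mul_right hloc 2) _).trans (le_of_eq ?_)
    rw [hD]; ring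

lemma gz_sq (l : ℤ) : gz (1/4) l = gz (1/2) l ^ 2 := by
  unfold gz
  rw [← ENNReal.ofReal_pow (by positivity), ← pow_mul, mul_comm, pow_mul]
  norm_num

lemma sum_gz (J : Finset ℤ) (k : ℤ) (o : ℤ → ℂ) (Y : ℝ≥0∞)
    (h : ∀ l, ‖o l‖ₑ ^ 2 ≤ gz (1/4) (l - k) * Y) :
    ‖∑ l ∈ J, o l‖ₑ ^ 2 ≤ (∑' l, gz (1/2) l) ^ 2 * Y := by
  have h1 : ∀ l, ‖o l‖ₑ ≤ gz (1/2) (l - k) * Y ^ (1/2 : ℝ) := by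
    intro l
    have := ENNReal.rpow_le_rpow (h l) (by norm_num : (0:ℝ) ≤ 1/2)
    rw [gz_sq, ENNReal.mul_rpow_of_nonneg _ _ (by norm_num), ← ENNReal.rpow_natCast,
      ← ENNReal.rpow_natCast, ← ENNReal.rpow_mul, ← ENNReal.rpow_mul] at this
    norm_num at this
    simpa using this
  have h2 : ‖∑ l ∈ J, o l‖ₑ ≤ (∑' l, gz (1/2) l) * Y ^ (1/2 : ℝ) := by
    calc _ ≤ ∑ l ∈ J, ‖o l‖ₑ := enorm_sum_le _ _
      _ ≤ ∑ l ∈ J, gz (1/2) (l - k) * Y ^ (1/2 : ℝ) := Finset.sum_le_sum fun l _ => h1 l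
      _ = (∑ l ∈ J, gz (1/2) (l - k)) * Y ^ (1/2 : ℝ) := by rw [Finset.sum_mul]
      _ ≤ _ := mul_le_mul_left (gz_sum_fin _ _ _) _
  calc _ ≤ ((∑' l, gz (1/2) l) * Y ^ (1/2 : ℝ)) ^ 2 := by gcongr
    _ = _ := by
      rw [mul_pow, ← ENNReal.rpow_natCast (Y ^ (1/2:ℝ)), ← ENNReal.rpow_mul]; norm_num

noncomputable def wS (Φ : SchwartzMap ℝ ℂ) (k : ℤ) : SchwartzMap ℝ ℂ :=
  dil (2 ^ k) (dil 2 Φ - dil (1/4) Φ)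

lemma fh_wS (Φ : SchwartzMap ℝ ℂ) (k : ℤ) (ξ : ℝ) :
    fh (wS Φ k) ξ = fh Φ (ξ / 2 ^ (k+1)) - fh Φ (ξ / 2 ^ (k-2)) := by
  rw [wS, fh_dil (by positivity), fh_sub, fh_dil (by norm_num), fh_dil (by norm_num)]
  rw [zpow_add₀ (by norm_num), zpow_sub₀ (by norm_num)]
  congr 2 <;> field_simp
  norm_num

lemma wS_low {Φ : SchwartzMap ℝ ℂ} (h : LP Φ) {ξ : ℝ} {k : ℤ} (hξ : |ξ| ≤ 2 ^ (k-2)) :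
    fh (wS Φ k) ξ = 0 := by
  rw [fh_wS, h.one, h.one, sub_self]
  · rw [abs_div, abs_of_pos (by positivity : (0:ℝ) < 2 ^ (k-2)), div_le_one (by positivity)]
    exact hξ
  · rw [abs_div, abs_of_pos (by positivity : (0:ℝ) < 2 ^ (k+1)), div_le_one (by positivity)]
    exact hξ.trans (zpow_le_zpow_right₀ (by norm_num) (by omega))

lemma LP.zero' {Φ : SchwartzMap ℝ ℂ} (h : LP Φ) {ξ : ℝ} {k : ℤ} (hξ : 2 ^ (k+1) < |ξ|) :
    fh Φ (ξ / 2 ^ k) = 0 := by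
  apply h.zero
  rw [abs_div, abs_of_pos (by positivity : (0:ℝ) < 2 ^ k), lt_div_iff₀ (by positivity)]
  rw [zpow_add_one₀ (by norm_num)] at hξ; linarith

lemma wS_high {Φ : SchwartzMap ℝ ℂ} (h : LP Φ) {ξ : ℝ} {k : ℤ} (hξ : 2 ^ (k+2) < |ξ|) :
    fh (wS Φ k) ξ = 0 := by
  rw [fh_wS, h.zero', h.zero', sub_self]
  · exact lt_of_le_of_lt (zpow_le_zpow_right₀ (by norm_num) (by omega)) hξ
  · exact lt_of_le_of_lt (zpow_le_zpow_right₀ (by norm_num) (by omega)) hξ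

lemma wS_one {Φ : SchwartzMap ℝ ℂ} (h : LP Φ) {ξ : ℝ} {k : ℤ} (h1 : 2 ^ (k-1) < |ξ|)
    (h2 : |ξ| ≤ 2 ^ (k+1)) : fh (wS Φ k) ξ = 1 := by
  rw [fh_wS, h.one, h.zero', sub_zero]
  · exact lt_of_le_of_lt (zpow_le_zpow_right₀ (by norm_num) (by omega)) h1
  · rw [abs_div, abs_of_pos (by positivity : (0:ℝ) < 2 ^ (k+1)), div_le_one (by positivity)]
    exact h2

/-- reproducing formula -/
lemma wS_repr {Φ : SchwartzMap ℝ ℂ} (h : LP Φ) (f : SchwartzMap ℝ ℂ) (k : ℤ) :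
    scv (scv f (psS Φ k)) (wS Φ k) = scv f (psS Φ k) := by
  apply fh_inj
  intro ξ
  rw [fh_scv, fh_scv]
  by_cases h1 : |ξ| ≤ 2 ^ (k-1)
  · rw [h.psS_low h1]; simp
  by_cases h2 : 2 ^ (k+1) < |ξ|
  · rw [h.psS_high h2]; simp
  push Not at h1 h2
  rw [wS_one h h1 h2, mul_one]

lemma wS_KB (Φ : SchwartzMap ℝ ℂ) : ∃ B : ℝ, 0 ≤ B ∧ ∀ k, KB B k (wS Φ k) := by
  obtain ⟨C, hC, h⟩ := dil_bound (dil 2 Φ - dil (1/4) Φ)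
  exact ⟨C, hC, fun k t => h k t⟩

lemma wS_sum {Φ : SchwartzMap ℝ ℂ} (hΦ : LP Φ) : ∃ M : ℝ, 0 ≤ M ∧ ∀ (J : Finset ℤ) (ξ : ℝ),
    ∑ j ∈ J, ‖fh (wS Φ j) ξ‖ ^ 2 ≤ M := by
  obtain ⟨M, hM, h⟩ := fh_bdd Φ
  refine ⟨7 * (2 * M) ^ 2, by positivity, fun J ξ => ?_⟩
  refine sum_scale J |ξ| (2 * M) (fun j => fh (wS Φ j) ξ) (fun j => ?_) fun j hj => ?_
  · rw [fh_wS]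
    refine (norm_sub_le _ _).trans ?_
    linarith [h (ξ / 2 ^ (j+1)), h (ξ / 2 ^ (j - 2))]
  · rw [not_and_or] at hj
    rcases hj with hj | hj <;> push Not at hj
    · exact wS_low hΦ (hj.trans (zpow_le_zpow_right₀ (by norm_num) (by omega)))
    · exact wS_high hΦ (lt_of_le_of_lt (zpow_le_zpow_right₀ (by norm_num) (by omega)) hj)

lemma sq2_L2 {Φ : SchwartzMap ℝ ℂ} (hΦ : LP Φ) : ∃ C : ℝ≥0∞, C ≠ ∞ ∧
    ∀ (J : Finset ℤ) (F : ℤ → SchwartzMap ℝ ℂ),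
    ∫⁻ x, ‖∑ k ∈ J, scv (F k) (wS Φ k) x‖ₑ ^ 2 ≤ C * ∫⁻ x, ∑ k ∈ J, ‖F k x‖ₑ ^ 2 := by
  obtain ⟨M, hM, hM'⟩ := wS_sum hΦ
  refine ⟨ENNReal.ofReal M, ENNReal.ofReal_ne_top, fun J F => ?_⟩
  have h1 : ∫⁻ x, ∑ k ∈ J, ‖F k x‖ₑ ^ 2 = ∫⁻ x, ∑ k ∈ J, ‖fh (F k) x‖ₑ ^ 2 := by
    rw [lintegral_finsetSum _ fun i _ => (sch_meas _).pow_const 2,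
      lintegral_finsetSum _ fun i _ => (sch_meas _).pow_const 2]
    exact Finset.sum_congr rfl fun i _ => (plancherel _).symm
  have h2 : ∫⁻ x, ‖∑ k ∈ J, scv (F k) (wS Φ k) x‖ₑ ^ 2
      = ∫⁻ ξ, ‖∑ k ∈ J, fh (F k) ξ * fh (wS Φ k) ξ‖ₑ ^ 2 := by
    have := plancherel (∑ k ∈ J, scv (F k) (wS Φ k))
    simp only [fh_sum, fh_scv, sum_apply'] at this
    exact this.symm
  rw [h1, h2, ← lintegral_const_mul' _ _ ENNReal.ofReal_ne_top]
  refine lintegral_mono fun ξ => ?_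
  simp only [enorm_sq_eq]
  rw [← ENNReal.ofReal_sum_of_nonneg fun _ _ => by positivity, ← ENNReal.ofReal_mul hM]
  refine ENNReal.ofReal_le_ofReal ?_
  calc _ ≤ (∑ k ∈ J, ‖fh (F k) ξ‖ * ‖fh (wS Φ k) ξ‖) ^ 2 := by
        gcongr
        refine (norm_sum_le _ _).trans (le_of_eq ?_)
        exact Finset.sum_congr rfl fun _ _ => norm_mul _ _
    _ ≤ (∑ k ∈ J, ‖fh (F k) ξ‖ ^ 2) * ∑ k ∈ J, ‖fh (wS Φ k) ξ‖ ^ 2 :=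
        Finset.sum_mul_sq_le_sq_mul_sq _ _ _
    _ ≤ (∑ k ∈ J, ‖fh (F k) ξ‖ ^ 2) * M := by gcongr; exact hM' J ξ
    _ = _ := mul_comm _ _

theorem sq2_fin {Φ : SchwartzMap ℝ ℂ} (hΦ : LP Φ) {p : ℝ} (hp : 2 ≤ p) :
    ∃ C : ℝ≥0∞, C ≠ ∞ ∧ ∀ (J : Finset ℤ) (F : ℤ → SchwartzMap ℝ ℂ),
    ∫⁻ x, ‖∑ k ∈ J, scv (F k) (wS Φ k) x‖ₑ ^ p ≤ C * ∫⁻ x, (∑ k ∈ J, ‖F k x‖ₑ ^ 2) ^ (p/2) := by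
  obtain ⟨C2, hC2, hL2⟩ := sq2_L2 hΦ
  rcases hp.eq_or_lt with rfl | hp2
  · refine ⟨C2, hC2, fun J F => ?_⟩
    have := hL2 J F
    simpa using this
  have hα : 1 < p / 2 := by linarith
  obtain ⟨C1, hC1, hSH⟩ := SH hα
  obtain ⟨CM, hCM, hmax⟩ := maximal_Lp hα
  obtain ⟨B, hB, hBk⟩ := wS_KB Φ
  set S : ℝ≥0∞ := ∑' l : ℤ, gz (1/2) l
  have hS : S ≠ ∞ := gz_sum (by norm_num) (by norm_num)
  set D : ℝ≥0∞ := 2 * (C2 * 8) + 2 * (S ^ 2 * (ENNReal.ofReal (2304 * B ^ 2) * 8)) with hD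
  have hDt : D ≠ ∞ := by
    rw [hD]
    refine ENNReal.add_ne_top.2 ⟨?_, ?_⟩
    · exact ENNReal.mul_ne_top (by norm_num) (ENNReal.mul_ne_top hC2 (by norm_num))
    · exact ENNReal.mul_ne_top (by norm_num) (ENNReal.mul_ne_top
        (ENNReal.pow_ne_top hS) (ENNReal.mul_ne_top ENNReal.ofReal_ne_top (by norm_num)))
  refine ⟨C1 * (D ^ (p / 2) * CM), ENNReal.mul_ne_top hC1 (ENNReal.mul_ne_top
    (ENNReal.rpow_ne_top_of_nonneg (by linarith) hDt) hCM), fun J F => ?_⟩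
  set W : ℝ → ℝ≥0∞ := fun t => ∑ k ∈ J, ‖F k t‖ₑ ^ 2 with hW
  have hWm : Measurable W := Finset.measurable_fun_sum _ fun k _ => (sch_meas (F k)).pow_const 2
  have hWle : ∀ k ∈ J, ∀ t, ‖F k t‖ₑ ^ 2 ≤ W t := fun k hk t =>
    Finset.single_le_sum (f := fun k => ‖F k t‖ₑ ^ 2) (fun _ _ => zero_le) hk
  let Gf : (ℤ → SchwartzMap ℝ ℂ) → ℝ → ℂ := fun F x => ∑ k ∈ J, scv (F k) (wS Φ k) x
  have hWfin : ∫⁻ x, W x ≠ ∞ := by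
    rw [hW, lintegral_finsetSum _ fun i _ => (sch_meas _).pow_const 2]
    exact ENNReal.sum_ne_top.2 fun k _ => l2_fin _
  have hfin : ∫⁻ x, ∑ _i : Unit, ‖Gf F x‖ₑ ^ 2 ≠ ∞ := by
    simp only [Finset.univ_unique, Finset.sum_singleton]
    exact ne_top_of_le_ne_top (ENNReal.mul_ne_top hC2 hWfin) (hL2 J F)
  have key := hSH Unit (fun _ => Gf F) (fun i => by
      refine continuous_finsetSum _ fun k _ => (scv (F k) (wS Φ k)).continuous)
      (fun x => D * HL W x) ((HL_meas hWm).const_mul _) hfin ?_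
  · have e1 : ∀ x, (∑ _i : Unit, ‖Gf F x‖ₑ ^ 2) ^ (p/2) = ‖Gf F x‖ₑ ^ p := by
      intro x
      simp only [Finset.univ_unique, Finset.sum_singleton]
      rw [← ENNReal.rpow_natCast, ← ENNReal.rpow_mul]
      congr 1; push_cast; ring
    simp only [e1] at key
    refine key.trans ?_
    rw [mul_assoc]
    refine mul_le_mul_right ?_ _
    simp only [ENNReal.mul_rpow_of_nonneg _ _ (by linarith : 0 ≤ p / 2)]
    rw [lintegral_const_mul _ ((HL_meas hWm).pow_const _), mul_assoc]
    exact mul_le_mul_right (hmax W hWm) _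
  · intro k x
    obtain ⟨T, hT⟩ := cutoff x (2 ^ (-k)) (by positivity)
    set F1 : ℤ → SchwartzMap ℝ ℂ := fun l => T (F l)
    set F2 : ℤ → SchwartzMap ℝ ℂ := fun l => if l ∈ J then F l - T (F l) else 0 with hF2
    refine ⟨fun _ => Gf F2 x, fun y' hy' => ?_⟩
    have htail : ∀ y ∈ cell k x, ‖Gf F2 y - Gf F2 x‖ₑ ^ 2
        ≤ S ^ 2 * (ENNReal.ofReal (2304 * B ^ 2) * (8 * HL W y')) := by
      intro y hy
      simp only [Gf]
      rw [← Finset.sum_sub_distrib]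
      refine sum_gz J k (fun l => scv (F2 l) (wS Φ l) y - scv (F2 l) (wS Φ l) x) _ fun l => ?_
      have := osc (ι := Unit) (fun _ => 0) (fun _ => wS Φ l) (fun _ => Set.univ)
        (fun _ => isClosed_univ) (fun i j h => (h rfl).elim) (fun i ξ h => (h (Set.mem_univ _)).elim)
        l B hB (fun _ => hBk l) (F2 l) k x y y' (fun t ht => by
          simp only [hF2]
          split_ifs
          · rw [SchwartzMap.sub_apply, (hT (F l) t).2.1 ht, sub_self]
          · rfl) (cell_dist hy) (cell_dist hy')
      simp only [Finset.univ_unique, Finset.sum_singleton, modS_zero, zero_mul, neg_zero, e2pi_zero,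
        one_mul] at this
      refine this.trans ?_
      rw [mul_comm (ENNReal.ofReal _) (gz _ _), mul_assoc]
      refine mul_le_mul_right (mul_le_mul_right ?_ _) _
      refine (kav_mono l (fun t => ?_) y').trans (kav_le_HL l hWm y')
      simp only [hF2]
      split_ifs with hl
      · refine le_trans ?_ (hWle l hl t)
        gcongr
        exact enorm_le_of (hT (F l) t).1.2
      · simp
    have hsp : ∀ y ∈ cell k x, ∑ _i : Unit, ‖Gf F y - Gf F2 x‖ₑ ^ 2
        ≤ 2 * ‖Gf F1 y‖ₑ ^ 2
          + 2 * (S ^ 2 * (ENNReal.ofReal (2304 * B ^ 2) * (8 * HL W y'))) := by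
      intro y hy
      simp only [Finset.univ_unique, Finset.sum_singleton]
      have : Gf F y - Gf F2 x = Gf F1 y + (Gf F2 y - Gf F2 x) := by
        have : Gf F y = Gf F1 y + Gf F2 y := by
          simp only [Gf]
          rw [← Finset.sum_add_distrib]
          refine Finset.sum_congr rfl fun l hl => ?_
          rw [← SchwartzMap.add_apply, ← add_scv]
          simp only [F1, F2, if_pos hl]
          rw [add_sub_cancel]
        rw [this]; ring
      rw [this]
      exact (enorm_add_sq _ _).trans (add_le_add_right (mul_le_mul_right (htail y hy) 2) _)
    refine (dA_split k x _ _ _ hsp).trans ?_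
    have hloc : p2 k * ∫⁻ y, ‖Gf F1 y‖ₑ ^ 2 ≤ C2 * (8 * HL W y') := by
      calc _ ≤ p2 k * (C2 * ∫⁻ t in {t | |t - x| ≤ 4 * 2 ^ (-k)}, W t) := by
            refine mul_le_mul_right ((hL2 J F1).trans (mul_le_mul_right ?_ _)) _
            rw [lintegral_finsetSum _ fun i _ => (sch_meas _).pow_const 2,
              hW, lintegral_finsetSum _ fun i _ => (sch_meas _).pow_const 2]
            refine Finset.sum_le_sum fun l _ => ?_
            exact local_int k x y' hy' (F l) (F1 l) (fun t => (hT (F l) t).1.1)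
              fun t => (hT (F l) t).2.2
        _ = C2 * (p2 k * ∫⁻ t in {t | |t - x| ≤ 4 * 2 ^ (-k)}, W t) := by ring
        _ ≤ _ := mul_le_mul_right (near_HL k x y' hy' W) _
    refine (add_le_add_left (mul_le_mul_right hloc 2) _).trans (le_of_eq ?_)
    rw [hD]; ring

lemma scv_dil (f η : SchwartzMap ℝ ℂ) {L : ℝ} (hL : 0 < L) (x : ℝ) :
    scv f (dil L η) x = ∫ u, η u * f (x - u / L) := by
  rw [scv_comm, scv_apply]
  have := Measure.integral_comp_mul_left (fun u => η u * f (x - u / L)) L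
  rw [abs_of_pos (inv_pos.2 hL)] at this
  have h2 : ∀ t, dil L η t * f (x - t) = (L : ℂ) * (η (L * t) * f (x - L * t / L)) := by
    intro t
    rw [dil_apply, mul_div_cancel_left₀ _ hL.ne', mul_assoc]
  simp only [h2]
  rw [integral_const_mul, this, Complex.real_smul, ← mul_assoc]
  push_cast
  rw [mul_inv_cancel₀ (by exact_mod_cast hL.ne'), one_mul]

lemma psS_telescope (Φ f : SchwartzMap ℝ ℂ) (x : ℝ) (n : ℕ) :
    ∑ k ∈ Finset.Icc (-(n:ℤ)) n, scv f (psS Φ k) x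
      = scv f (dil (2 ^ (n:ℤ)) Φ) x - scv f (dil (2 ^ (-(n:ℤ) - 1)) Φ) x := by
  have h0 : ∀ k, scv f (psS Φ k) x = scv f (dil (2 ^ k) Φ) x - scv f (dil (2 ^ (k-1)) Φ) x := by
    intro k
    rw [psS_eq, scv_sub, SchwartzMap.sub_apply]
  induction n with
  | zero => simp [h0]
  | succ n ih =>
    have : Finset.Icc (-((n+1:ℕ):ℤ)) ((n+1:ℕ):ℤ)
        = insert (-((n+1:ℕ):ℤ)) (insert ((n+1:ℕ):ℤ) (Finset.Icc (-(n:ℤ)) n)) := by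
      ext k; simp only [Finset.mem_Icc, Finset.mem_insert]; push_cast; omega
    rw [this, Finset.sum_insert, Finset.sum_insert, ih, h0, h0]
    · have e1 : ((n+1:ℕ):ℤ) - 1 = n := by push_cast; ring
      have e2 : -((n+1:ℕ):ℤ) = -(n:ℤ) - 1 := by push_cast; ring
      rw [e1, e2]; ring
    · simp
    · simp only [Finset.mem_insert, Finset.mem_Icc]; push_cast; omega

open Filter Topology in
lemma lp_conv {Φ : SchwartzMap ℝ ℂ} (hΦ : LP Φ) (f : SchwartzMap ℝ ℂ) (x : ℝ) :
    Tendsto (fun n : ℕ => ∑ k ∈ Finset.Icc (-(n:ℤ)) n, scv f (psS Φ k) x) atTop (𝓝 (f x)) := by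
  obtain ⟨M, hM, hf⟩ := sdecay f 0
  obtain ⟨M', hM', hf'⟩ := sdecay Φ 0
  simp only [pow_zero, div_one] at hf hf'
  simp only [psS_telescope]
  have h1 : Tendsto (fun n : ℕ => scv f (dil (2 ^ (n:ℤ)) Φ) x) atTop (𝓝 (f x)) := by
    have e : f x = ∫ u, Φ u * f x := by
      rw [integral_mul_const]
      have : ∫ u, Φ u = 1 := by
        have h := hΦ.one (ξ := 0) (by simp)
        rw [fh_apply] at h
        simpa [e2pi_zero] using h
      rw [this, one_mul]
    conv => arg 3; rw [e]
    simp only [scv_dil f Φ (zpow_pos (by norm_num : (0:ℝ) < 2) _)]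
    refine tendsto_integral_of_dominated_convergence (fun u => ‖Φ u‖ * M) ?_ ?_ ?_ ?_
    · intro n
      have := f.continuous
      have := Φ.continuous
      exact (by fun_prop : Continuous fun u => Φ u * f (x - u / 2 ^ (n:ℤ))).aestronglyMeasurable
    · exact Φ.integrable.norm.mul_const _
    · intro n
      filter_upwards with u
      rw [norm_mul]; gcongr; exact hf _
    · filter_upwards with u
      refine Tendsto.const_mul _ ?_
      have h2 : Tendsto (fun n : ℕ => x - u / 2 ^ (n:ℤ)) atTop (𝓝 (x - 0)) := by
        refine Tendsto.const_sub _ ?_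
        have : Tendsto (fun n : ℕ => ((2:ℝ)⁻¹) ^ n) atTop (𝓝 0) :=
          tendsto_pow_atTop_nhds_zero_of_lt_one (by norm_num) (by norm_num)
        have := this.const_mul u
        rw [mul_zero] at this
        refine this.congr fun n => ?_
        rw [zpow_natCast, inv_pow, div_eq_mul_inv]
      rw [sub_zero] at h2
      exact (f.continuous.tendsto x).comp h2
  have h2 : Tendsto (fun n : ℕ => scv f (dil (2 ^ (-(n:ℤ) - 1)) Φ) x) atTop (𝓝 0) := by
    have hb : ∀ n : ℕ, ‖scv f (dil (2 ^ (-(n:ℤ) - 1)) Φ) x‖ ≤ (∫ t, ‖f t‖) * M' * ((2:ℝ)⁻¹) ^ n := by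
      intro n
      rw [scv_apply]
      refine (norm_integral_le_integral_norm _).trans ?_
      rw [mul_assoc, ← integral_mul_const]
      refine integral_mono_of_nonneg (by filter_upwards with t; positivity)
        (f.integrable.norm.mul_const _) ?_
      filter_upwards with t
      rw [norm_mul]
      gcongr
      rw [dil_apply, norm_mul, Complex.norm_real, Real.norm_of_nonneg (by positivity), mul_comm]
      gcongr
      · exact hf' _
      · rw [inv_pow, ← zpow_natCast, ← zpow_neg]
        exact zpow_le_zpow_right₀ (by norm_num) (by omega)
    refine squeeze_zero_norm hb ?_
    have : Tendsto (fun n : ℕ => ((2:ℝ)⁻¹) ^ n) atTop (𝓝 0) :=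
      tendsto_pow_atTop_nhds_zero_of_lt_one (by norm_num) (by norm_num)
    simpa using this.const_mul ((∫ t, ‖f t‖) * M')
  simpa using h1.sub h2

open Filter Topology in
theorem sq2 {Φ : SchwartzMap ℝ ℂ} (hΦ : LP Φ) {p : ℝ} (hp : 2 ≤ p) :
    ∃ C : ℝ≥0∞, C ≠ ∞ ∧ ∀ f : SchwartzMap ℝ ℂ,
    ∫⁻ x, ‖f x‖ₑ ^ p ≤ C * ∫⁻ x, (∑' k : ℤ, ‖scv f (psS Φ k) x‖ₑ ^ 2) ^ (p/2) := by
  obtain ⟨C, hC, h⟩ := sq2_fin hΦ hp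
  refine ⟨C, hC, fun f => ?_⟩
  have hb : ∀ n : ℕ, ∫⁻ x, ‖∑ k ∈ Finset.Icc (-(n:ℤ)) n, scv f (psS Φ k) x‖ₑ ^ p
      ≤ C * ∫⁻ x, (∑' k : ℤ, ‖scv f (psS Φ k) x‖ₑ ^ 2) ^ (p/2) := by
    intro n
    have := h (Finset.Icc (-(n:ℤ)) n) (fun k => scv f (psS Φ k))
    simp only [wS_repr hΦ] at this
    refine this.trans (mul_le_mul_right (lintegral_mono fun x => ?_) _)
    exact ENNReal.rpow_le_rpow (ENNReal.sum_le_tsum _) (by linarith)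
  have hlim : ∀ x, Tendsto (fun n : ℕ => ‖∑ k ∈ Finset.Icc (-(n:ℤ)) n, scv f (psS Φ k) x‖ₑ ^ p)
      atTop (𝓝 (‖f x‖ₑ ^ p)) := fun x =>
    ((lp_conv hΦ f x).enorm).ennrpow_const p
  calc ∫⁻ x, ‖f x‖ₑ ^ p = ∫⁻ x, liminf (fun n : ℕ =>
        ‖∑ k ∈ Finset.Icc (-(n:ℤ)) n, scv f (psS Φ k) x‖ₑ ^ p) atTop :=
        lintegral_congr fun x => (hlim x).liminf_eq.symm
    _ ≤ liminf (fun n : ℕ => ∫⁻ x, ‖∑ k ∈ Finset.Icc (-(n:ℤ)) n, scv f (psS Φ k) x‖ₑ ^ p) atTop := by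
        refine lintegral_liminf_le fun n => ?_
        refine Measurable.pow_const ?_ _
        refine (Continuous.measurable ?_)
        exact continuous_enorm.comp
          (continuous_finsetSum _ fun k _ => (scv f (psS Φ k)).continuous)
    _ ≤ _ := liminf_le_of_frequently_le' (Frequently.of_forall hb)

open Filter Topology in
/-- the case `s = 0, q = 2` -/
theorem case_zero {φ Φ : SchwartzMap ℝ ℂ} (hφ : PH φ) (hΦ : LP Φ) {p : ℝ} (hp : 2 ≤ p) :
    ∃ C : ℝ≥0∞, C ≠ ∞ ∧
    ∀ (N : ℕ) (a b : Fin N → ℝ), Admissible a b → ∀ (f : SchwartzMap ℝ ℂ),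
    ∫⁻ x, (∑' j : ℤ, ∑ m, ‖scv f (uk φ Φ a b m j) x‖ₑ ^ 2) ^ (p / 2)
      ≤ C * ∫⁻ x, (∑' k : ℤ, ‖scv f (psS Φ k) x‖ₑ ^ 2) ^ (p/2) := by
  obtain ⟨C1, hC1, h1⟩ := sq1 hφ hΦ hp
  obtain ⟨C2, hC2, h2⟩ := sq2 hΦ hp
  refine ⟨C1 * C2, ENNReal.mul_ne_top hC1 hC2, fun N a b hab f => ?_⟩
  rw [mul_assoc]
  refine le_trans ?_ (mul_le_mul_right (h2 f) _)
  have hlim : ∀ x, Tendsto (fun n : ℕ => (∑ j ∈ Finset.Icc (-(n:ℤ)) n,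
      ∑ m, ‖scv f (uk φ Φ a b m j) x‖ₑ ^ 2) ^ (p/2))
      atTop (𝓝 ((∑' j : ℤ, ∑ m, ‖scv f (uk φ Φ a b m j) x‖ₑ ^ 2) ^ (p / 2))) := by
    intro x
    refine Tendsto.ennrpow_const _ ?_
    refine (ENNReal.summable.hasSum (f := fun j : ℤ => ∑ m, ‖scv f (uk φ Φ a b m j) x‖ₑ ^ 2)).comp ?_
    refine Filter.tendsto_atTop_finset_of_monotone ?_ ?_
    · intro n n' h
      exact Finset.Icc_subset_Icc (by simpa using h) (by simpa using h)
    · intro k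
      exact ⟨k.natAbs, by simp only [Finset.mem_Icc]; omega⟩
  calc _ = ∫⁻ x, liminf (fun n : ℕ => (∑ j ∈ Finset.Icc (-(n:ℤ)) n,
      ∑ m, ‖scv f (uk φ Φ a b m j) x‖ₑ ^ 2) ^ (p/2)) atTop :=
        lintegral_congr fun x => (hlim x).liminf_eq.symm
    _ ≤ liminf (fun n : ℕ => ∫⁻ x, (∑ j ∈ Finset.Icc (-(n:ℤ)) n,
      ∑ m, ‖scv f (uk φ Φ a b m j) x‖ₑ ^ 2) ^ (p/2)) atTop := by
        refine lintegral_liminf_le fun n => ?_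
        refine Measurable.pow_const ?_ _
        exact Finset.measurable_fun_sum _ fun k _ => Finset.measurable_fun_sum _ fun m _ =>
          (sch_meas _).pow_const 2
    _ ≤ _ := liminf_le_of_frequently_le' (Frequently.of_forall fun n => by
        have := h1 N a b hab (Finset.Icc (-(n:ℤ)) n) f
        refine le_trans (le_of_eq (lintegral_congr fun x => ?_)) this
        rw [Fintype.sum_prod_type_right, Finset.sum_coe_sort (Finset.Icc (-(n:ℤ)) n)
          (fun j => ∑ m, ‖scv f (uk φ Φ a b m j) x‖ₑ ^ 2)])

noncomputable def dS (η : SchwartzMap ℝ ℂ) : SchwartzMap ℝ ℂ := SchwartzMap.derivCLM ℂ ℂ η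

lemma fh_dS (η : SchwartzMap ℝ ℂ) (ξ : ℝ) : fh (dS η) ξ = 2 * π * Complex.I * ξ * fh η ξ := by
  have h : ⇑(dS η) = deriv ⇑η := by
    ext x; exact SchwartzMap.derivCLM_apply ℂ η x
  rw [fh_coe, fh_coe, h]
  have := Real.fourier_deriv (f := ⇑η) η.integrable η.differentiable (by
    rw [← h]; exact (dS η).integrable)
  rw [this]; simp

/-- Schwartz functions with mean zero have a Schwartz antiderivative. -/
lemma antideriv (χ : SchwartzMap ℝ ℂ) (h0 : fh χ 0 = 0) : ∃ η : SchwartzMap ℝ ℂ, dS η = χ := by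
  have hinteg0 : ∫ t, χ t = 0 := by
    rw [fh_apply] at h0
    simpa [e2pi_zero] using h0
  set g : ℝ → ℂ := fun x => ∫ t in Set.Iic x, χ t with hg
  have hd : ∀ x, HasDerivAt g (χ x) x := by
    intro x
    have e : g = fun x => (∫ t in Set.Iic (0:ℝ), χ t) + ∫ t in (0:ℝ)..x, χ t := by
      ext y
      have := intervalIntegral.integral_Iic_sub_Iic (μ := volume) (f := χ) (a := 0) (b := y)
        χ.integrable.integrableOn χ.integrable.integrableOn
      rw [← this]; simp [hg]
    rw [e]
    exact (intervalIntegral.integral_hasDerivAt_right (χ.integrable.intervalIntegrable)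
      χ.continuous.stronglyMeasurable.stronglyMeasurableAtFilter
      χ.continuous.continuousAt).const_add _
  have hder : deriv g = ⇑χ := by ext x; exact (hd x).deriv
  have hsm : ContDiff ℝ (⊤ : ℕ∞) g := by
    rw [contDiff_infty_iff_deriv]
    refine ⟨fun x => (hd x).differentiableAt, ?_⟩
    rw [hder]; exact χ.smooth _
  have hdec : ∀ k n : ℕ, ∃ C : ℝ, ∀ x, ‖x‖ ^ k * ‖iteratedFDeriv ℝ n g x‖ ≤ C := by
    intro k n
    cases n with
    | succ n =>
      obtain ⟨C, hC⟩ := χ.decay' k n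
      refine ⟨C, fun x => ?_⟩
      have := hC x
      rw [norm_iteratedFDeriv_eq_norm_iteratedDeriv] at this ⊢
      rw [iteratedDeriv_succ', hder]; exact this
    | zero =>
      have hI : Integrable fun t : ℝ => ‖t‖ ^ k * ‖χ t‖ := χ.integrable_pow_mul volume k
      refine ⟨∫ t, ‖t‖ ^ k * ‖χ t‖, fun x => ?_⟩
      rw [norm_iteratedFDeriv_zero]
      have aux : ∀ S : Set ℝ, MeasurableSet S → (∀ t ∈ S, |x| ≤ |t|) →
          ‖x‖ ^ k * ‖∫ t in S, χ t‖ ≤ ∫ t, ‖t‖ ^ k * ‖χ t‖ := by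
        intro S hS h
        calc _ ≤ ‖x‖ ^ k * ∫ t in S, ‖χ t‖ := by
              gcongr; exact norm_integral_le_integral_norm _
          _ = ∫ t in S, ‖x‖ ^ k * ‖χ t‖ := by rw [integral_const_mul]
          _ ≤ ∫ t in S, ‖t‖ ^ k * ‖χ t‖ := by
              refine setIntegral_mono_on (χ.integrable.norm.const_mul _).integrableOn
                hI.integrableOn hS fun t ht => ?_
              gcongr
              exact h t ht
          _ ≤ _ := setIntegral_le_integral hI (by filter_upwards with t; positivity)
      rcases le_total x 0 with hx | hx
      · refine aux _ measurableSet_Iic fun t ht => ?_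
        rw [abs_of_nonpos hx, abs_of_nonpos (le_trans ht hx)]
        linarith [Set.mem_Iic.1 ht]
      · have e : g x = -∫ t in Set.Ioi x, χ t := by
          have := intervalIntegral.integral_Iic_add_Ioi (μ := volume) (f := χ) (b := x)
            χ.integrable.integrableOn χ.integrable.integrableOn
          rw [hinteg0] at this
          exact eq_neg_of_add_eq_zero_left this
        rw [e, norm_neg]
        refine aux _ measurableSet_Ioi fun t ht => ?_
        rw [abs_of_nonneg hx, abs_of_nonneg (hx.trans (le_of_lt ht))]
        exact le_of_lt ht
  refine ⟨⟨g, hsm, hdec⟩, ?_⟩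
  ext x
  change SchwartzMap.derivCLM ℂ ℂ _ x = _
  rw [SchwartzMap.derivCLM_apply]
  exact congrFun hder x

lemma antideriv' (χ : SchwartzMap ℝ ℂ) (h0 : ∀ ξ, 0 ≤ ξ → fh χ ξ = 0) :
    ∃ η : SchwartzMap ℝ ℂ, dS η = χ ∧ ∀ ξ, 0 ≤ ξ → fh η ξ = 0 := by
  obtain ⟨η, hη⟩ := antideriv χ (h0 0 le_rfl)
  have h1 : ∀ ξ, 0 < ξ → fh η ξ = 0 := by
    intro ξ hξ
    have := h0 ξ hξ.le
    rw [← hη, fh_dS] at this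
    simpa [Real.pi_ne_zero, hξ.ne'] using this
  refine ⟨η, hη, fun ξ hξ => ?_⟩
  rcases hξ.eq_or_lt with rfl | hξ
  · have hc : IsClosed {ξ | fh η ξ = 0} := isClosed_eq (fh η).continuous continuous_const
    have : closure (Set.Ioi (0:ℝ)) ⊆ {ξ | fh η ξ = 0} :=
      closure_minimal (fun ξ hξ => h1 ξ hξ) hc
    rw [closure_Ioi] at this
    exact this Set.self_mem_Ici
  · exact h1 ξ hξ

lemma nv_ident (η Θ : SchwartzMap ℝ ℂ) {b L M : ℝ} (hL : 0 < L) (hM : 0 < M) :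
    scv (modS b (dil L (dS η))) (dil M Θ)
      = ((M / L : ℝ) : ℂ) • (scv (modS b (dil L η)) (dil M (dS Θ))
        - ((2 * π * Complex.I * (b / M : ℝ) : ℂ)) • scv (modS b (dil L η)) (dil M Θ)) := by
  apply fh_inj
  intro ξ
  simp only [fh_smul, fh_sub, fh_scv, fh_modS, fh_dil hL, fh_dil hM, fh_dS]
  have : (L : ℂ) ≠ 0 := by exact_mod_cast hL.ne'
  have : (M : ℂ) ≠ 0 := by exact_mod_cast hM.ne'
  push_cast
  field_simp

lemma NV (A : ℕ) : ∀ (χ Θ : SchwartzMap ℝ ℂ), (∀ ξ, 0 ≤ ξ → fh χ ξ = 0) → ∃ C : ℝ, 0 ≤ C ∧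
    ∀ (k : ℤ) (L b : ℝ), 2 ^ k ≤ L → |b| ≤ 4 * 2 ^ k → ∀ t,
    ‖scv (modS b (dil L χ)) (dil (2 ^ k) Θ) t‖ ≤ C * (2 ^ k / L) ^ A * kr k t := by
  induction A with
  | zero =>
    intro χ Θ _
    obtain ⟨C, hC, h⟩ := CV χ
    obtain ⟨B, hB, hd⟩ := dil_bound Θ
    refine ⟨C * B, by positivity, fun k L b hL hb t => ?_⟩
    rw [scv_comm, pow_zero, mul_one]
    have : (0:ℝ) < 2 ^ k := by positivity
    exact h k B (dil (2 ^ k) Θ) b L hB (by linarith) (fun t => (hd k t).1) t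
  | succ A ih =>
    intro χ Θ hχ
    obtain ⟨η, hη, hη0⟩ := antideriv' χ hχ
    obtain ⟨C1, hC1, h1⟩ := ih η (dS Θ) hη0
    obtain ⟨C2, hC2, h2⟩ := ih η Θ hη0
    refine ⟨C1 + 2 * π * 4 * C2, by positivity, fun k L b hL hb t => ?_⟩
    have hk : (0:ℝ) < 2 ^ k := by positivity
    have hL0 : 0 < L := hk.trans_le hL
    rw [← hη, nv_ident η Θ hL0 hk, SchwartzMap.smul_apply, SchwartzMap.sub_apply,
      SchwartzMap.smul_apply, smul_eq_mul, smul_eq_mul, norm_mul, Complex.norm_real,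
      Real.norm_of_nonneg (by positivity)]
    have hn : ‖(2 * π * Complex.I * (b / 2 ^ k : ℝ) : ℂ)‖ ≤ 2 * π * 4 := by
      simp only [norm_mul, Complex.norm_real, Complex.norm_I, mul_one, Complex.norm_ofNat]
      rw [Real.norm_of_nonneg Real.pi_pos.le, Real.norm_eq_abs, abs_div, abs_of_pos hk]
      gcongr
      rwa [div_le_iff₀ hk]
    have hkr := kr_nonneg k t
    calc _ ≤ 2 ^ k / L * (C1 * (2 ^ k / L) ^ A * kr k t
            + 2 * π * 4 * (C2 * (2 ^ k / L) ^ A * kr k t)) := by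
          gcongr
          refine (norm_sub_le _ _).trans ?_
          rw [norm_mul]
          gcongr
          · exact h1 k L b hL hb t
          · exact h2 k L b hL hb t
      _ = _ := by ring

lemma d2_one {Φ : SchwartzMap ℝ ℂ} (h : LP Φ) {ξ : ℝ} {k : ℤ} (hξ : |ξ| ≤ 2 ^ (k+1)) :
    fh (dil (2 ^ k) (dil 2 Φ)) ξ = 1 := by
  rw [fh_dil (by positivity), fh_dil (by norm_num)]
  apply h.one
  rw [div_div, ← zpow_add_one₀ (by norm_num), abs_div,
    abs_of_pos (by positivity : (0:ℝ) < 2 ^ (k+1)), div_le_one (by positivity)]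
  exact hξ

lemma d2_zero {Φ : SchwartzMap ℝ ℂ} (h : LP Φ) {ξ : ℝ} {k : ℤ} (hξ : 2 ^ (k+2) < |ξ|) :
    fh (dil (2 ^ k) (dil 2 Φ)) ξ = 0 := by
  rw [fh_dil (by positivity), fh_dil (by norm_num), div_div, ← zpow_add_one₀ (by norm_num)]
  apply h.zero'
  rwa [add_assoc]

lemma d2_repr {Φ : SchwartzMap ℝ ℂ} (h : LP Φ) (f : SchwartzMap ℝ ℂ) (k : ℤ) :
    scv (scv f (psS Φ k)) (dil (2 ^ k) (dil 2 Φ)) = scv f (psS Φ k) := by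
  apply fh_inj
  intro ξ
  rw [fh_scv, fh_scv]
  by_cases h2 : 2 ^ (k+1) < |ξ|
  · rw [h.psS_high h2]; simp
  push Not at h2
  rw [d2_one h h2, mul_one]

lemma KS {φ Φ : SchwartzMap ℝ ℂ} (hφ : PH φ) (hΦ : LP Φ) (A : ℕ) : ∃ C : ℝ, 0 ≤ C ∧
    ∀ (a b : ℝ) (j k : ℤ), a < b → (0:ℝ) ∉ Set.Ioo a b → k ≤ j - 4 → ∀ t,
    ‖scv (modS a (hk φ Φ (b - a) j)) (dil (2 ^ k) (dil 2 Φ)) t‖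
      ≤ C * ((2:ℝ) ^ (k - j)) ^ A * kr k t := by
  obtain ⟨C1, hC1, h1⟩ := NV A (modS (-1) φ) (dil 2 Φ) (fun ξ hξ => by
    rw [fh_modS]
    exact hφ.zero (fun h => by have := h.2; linarith))
  obtain ⟨C2, hC2, h2⟩ := CV Φ
  refine ⟨2 * (C2 * (C1 * 2 ^ A)), by positivity, fun a b j k hab h0 hkj => ?_⟩
  have hkr := fun t => kr_nonneg k t
  by_cases hz : scv (modS a (hk φ Φ (b - a) j)) (dil (2 ^ k) (dil 2 Φ)) = 0
  · intro t
    rw [hz, SchwartzMap.zero_apply, norm_zero]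
    have := hkr t
    positivity
  have hL : 2 ^ (j-1) < b - a := by
    by_contra hc
    push Not at hc
    apply hz
    rw [hk_zero hφ hΦ (sub_pos.2 hab) hc]
    apply fh_inj
    intro ξ
    rw [fh_scv, fh_modS, fh_zero, zero_mul, fh_zero]
  have ha : a < 0 := by
    by_contra hc
    push Not at hc
    apply hz
    apply fh_inj
    intro ξ
    rw [fh_scv, fh_modS, hk, fh_scv, fh_zero]
    by_cases hξ : 2 ^ (k+2) < |ξ|
    · rw [d2_zero hΦ hξ, mul_zero]
    push Not at hξ
    by_cases hξa : ξ - a ≤ 0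
    · rw [fh_dil (sub_pos.2 hab), hφ.zero, zero_mul, zero_mul]
      intro h
      have h3 := h.1
      have := div_nonpos_of_nonpos_of_nonneg hξa (sub_pos.2 hab).le
      linarith
    · push Not at hξa
      rw [hΦ.psS_low, mul_zero, zero_mul]
      rw [abs_of_pos hξa]
      have h3 : (2:ℝ) ^ (k+2) ≤ 2 ^ (j-1) := zpow_le_zpow_right₀ (by norm_num) (by omega)
      have := le_abs_self ξ
      linarith
  have hb0 : b ≤ 0 := by
    by_contra hc
    push Not at hc
    exact h0 ⟨ha, hc⟩
  have hb1 : -2 ^ (k+2) ≤ b := by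
    by_contra hc
    push Not at hc
    apply hz
    apply fh_inj
    intro ξ
    rw [fh_scv, fh_zero]
    by_cases hξ : 2 ^ (k+2) < |ξ|
    · rw [d2_zero hΦ hξ, mul_zero]
    push Not at hξ
    rw [hk_supp hφ hab, zero_mul]
    intro h
    have := h.2
    have := (abs_le.1 hξ).1
    linarith
  have hk0 : (0:ℝ) < 2 ^ k := by positivity
  have hj0 : (0:ℝ) < 2 ^ j := by positivity
  have hkj' : (2:ℝ) ^ k ≤ 2 ^ (j - 1) := zpow_le_zpow_right₀ (by norm_num) (by omega)
  have hL' : (2:ℝ) ^ k ≤ b - a := by linarith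
  have hb : |b| ≤ 4 * 2 ^ k := by
    rw [abs_of_nonpos hb0]
    rw [zpow_add₀ (by norm_num)] at hb1
    norm_num at hb1
    linarith
  have hv := h1 k (b - a) b hL' hb
  set v := scv (modS b (dil (b - a) (modS (-1) φ))) (dil (2 ^ k) (dil 2 Φ)) with hvd
  have e : scv (modS a (hk φ Φ (b - a) j)) (dil (2 ^ k) (dil 2 Φ))
      = scv v (modS a (dil (2 ^ j) Φ)) - scv v (modS a (dil (2 ^ (j-1)) Φ)) := by
    apply fh_inj
    intro ξ
    have : fh φ ((ξ - a) / (b - a)) = fh φ ((ξ - b) / (b - a) + 1) := by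
      congr 1
      field_simp [(sub_pos.2 hab).ne']
      ring
    simp only [hvd, fh_sub, fh_scv, fh_modS, hk, psS_eq, fh_dil (sub_pos.2 hab), this,
      sub_neg_eq_add]
    ring
  have hB : (2 ^ k / (b - a)) ^ A ≤ 2 ^ A * ((2:ℝ) ^ (k - j)) ^ A := by
    rw [← mul_pow]
    have : (0:ℝ) ≤ 2 ^ k / (b - a) := by have := sub_pos.2 hab; positivity
    gcongr
    rw [div_le_iff₀ (sub_pos.2 hab), zpow_sub₀ (by norm_num)]
    rw [zpow_sub_one₀ (by norm_num)] at hL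
    calc (2:ℝ) ^ k = 2 * (2 ^ k / 2 ^ j) * (2 ^ j * 2⁻¹) := by field_simp
      _ ≤ _ := by gcongr
  intro t
  have hBn : 0 ≤ C1 * (2 ^ k / (b - a)) ^ A := by have := sub_pos.2 hab; positivity
  have b1 := h2 k _ v a (2 ^ j) hBn (by
    have : (2:ℝ) ^ k ≤ 2 ^ j := zpow_le_zpow_right₀ (by norm_num) (by omega)
    linarith) hv t
  have b2 := h2 k _ v a (2 ^ (j-1)) hBn (by linarith) hv t
  rw [e, SchwartzMap.sub_apply]
  refine (norm_sub_le _ _).trans ?_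
  calc _ ≤ 2 * (C2 * (C1 * (2 ^ k / (b - a)) ^ A) * kr k t) := by linarith
    _ ≤ 2 * (C2 * (C1 * (2 ^ A * ((2:ℝ) ^ (k - j)) ^ A)) * kr k t) := by
        have := hkr t
        gcongr
    _ = _ := by ring

lemma kr_le_kw (k : ℤ) (t : ℝ) : ENNReal.ofReal (kr k t) ≤ kw k t := by
  unfold kr kw
  refine ENNReal.ofReal_le_ofReal ?_
  have : (0:ℝ) < 2 ^ k := by positivity
  have h1 : 1 ≤ 1 + 2 ^ k * |t| := by
    have : 0 ≤ 2 ^ k * |t| := by positivity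
    linarith
  gcongr
  norm_num

lemma bern1 {Φ : SchwartzMap ℝ ℂ} (hΦ : LP Φ) : ∃ C : ℝ≥0∞, C ≠ ∞ ∧ ∀ (f : SchwartzMap ℝ ℂ)
    (k : ℤ) (y : ℝ), ‖scv f (psS Φ k) y‖ₑ ≤ C * kav k (fun z => ‖scv f (psS Φ k) z‖ₑ) y := by
  obtain ⟨C, hC, h⟩ := dil_bound (dil 2 Φ)
  refine ⟨ENNReal.ofReal C, ENNReal.ofReal_ne_top, fun f k y => ?_⟩
  conv_lhs => rw [← d2_repr hΦ f k, scv_apply]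
  refine (enorm_integral_le_lintegral_enorm _).trans ?_
  rw [kav, ← lintegral_const_mul' _ _ ENNReal.ofReal_ne_top]
  refine lintegral_mono fun z => ?_
  simp only
  rw [enorm_mul, mul_comm, ← mul_assoc]
  refine mul_le_mul_left ?_ _
  refine le_trans ?_ (mul_le_mul_right (kr_le_kw k (y - z)) _)
  rw [← ENNReal.ofReal_mul hC, ← ofReal_norm]
  exact ENNReal.ofReal_le_ofReal (h k _).1

lemma bern2 {Φ : SchwartzMap ℝ ℂ} (hΦ : LP Φ) {r : ℝ} (hr : 1 < r) : ∃ C : ℝ≥0∞, C ≠ ∞ ∧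
    ∀ (f : SchwartzMap ℝ ℂ) (k : ℤ) (y : ℝ),
    ‖scv f (psS Φ k) y‖ₑ ^ r ≤ C * kav k (fun z => ‖scv f (psS Φ k) z‖ₑ ^ r) y := by
  obtain ⟨C, hC, h⟩ := bern1 hΦ
  refine ⟨C ^ r * 16 ^ (r - 1), ENNReal.mul_ne_top (ENNReal.rpow_ne_top_of_nonneg (by linarith) hC)
    (ENNReal.rpow_ne_top_of_nonneg (by linarith) (by norm_num)), fun f k y => ?_⟩
  refine (ENNReal.rpow_le_rpow (h f k y) (by linarith)).trans ?_
  rw [ENNReal.mul_rpow_of_nonneg _ _ (by linarith), mul_assoc]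
  exact mul_le_mul_right (kav_jensen k (sch_meas _) hr y) _

lemma kw_comp {i k : ℤ} (hik : i ≤ k) (x y z : ℝ) :
    kw k (y - z) ≤ ENNReal.ofReal ((2:ℝ) ^ (k - i)) * ENNReal.ofReal ((1 + 2 ^ i * |x - y|) ^ 2)
      * kw i (x - z) := by
  unfold kw
  rw [← ENNReal.ofReal_mul (by positivity), ← ENNReal.ofReal_mul (by positivity)]
  refine ENNReal.ofReal_le_ofReal ?_
  have hi : (0:ℝ) < 2 ^ i := by positivity
  have hk : (0:ℝ) < 2 ^ k := by positivity
  have hik' : (2:ℝ) ^ i ≤ 2 ^ k := zpow_le_zpow_right₀ (by norm_num) hik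
  have h1 : 1 + 2 ^ i * |x - z| ≤ (1 + 2 ^ i * |x - y|) * (1 + 2 ^ k * |y - z|) := by
    have h2 : |x - z| ≤ |x - y| + |y - z| := abs_sub_le _ _ _
    have h3 : 2 ^ i * |x - z| ≤ 2 ^ i * |x - y| + 2 ^ k * |y - z| := by
      calc _ ≤ 2 ^ i * (|x - y| + |y - z|) := by gcongr
        _ = 2 ^ i * |x - y| + 2 ^ i * |y - z| := by ring
        _ ≤ _ := by gcongr
    have : 0 ≤ 2 ^ i * |x - y| * (2 ^ k * |y - z|) := by positivity
    nlinarith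
  rw [zpow_sub₀ (by norm_num)]
  have e : (2:ℝ) ^ k / 2 ^ i * (1 + 2 ^ i * |x - y|) ^ 2 * (2 ^ i / (1 + 2 ^ i * |x - z|) ^ 2)
      = 2 ^ k * (1 + 2 ^ i * |x - y|) ^ 2 / (1 + 2 ^ i * |x - z|) ^ 2 := by field_simp
  rw [e, div_le_div_iff₀ (by positivity) (by positivity), mul_assoc, ← mul_pow]
  gcongr

lemma bern {Φ : SchwartzMap ℝ ℂ} (hΦ : LP Φ) {r : ℝ} (hr : 1 < r) (hr2 : r < 2) :
    ∃ C : ℝ≥0∞, C ≠ ∞ ∧ ∀ (f : SchwartzMap ℝ ℂ) (i k : ℤ) (_ : i ≤ k) (x : ℝ),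
    ∫⁻ y, k4 i (x - y) * ‖scv f (psS Φ k) y‖ₑ ^ 2 ≤
      C * ENNReal.ofReal ((2:ℝ) ^ (k - i)) ^ ((2 - r) / r)
        * kav i (fun z => ‖scv f (psS Φ k) z‖ₑ ^ r) x ^ (2 / r) := by
  obtain ⟨C, hC, h⟩ := bern2 hΦ hr
  set θ := (2 - r) / r with hθ
  have hθ0 : 0 ≤ θ := div_nonneg (by linarith) (by linarith)
  have hθ1 : θ ≤ 1 := by rw [hθ, div_le_one (by linarith)]; linarith
  refine ⟨C ^ θ, ENNReal.rpow_ne_top_of_nonneg hθ0 hC, fun f i k hik x => ?_⟩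
  set F : ℝ → ℝ≥0∞ := fun z => ‖scv f (psS Φ k) z‖ₑ with hF
  set X := kav i (fun z => F z ^ r) x with hX
  set D := ENNReal.ofReal ((2:ℝ) ^ (k - i)) with hD
  have hFm : Measurable F := sch_meas _
  have h3 : ∀ y, F y ^ r ≤ C * D * X * ENNReal.ofReal ((1 + 2 ^ i * |x - y|) ^ 2) := by
    intro y
    refine (h f k y).trans ?_
    calc C * kav k (fun z => F z ^ r) y
        ≤ C * (D * ENNReal.ofReal ((1 + 2 ^ i * |x - y|) ^ 2) * X) := by
          refine mul_le_mul_right ?_ _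
          rw [hX, kav, kav, ← lintegral_const_mul' _ _ (ENNReal.mul_ne_top ENNReal.ofReal_ne_top
            ENNReal.ofReal_ne_top)]
          refine lintegral_mono fun z => ?_
          simp only
          rw [← mul_assoc]
          exact mul_le_mul_left (kw_comp hik x y z) _
      _ = _ := by ring
  have h4 : ∀ y, k4 i (x - y) * F y ^ 2 ≤ (C * D * X) ^ θ * (kw i (x - y) * F y ^ r) := by
    intro y
    have e1 : F y ^ 2 = (F y ^ r) ^ θ * F y ^ r := by
      rw [← ENNReal.rpow_mul, ← ENNReal.rpow_add_of_nonneg _ _ (by positivity) (by linarith),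
        ← ENNReal.rpow_natCast]
      congr 1
      rw [hθ]; push_cast; field_simp; ring
    have e2 : k4 i (x - y) * ENNReal.ofReal ((1 + 2 ^ i * |x - y|) ^ 2) = kw i (x - y) := by
      unfold k4 kw
      rw [← ENNReal.ofReal_mul (by positivity)]
      congr 1
      have : 0 < 1 + 2 ^ i * |x - y| := by positivity
      field_simp
    have h5 : (F y ^ r) ^ θ ≤ (C * D * X) ^ θ * ENNReal.ofReal ((1 + 2 ^ i * |x - y|) ^ 2) := by
      refine (ENNReal.rpow_le_rpow (h3 y) hθ0).trans ?_
      rw [ENNReal.mul_rpow_of_nonneg _ _ hθ0]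
      refine mul_le_mul_right ?_ _
      have h1 : (1:ℝ≥0∞) ≤ ENNReal.ofReal ((1 + 2 ^ i * |x - y|) ^ 2) := by
        rw [ENNReal.one_le_ofReal]
        have : 0 ≤ 2 ^ i * |x - y| := by positivity
        nlinarith
      calc _ ≤ ENNReal.ofReal ((1 + 2 ^ i * |x - y|) ^ 2) ^ (1:ℝ) :=
            ENNReal.rpow_le_rpow_of_exponent_le h1 hθ1
        _ = _ := ENNReal.rpow_one _
    rw [e1, ← e2]
    calc _ ≤ k4 i (x - y) * (((C * D * X) ^ θ * ENNReal.ofReal ((1 + 2 ^ i * |x - y|) ^ 2))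
          * F y ^ r) := by gcongr
      _ = _ := by ring
  calc _ ≤ ∫⁻ y, (C * D * X) ^ θ * (kw i (x - y) * F y ^ r) := lintegral_mono h4
    _ = (C * D * X) ^ θ * X := by
        rw [lintegral_const_mul]
        · rfl
        · have := kw_meas i
          exact (this.comp (measurable_const.sub measurable_id)).mul (hFm.pow_const _)
    _ = _ := by
        rw [ENNReal.mul_rpow_of_nonneg _ _ hθ0, ENNReal.mul_rpow_of_nonneg _ _ hθ0, mul_assoc]
        congr 1
        nth_rw 2 [← ENNReal.rpow_one X]
        rw [← ENNReal.rpow_add_of_nonneg _ _ hθ0 (by norm_num)]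
        congr 1
        rw [hθ]; field_simp; ring

/-- growth/decay factor -/
noncomputable def ee (τ : ℝ) (A : ℕ) (l : ℤ) : ℝ≥0∞ :=
  ENNReal.ofReal (if 0 ≤ l then (2:ℝ) ^ ((l:ℝ) * τ) else ((2:ℝ) ^ l) ^ A)

lemma k4_comp {k j : ℤ} (h1 : j ≤ k + 3) (h2 : k ≤ j) (t : ℝ) : k4 j t ≤ 8 * k4 k t := by
  unfold k4
  rw [show (8:ℝ≥0∞) = ENNReal.ofReal 8 by norm_num, ← ENNReal.ofReal_mul (by norm_num)]
  refine ENNReal.ofReal_le_ofReal ?_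
  rw [mul_div_assoc']
  have h3 : (2:ℝ) ^ j ≤ 8 * 2 ^ k := by
    have : (2:ℝ) ^ j ≤ 2 ^ (k + 3) := zpow_le_zpow_right₀ (by norm_num) h1
    rw [zpow_add₀ (by norm_num)] at this
    norm_num at this
    linarith
  have h4 : (2:ℝ) ^ k ≤ 2 ^ j := zpow_le_zpow_right₀ (by norm_num) h2
  gcongr

lemma Gsq {φ Φ : SchwartzMap ℝ ℂ} (hφ : PH φ) (hΦ : LP Φ) {r : ℝ} (hr : 1 < r) (hr2 : r < 2)
    (A : ℕ) : ∃ C : ℝ≥0∞, C ≠ ∞ ∧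
    ∀ (N : ℕ) (a b : Fin N → ℝ), Admissible a b → ∀ (f : SchwartzMap ℝ ℂ) (j k : ℤ) (x : ℝ),
    ∑ m, ‖scv (scv f (psS Φ k)) (uk φ Φ a b m j) x‖ₑ ^ 2 ≤
      C * ee ((2 - r) / (2 * r)) A (k - j) ^ 2
        * kav (min j k) (fun z => ‖scv f (psS Φ k) z‖ₑ ^ r) x ^ (2 / r) := by
  obtain ⟨B, hB, hBk⟩ := hk_bound hφ hΦ
  obtain ⟨C1, hC1, h1⟩ := bern hΦ hr hr2
  obtain ⟨C2, hC2, h2⟩ := KS hφ hΦ A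
  set K1 := ENNReal.ofReal (64 * B ^ 2) * C1 with hK1
  set K2 := ENNReal.ofReal (64 * B ^ 2) * 8 * C1 * ENNReal.ofReal (64 ^ A) with hK2
  set K3 := ENNReal.ofReal (64 * C2 ^ 2) * C1 with hK3
  have hK1t : K1 ≠ ∞ := ENNReal.mul_ne_top ENNReal.ofReal_ne_top hC1
  have hK2t : K2 ≠ ∞ := ENNReal.mul_ne_top (ENNReal.mul_ne_top (ENNReal.mul_ne_top
    ENNReal.ofReal_ne_top (by norm_num)) hC1) ENNReal.ofReal_ne_top
  have hK3t : K3 ≠ ∞ := ENNReal.mul_ne_top ENNReal.ofReal_ne_top hC1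
  refine ⟨K1 + K2 + K3, ENNReal.add_ne_top.2 ⟨ENNReal.add_ne_top.2 ⟨hK1t, hK2t⟩, hK3t⟩,
    fun N a b hab f j k x => ?_⟩
  set fk := scv f (psS Φ k) with hfk
  have hBL : ∑ m, ‖scv fk (uk φ Φ a b m j) x‖ₑ ^ 2
      ≤ ENNReal.ofReal (64 * B ^ 2) * ∫⁻ t, k4 j (x - t) * ‖fk t‖ₑ ^ 2 :=
    BL (fun m => uk φ Φ a b m j) (fun m => Set.Icc (a m) (b m)) (fun m => isClosed_Icc) hab.2.2
      (fun m ξ hξ => hk_supp hφ (hab.1 m) j ξ hξ) j B hB (fun m t => by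
        rw [uk, norm_modS]
        exact (hBk _ j (sub_pos.2 (hab.1 m)) t).1) fk x
  rcases le_or_gt 0 (k - j) with hl | hl
  · have hmin : min j k = j := min_eq_left (by omega)
    rw [hmin]
    have he : ENNReal.ofReal ((2:ℝ) ^ (k - j)) ^ ((2 - r) / r) = ee ((2 - r) / (2 * r)) A (k - j) ^ 2 := by
      unfold ee
      rw [if_pos hl, ENNReal.ofReal_rpow_of_pos (by positivity), ← ENNReal.ofReal_pow (by positivity),
        ← Real.rpow_natCast, ← Real.rpow_mul (by norm_num), ← Real.rpow_intCast,
        ← Real.rpow_mul (by norm_num)]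
      congr 2
      push_cast
      field_simp
    refine hBL.trans ((mul_le_mul_right (h1 f j k (by omega) x) _).trans ?_)
    rw [he, ← mul_assoc, ← mul_assoc]
    refine mul_le_mul_left (mul_le_mul_left ?_ _) _
    rw [add_assoc]; exact le_self_add
  have hmin : min j k = k := min_eq_right (by omega)
  rw [hmin]
  have hb := h1 f k k le_rfl x
  rw [sub_self, zpow_zero, ENNReal.ofReal_one, ENNReal.one_rpow, mul_one] at hb
  set X := kav k (fun z => ‖fk z‖ₑ ^ r) x ^ (2 / r)
  rcases le_or_gt (-3) (k - j) with hl3 | hl3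
  · have h3 : ∫⁻ t, k4 j (x - t) * ‖fk t‖ₑ ^ 2 ≤ 8 * (C1 * X) := by
      refine le_trans ?_ (mul_le_mul_right hb 8)
      rw [← lintegral_const_mul' _ _ (by norm_num)]
      refine lintegral_mono fun t => ?_
      simp only
      rw [← mul_assoc]
      exact mul_le_mul_left (k4_comp (by omega) (by omega) _) _
    have h4 : 1 ≤ ENNReal.ofReal (64 ^ A) * ee ((2 - r) / (2 * r)) A (k - j) ^ 2 := by
      unfold ee
      rw [if_neg (by omega), ← ENNReal.ofReal_pow (by positivity), ← ENNReal.ofReal_mul (by positivity),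
        ENNReal.one_le_ofReal, ← pow_mul, mul_comm A 2, pow_mul, ← mul_pow]
      refine one_le_pow₀ ?_
      have : (2:ℝ) ^ (-3:ℤ) ≤ 2 ^ (k - j) := zpow_le_zpow_right₀ (by norm_num) hl3
      norm_num at this
      nlinarith
    calc _ ≤ ENNReal.ofReal (64 * B ^ 2) * (8 * (C1 * X)) := hBL.trans (mul_le_mul_right h3 _)
      _ = ENNReal.ofReal (64 * B ^ 2) * 8 * C1 * 1 * X := by ring
      _ ≤ ENNReal.ofReal (64 * B ^ 2) * 8 * C1 *
          (ENNReal.ofReal (64 ^ A) * ee ((2 - r) / (2 * r)) A (k - j) ^ 2) * X :=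
          mul_le_mul_left (mul_le_mul_right h4 _) _
      _ = K2 * ee ((2 - r) / (2 * r)) A (k - j) ^ 2 * X := by rw [hK2]; ring
      _ ≤ _ := by
          refine mul_le_mul_left (mul_le_mul_left ?_ _) _
          rw [add_comm K1 K2, add_assoc]; exact le_self_add
  · set θ := dil (2 ^ k) (dil 2 Φ)
    set E := C2 * ((2:ℝ) ^ (k - j)) ^ A with hE
    have e1 : ∀ m, scv fk (uk φ Φ a b m j) = scv fk (scv (uk φ Φ a b m j) θ) := by
      intro m
      rw [scv_comm (uk φ Φ a b m j) θ, ← scv_assoc, d2_repr hΦ]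
    have hBL2 : ∑ m, ‖scv fk (scv (uk φ Φ a b m j) θ) x‖ₑ ^ 2
        ≤ ENNReal.ofReal (64 * E ^ 2) * ∫⁻ t, k4 k (x - t) * ‖fk t‖ₑ ^ 2 :=
      BL (fun m => scv (uk φ Φ a b m j) θ) (fun m => Set.Icc (a m) (b m)) (fun m => isClosed_Icc)
        hab.2.2 (fun m ξ hξ => by
          rw [fh_scv, uk, hk_supp hφ (hab.1 m) j ξ hξ, zero_mul]) k E (by positivity)
        (fun m t => h2 (a m) (b m) j k (hab.1 m) (hab.2.1 m) (by omega) t) fk x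
    simp only [← e1] at hBL2
    refine hBL2.trans ((mul_le_mul_right hb _).trans ?_)
    have e3 : ENNReal.ofReal (64 * E ^ 2)
        = ENNReal.ofReal (64 * C2 ^ 2) * ee ((2 - r) / (2 * r)) A (k - j) ^ 2 := by
      unfold ee
      rw [if_neg (by omega), ← ENNReal.ofReal_pow (by positivity), ← ENNReal.ofReal_mul (by positivity),
        hE, mul_pow, mul_assoc]
    calc _ = K3 * ee ((2 - r) / (2 * r)) A (k - j) ^ 2 * X := by rw [e3, hK3]; ring
      _ ≤ _ := by
          refine mul_le_mul_left (mul_le_mul_left ?_ _) _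
          exact le_add_self

lemma fin_mink {N : ℕ} (J : Finset ℤ) (z : Fin N → ℤ → ℂ) :
    (∑ m, ‖∑ k ∈ J, z m k‖ₑ ^ 2) ^ (1/2:ℝ) ≤ ∑ k ∈ J, (∑ m, ‖z m k‖ₑ ^ 2) ^ (1/2:ℝ) := by
  classical
  induction J using Finset.induction_on with
  | empty => simp
  | insert k J hk ih =>
    simp only [Finset.sum_insert hk]
    have h1 := ENNReal.Lp_add_le Finset.univ (fun m => ‖z m k‖ₑ) (fun m => ‖∑ k ∈ J, z m k‖ₑ)
      (p := 2) (by norm_num)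
    simp only [ENNReal.rpow_ofNat] at h1
    refine le_trans ?_ (h1.trans (add_le_add_right ih _))
    refine ENNReal.rpow_le_rpow (Finset.sum_le_sum fun m _ => ?_) (by norm_num)
    gcongr
    exact enorm_add_le _ _

open Filter Topology in
lemma G_le {φ Φ : SchwartzMap ℝ ℂ} (hΦ : LP Φ) {N : ℕ} (a b : Fin N → ℝ) (f : SchwartzMap ℝ ℂ)
    (j : ℤ) (x : ℝ) :
    (∑ m, ‖scv f (uk φ Φ a b m j) x‖ₑ ^ 2) ^ (1/2:ℝ)
      ≤ ∑' k : ℤ, (∑ m, ‖scv (scv f (psS Φ k)) (uk φ Φ a b m j) x‖ₑ ^ 2) ^ (1/2:ℝ) := by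
  have hc : ∀ m k, scv (scv f (psS Φ k)) (uk φ Φ a b m j)
      = scv (scv f (uk φ Φ a b m j)) (psS Φ k) := by
    intro m k
    rw [scv_assoc, scv_comm (psS Φ k), ← scv_assoc]
  simp only [hc]
  have hlim : Tendsto (fun n : ℕ => (∑ m, ‖∑ k ∈ Finset.Icc (-(n:ℤ)) n,
      scv (scv f (uk φ Φ a b m j)) (psS Φ k) x‖ₑ ^ 2) ^ (1/2:ℝ)) atTop
      (𝓝 ((∑ m, ‖scv f (uk φ Φ a b m j) x‖ₑ ^ 2) ^ (1/2:ℝ))) := by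
    refine Tendsto.ennrpow_const _ (tendsto_finsetSum _ fun m _ => ?_)
    exact ENNReal.Tendsto.pow (lp_conv hΦ (scv f (uk φ Φ a b m j)) x).enorm
  refine le_of_tendsto' hlim fun n => ?_
  exact (fin_mink _ _).trans (ENNReal.sum_le_tsum _)

lemma two_rpow (y : ℝ) : (2:ℝ≥0∞) ^ y = ENNReal.ofReal ((2:ℝ) ^ y) := by
  rw [← ENNReal.ofReal_rpow_of_pos (by norm_num)]; norm_num

lemma ee_le {s τ : ℝ} {A : ℕ} (hτ : τ < s) (hA : s < A) :
    ∃ ρ : ℝ, 0 ≤ ρ ∧ ρ < 1 ∧ ∀ l : ℤ, (2:ℝ≥0∞) ^ (-((l:ℝ) * s)) * ee τ A l ≤ gz ρ l := by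
  refine ⟨max (2 ^ (-(s - τ))) (2 ^ (-(A - s))), le_max_of_le_left (by positivity), max_lt ?_ ?_,
    fun l => ?_⟩
  · exact Real.rpow_lt_one_of_one_lt_of_neg (by norm_num) (by linarith)
  · exact Real.rpow_lt_one_of_one_lt_of_neg (by norm_num) (by linarith)
  · unfold ee gz
    rw [two_rpow, ← ENNReal.ofReal_mul (by positivity)]
    refine ENNReal.ofReal_le_ofReal ?_
    split_ifs with hl
    · calc _ = ((2:ℝ) ^ (-(s - τ))) ^ l.natAbs := by
            rw [← Real.rpow_natCast, ← Real.rpow_mul (by norm_num), ← Real.rpow_add (by norm_num)]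
            congr 1
            have : ((l.natAbs : ℕ) : ℝ) = (l : ℝ) := by
              rw [← Int.cast_natCast, Int.natAbs_of_nonneg hl]
            rw [this]; ring
        _ ≤ _ := by gcongr; exact le_max_left _ _
    · calc _ = ((2:ℝ) ^ (-(A - s))) ^ l.natAbs := by
            rw [← Real.rpow_natCast ((2:ℝ) ^ l) A, ← Real.rpow_natCast _ l.natAbs,
              ← Real.rpow_intCast, ← Real.rpow_mul (by norm_num), ← Real.rpow_mul (by norm_num),
              ← Real.rpow_add (by norm_num)]
            congr 1
            have : ((l.natAbs : ℕ) : ℝ) = -(l : ℝ) := by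
              rw [← Int.cast_natCast, Int.ofNat_natAbs_of_nonpos (by omega)]; push_cast; ring
            rw [this]; ring
        _ ≤ _ := by gcongr; exact le_max_right _ _

theorem case_pos {φ Φ : SchwartzMap ℝ ℂ} (hφ : PH φ) (hΦ : LP Φ) {p s : ℝ} {q : ℝ≥0∞}
    (hp : 2 ≤ p) (hq : 2 ≤ q) (hs : 0 < s) : ∃ C : ℝ≥0∞, C ≠ ∞ ∧
    ∀ (N : ℕ) (a b : Fin N → ℝ), Admissible a b → ∀ f : SchwartzMap ℝ ℂ,
    (∫⁻ x : ℝ, (lqNorm q fun j : ℤ => (2 : ℝ≥0∞) ^ ((j : ℝ) * s) *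
        (∑ m, ‖scv f (uk φ Φ a b m j) x‖ₑ ^ 2) ^ (1/2 : ℝ)) ^ p) ^ (1/p)
      ≤ C * (∫⁻ x : ℝ, (lqNorm q fun k : ℤ =>
          (2 : ℝ≥0∞) ^ ((k : ℝ) * s) * ‖scv f (psS Φ k) x‖ₑ) ^ p) ^ (1/p) := by
  -- choice of the parameters
  set τ : ℝ := min s (1/2) / 2 with hτ
  have hτ0 : 0 < τ := by have : 0 < min s (1/2) := lt_min hs (by norm_num); positivity
  have hτs : τ < s := by have : min s (1/2) ≤ s := min_le_left _ _; linarith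
  have hτ4 : τ ≤ 1/4 := by have : min s (1/2) ≤ 1/2 := min_le_right _ _; linarith
  set r : ℝ := 1 / (1/2 + τ) with hr
  have hr1 : 1 < r := by rw [hr, lt_div_iff₀ (by linarith)]; linarith
  have hr2 : r < 2 := by rw [hr, div_lt_iff₀ (by linarith)]; linarith
  have hr0 : 0 < r := by linarith
  have hrτ : (2 - r) / (2 * r) = τ := by rw [hr]; field_simp; ring
  obtain ⟨A, hA⟩ := exists_nat_gt s
  obtain ⟨ρ, hρ0, hρ1, hρ⟩ := ee_le hτs hA
  obtain ⟨C1, hC1, hG⟩ := Gsq hφ hΦ hr1 hr2 A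
  have hα : 1 < p / r := by rw [lt_div_iff₀ hr0]; linarith
  have hβ : 1 < q / ENNReal.ofReal r := by
    rw [ENNReal.lt_div_iff_mul_lt (Or.inl (by simpa using hr0)) (Or.inl ENNReal.ofReal_ne_top),
      one_mul]
    refine lt_of_lt_of_le ?_ hq
    rw [show (2:ℝ≥0∞) = ENNReal.ofReal 2 by norm_num]
    exact (ENNReal.ofReal_lt_ofReal_iff (by norm_num)).2 hr2
  obtain ⟨C2, hC2, hVV⟩ := VV hα hβ
  have hq1 : 1 ≤ q := le_trans (by norm_num) hq
  have hq0 : q ≠ 0 := fun h => by rw [h] at hq1; simp at hq1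
  set S := ∑' l : ℤ, gz ρ l
  have hS : S ≠ ∞ := gz_sum hρ0 hρ1
  have hp0 : 0 < p := by linarith
  obtain ⟨D, hD⟩ : ∃ D, D = C1 ^ (1/2:ℝ) := ⟨_, rfl⟩
  have hDt : D ≠ ∞ := hD ▸ ENNReal.rpow_ne_top_of_nonneg (by norm_num) hC1
  refine ⟨D * C2 ^ (1/p) * S, ENNReal.mul_ne_top (ENNReal.mul_ne_top hDt
    (ENNReal.rpow_ne_top_of_nonneg (by positivity) hC2)) hS, fun N a b hab f => ?_⟩
  set F : ℤ → ℝ → ℝ≥0∞ := fun k x => (2 : ℝ≥0∞) ^ ((k : ℝ) * s) * ‖scv f (psS Φ k) x‖ₑ with hF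
  have hFm : ∀ k, Measurable (F k) := fun k => (sch_meas _).const_mul _
  set E : ℤ → ℤ → ℝ → ℝ≥0∞ := fun l j x => kav (min j (j + l)) (fun z => F (j + l) z ^ r) x with hE
  have hEm : ∀ l j, Measurable (E l j) := fun l j => kav_meas _ ((hFm _).pow_const _)
  have hkavF : ∀ i k x, kav i (fun z => F k z ^ r) x ^ (1/r)
      = (2 : ℝ≥0∞) ^ ((k : ℝ) * s) * kav i (fun z => ‖scv f (psS Φ k) z‖ₑ ^ r) x ^ (1/r) := by
    intro i k x
    have : kav i (fun z => F k z ^ r) x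
        = ((2 : ℝ≥0∞) ^ ((k : ℝ) * s)) ^ r * kav i (fun z => ‖scv f (psS Φ k) z‖ₑ ^ r) x := by
      unfold kav
      rw [← lintegral_const_mul]
      · refine lintegral_congr fun z => ?_
        simp only [hF]
        rw [ENNReal.mul_rpow_of_nonneg _ _ hr0.le]; ring
      · exact ((kw_meas i).comp (measurable_const.sub measurable_id)).mul ((sch_meas _).pow_const _)
    rw [this, ENNReal.mul_rpow_of_nonneg _ _ (by positivity), ← ENNReal.rpow_mul,
      mul_one_div_cancel hr0.ne', ENNReal.rpow_one]
  -- pointwise estimate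
  have hpt : ∀ (x : ℝ) (j : ℤ), (2 : ℝ≥0∞) ^ ((j : ℝ) * s) * (∑ m, ‖scv f (uk φ Φ a b m j) x‖ₑ ^ 2) ^ (1/2 : ℝ)
      ≤ ∑' l : ℤ, D * gz ρ l * E l j x ^ (1/r) := by
    intro x j
    refine (mul_le_mul_right (G_le hΦ a b f j x) _).trans ?_
    rw [← ENNReal.tsum_mul_left, ← (Equiv.addLeft j).tsum_eq]
    refine ENNReal.tsum_le_tsum fun l => ?_
    simp only [Equiv.coe_addLeft]
    have h1 := ENNReal.rpow_le_rpow (hG N a b hab f j (j + l) x) (by norm_num : (0:ℝ) ≤ 1/2)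
    rw [ENNReal.mul_rpow_of_nonneg _ _ (by norm_num), ENNReal.mul_rpow_of_nonneg _ _ (by norm_num),
      ← ENNReal.rpow_natCast (ee _ _ _), ← ENNReal.rpow_mul, ← ENNReal.rpow_mul, hrτ,
      add_sub_cancel_left, show 2 / r * (1/2) = 1 / r by field_simp,
      show ((2:ℕ):ℝ) * (1/2) = 1 by norm_num, ENNReal.rpow_one] at h1
    rw [hE]
    simp only
    rw [hkavF]
    refine (mul_le_mul_right h1 _).trans ?_
    set Y := kav (min j (j + l)) (fun z => ‖scv f (psS Φ (j + l)) z‖ₑ ^ r) x ^ (1/r)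
    have e : (2 : ℝ≥0∞) ^ ((j : ℝ) * s)
        = 2 ^ (-((l:ℝ) * s)) * 2 ^ (((j + l : ℤ) : ℝ) * s) := by
      rw [← ENNReal.rpow_add _ _ (by norm_num) (by norm_num)]
      congr 1; push_cast; ring
    calc _ = D * (2 ^ (-((l:ℝ) * s)) * ee τ A l) * (2 ^ (((j + l : ℤ) : ℝ) * s) * Y) := by
          rw [e, hD]; ring
      _ ≤ _ := mul_le_mul_left (mul_le_mul_right (hρ l) _) _
  set H : ℤ → ℝ → ℝ≥0∞ := fun l x => lqNorm q (fun j => E l j x ^ (1/r)) with hH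
  have hHm : ∀ l, Measurable (H l) := fun l => lqNorm_meas fun j => (hEm l j).pow_const _
  have hlq : ∀ x, lqNorm q (fun j : ℤ => (2 : ℝ≥0∞) ^ ((j : ℝ) * s) *
      (∑ m, ‖scv f (uk φ Φ a b m j) x‖ₑ ^ 2) ^ (1/2 : ℝ)) ≤ ∑' l, D * gz ρ l * H l x := by
    intro x
    refine (lqNorm_mono (hpt x)).trans ((lqNorm_tsum hq1 _).trans (le_of_eq ?_))
    refine tsum_congr fun l => ?_
    rw [lqNorm_const_mul hq1]
  have hHint : ∀ l, ∫⁻ x, H l x ^ p ≤ C2 * ∫⁻ x, (lqNorm q fun k : ℤ => F k x) ^ p := by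
    intro l
    have h := hVV (fun j => min j (j + l)) (fun j z => F (j + l) z ^ r) fun j => (hFm _).pow_const _
    have e1 : ∀ x, H l x ^ p
        = lqNorm (q / ENNReal.ofReal r) (fun j => E l j x) ^ (p / r) := by
      intro x
      simp only [hH]
      rw [lqNorm_rpow hq0 hr0, ← ENNReal.rpow_mul]
      congr 1; ring
    have e2 : ∀ x, lqNorm (q / ENNReal.ofReal r) (fun j => F (j + l) x ^ r) ^ (p / r)
        = (lqNorm q fun k : ℤ => F k x) ^ p := by
      intro x
      rw [lqNorm_shift (q / ENNReal.ofReal r) l (fun k => F k x ^ r)]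
      have := lqNorm_rpow hq0 hr0 (fun k => F k x ^ r)
      simp only [← ENNReal.rpow_mul, mul_one_div_cancel hr0.ne', ENNReal.rpow_one] at this
      rw [this, ← ENNReal.rpow_mul]
      congr 1; ring
    simp only [e2] at h
    simp only [e1]
    exact h
  calc _ ≤ (∫⁻ x, (∑' l, D * gz ρ l * H l x) ^ p) ^ (1/p) := by
        refine ENNReal.rpow_le_rpow (lintegral_mono fun x => ?_) (by positivity)
        exact ENNReal.rpow_le_rpow (hlq x) hp0.le
    _ ≤ ∑' l, (∫⁻ x, (D * gz ρ l * H l x) ^ p) ^ (1/p) :=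
        minkowski volume (by linarith) (fun l x => D * gz ρ l * H l x) fun l => (hHm l).const_mul _
    _ ≤ ∑' l, D * gz ρ l * (C2 ^ (1/p) * (∫⁻ x, (lqNorm q fun k : ℤ => F k x) ^ p) ^ (1/p)) := by
        refine ENNReal.tsum_le_tsum fun l => ?_
        simp only [ENNReal.mul_rpow_of_nonneg _ _ hp0.le]
        rw [lintegral_const_mul _ ((hHm l).pow_const _),
          ENNReal.mul_rpow_of_nonneg _ _ (by positivity : 0 ≤ 1/p),
          ENNReal.mul_rpow_of_nonneg _ _ (by positivity : 0 ≤ 1/p), ← ENNReal.rpow_mul,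
          ← ENNReal.rpow_mul, mul_one_div_cancel hp0.ne', ENNReal.rpow_one, ENNReal.rpow_one,
          ← ENNReal.mul_rpow_of_nonneg _ _ (by positivity : 0 ≤ 1/p)]
        exact mul_le_mul_right (ENNReal.rpow_le_rpow (hHint l) (by positivity)) _
    _ = _ := by
        rw [ENNReal.tsum_mul_right, ENNReal.tsum_mul_left]; ring

theorem statement5 (φ Φ : SchwartzMap ℝ ℂ)
    (hφ : Function.support (𝓕 ⇑φ) ⊆ Set.Ioo 0 1)
    (hΦsupp : Function.support (𝓕 ⇑Φ) ⊆ Set.Icc (-2) 2)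
    (hΦone : ∀ ξ ∈ Set.Icc (-1:ℝ) 1, 𝓕 ⇑Φ ξ = 1)
    (p : ℝ) (q : ℝ≥0∞) (s : ℝ) (hp : 2 ≤ p) (hq : 2 ≤ q)
    (hs : 0 < s ∨ (s = 0 ∧ q = 2)) :
    ∃ C : ℝ, 0 < C ∧ ∀ (N : ℕ) (a b : Fin N → ℝ), Admissible a b →
      ∀ f : SchwartzMap ℝ ℂ,
        (∫⁻ x : ℝ, (lqNorm q fun j : ℤ =>
            (2 : ℝ≥0∞) ^ ((j : ℝ) * s) *
              (∑ m : Fin N,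
                (‖conv (rotConv ⇑φ (a m) (b m) ⇑f) (psi ⇑Φ j) x‖₊ : ℝ≥0∞) ^ 2) ^ (1/2 : ℝ)) ^ p)
          ^ (1/p)
        ≤ ENNReal.ofReal C *
          (∫⁻ x : ℝ, (lqNorm q fun j : ℤ =>
              (2 : ℝ≥0∞) ^ ((j : ℝ) * s) * (‖conv ⇑f (psi ⇑Φ j) x‖₊ : ℝ≥0∞)) ^ p) ^ (1/p) := by
  have hP : PH φ := hφ
  have hL : LP Φ := ⟨hΦsupp, hΦone⟩
  have hp0 : 0 < p := by linarith
  have main : ∃ C : ℝ≥0∞, C ≠ ∞ ∧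
    ∀ (N : ℕ) (a b : Fin N → ℝ), Admissible a b → ∀ f : SchwartzMap ℝ ℂ,
    (∫⁻ x : ℝ, (lqNorm q fun j : ℤ => (2 : ℝ≥0∞) ^ ((j : ℝ) * s) *
        (∑ m, ‖scv f (uk φ Φ a b m j) x‖ₑ ^ 2) ^ (1/2 : ℝ)) ^ p) ^ (1/p)
      ≤ C * (∫⁻ x : ℝ, (lqNorm q fun k : ℤ =>
          (2 : ℝ≥0∞) ^ ((k : ℝ) * s) * ‖scv f (psS Φ k) x‖ₑ) ^ p) ^ (1/p) := by
    rcases hs with hs | ⟨rfl, rfl⟩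
    · exact case_pos hP hL hp hq hs
    · obtain ⟨C, hC, h⟩ := case_zero hP hL hp
      refine ⟨C ^ (1/p), ENNReal.rpow_ne_top_of_nonneg (by positivity) hC, fun N a b hab f => ?_⟩
      have e1 : ∀ x, (lqNorm 2 fun j : ℤ => (2 : ℝ≥0∞) ^ ((j : ℝ) * 0) *
          (∑ m, ‖scv f (uk φ Φ a b m j) x‖ₑ ^ 2) ^ (1/2 : ℝ)) ^ p
          = (∑' j : ℤ, ∑ m, ‖scv f (uk φ Φ a b m j) x‖ₑ ^ 2) ^ (p / 2) := by
        intro x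
        simp only [lqNorm, if_neg (by norm_num : (2:ℝ≥0∞) ≠ ∞), mul_zero, ENNReal.rpow_zero, one_mul,
          ← ENNReal.rpow_mul, ENNReal.toReal_ofNat]
        congr 1
        · refine tsum_congr fun j => ?_
          norm_num
        · ring
      have e2 : ∀ x, (lqNorm 2 fun k : ℤ =>
          (2 : ℝ≥0∞) ^ ((k : ℝ) * 0) * ‖scv f (psS Φ k) x‖ₑ) ^ p
          = (∑' k : ℤ, ‖scv f (psS Φ k) x‖ₑ ^ 2) ^ (p / 2) := by
        intro x
        simp only [lqNorm, if_neg (by norm_num : (2:ℝ≥0∞) ≠ ∞), mul_zero, ENNReal.rpow_zero, one_mul,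
          ← ENNReal.rpow_mul, ENNReal.toReal_ofNat]
        congr 1
        · refine tsum_congr fun j => ?_
          norm_num
        · ring
      simp only [e1, e2]
      rw [← ENNReal.mul_rpow_of_nonneg _ _ (by positivity)]
      exact ENNReal.rpow_le_rpow (h N a b hab f) (by positivity)
  obtain ⟨C, hC, h⟩ := main
  refine ⟨C.toReal + 1, by positivity, fun N a b hab f => ?_⟩
  have hl : ∀ (x : ℝ) (j : ℤ) (m : Fin N),
      (‖conv (rotConv ⇑φ (a m) (b m) ⇑f) (psi ⇑Φ j) x‖₊ : ℝ≥0∞)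
        = ‖scv f (uk φ Φ a b m j) x‖ₑ := by
    intro x j m
    rw [main_conv, ← enorm_eq_nnnorm, enorm_e2pi_mul]; rfl
  have hr : ∀ (x : ℝ) (j : ℤ), (‖conv ⇑f (psi ⇑Φ j) x‖₊ : ℝ≥0∞) = ‖scv f (psS Φ j) x‖ₑ := by
    intro x j
    rw [← psS_coe, ← scv_conv, ← enorm_eq_nnnorm]
  simp only [hl, hr]
  refine (h N a b hab f).trans (mul_le_mul_left ?_ _)
  rw [← ENNReal.ofReal_toReal hC]
  refine ENNReal.ofReal_le_ofReal ?_
  simp
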